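/- Let n ≥ 3 and let a₀, a₁, …, aₙ be rational integers with a₀ ≠ 0 such that the polynomial a₀·Xⁿ + a₁·X^(n−1) + ⋯ + aₙ has at least three simple complex zeroes, and set H = max{|a₀|, …, |aₙ|}. Then all rational integers x, y with y² = a₀·xⁿ + a₁·x^(n−1) + ⋯ + aₙ satisfy max{|x|, |y|} < exp(exp(exp((n^(10n)·H)^(n²)))). -/

import Mathlib

namespace BakerHyperelliptic
open Finset

/-- If the values of `w` below `#ι` are attained at most once, then `∑ w ≥ 0 + 1 + ⋯ + (#ι - 1)`. -/
lemma sum_ge_of_injOn_lt_card {ι : Type*} [Fintype ι] (w : ι → ℕ)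
    (hw : ∀ i j, w i = w j → w i < Fintype.card ι → i = j) :
    (Fintype.card ι : ℝ) * (Fintype.card ι - 1) / 2 ≤ ∑ i, (w i : ℝ) := by
  classical
  set N := Fintype.card ι with hN
  have h1 : ∀ m ∈ range N, N - (m + 1) ≤ #{i | m < w i} := by
    intro m hm
    have h2 : #{i | ¬ m < w i} ≤ m + 1 := by
      rw [← card_range (m + 1)]
      apply card_le_card_of_injOn w
      · intro i hi
        simp at hi ⊢
        omega
      · intro i hi j hj hij
        simp at hi hm
        exact hw i j hij (by omega)
    have h3 := card_filter_add_card_filter_not (s := (univ : Finset ι)) (fun i => m < w i)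
    rw [card_univ, ← hN] at h3
    omega
  have h2 : ∑ m ∈ range N, (N - (m + 1)) ≤ ∑ i, w i := by
    calc ∑ m ∈ range N, (N - (m + 1)) ≤ ∑ m ∈ range N, #{i | m < w i} := sum_le_sum h1
      _ = ∑ m ∈ range N, ∑ i, if m < w i then 1 else 0 := by simp only [card_filter]
      _ = ∑ i, ∑ m ∈ range N, if m < w i then 1 else 0 := sum_comm
      _ ≤ ∑ i, w i := by
        apply sum_le_sum
        intro i _
        rw [← card_filter]
        calc _ ≤ #(range (w i)) := card_le_card (by intro m; simp)
          _ = w i := card_range _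
  have h3 : ∑ m ∈ range N, (N - (m + 1)) = ∑ m ∈ range N, m := by
    rw [← sum_range_reflect (fun m => m) N]
    exact sum_congr rfl fun m hm => by omega
  have h4 : (∑ m ∈ range N, (m : ℝ)) = (N : ℝ) * (N - 1) / 2 := by
    clear h1 h2 h3
    generalize N = M
    induction M with
    | zero => simp
    | succ k ih => rw [sum_range_succ, ih]; push_cast; ring
  rw [← h4, ← Nat.cast_sum, ← Nat.cast_sum, ← h3]
  exact_mod_cast h2

/-- Laurent's bound for an interpolation determinant with finitely many monomials. -/
lemma norm_det_le_of_finset {ι A : Type*} [Fintype ι] [DecidableEq ι] (s : Finset A) (w : A → ℕ)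
    (hw : ∀ a b, w a = w b → w a < Fintype.card ι → a = b) (c U : ι → A → ℂ) (X : A → ℝ)
    (hX : ∀ a, 0 ≤ X a) (hU : ∀ i a, ‖U i a‖ ≤ X a * Real.exp (-(w a))) :
    ‖(Matrix.of fun i j => ∑ a ∈ s, c j a * U i a).det‖ ≤
      (Fintype.card ι).factorial *
        Real.exp (-((Fintype.card ι : ℝ) * (Fintype.card ι - 1) / 2)) *
        ∏ j, ∑ a ∈ s, ‖c j a‖ * X a := by
  classical
  set N := Fintype.card ι with hN
  have key : (Matrix.of fun i j => ∑ a ∈ s, c j a * U i a).det =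
      ∑ f ∈ Fintype.piFinset fun _ : ι => s,
        (∏ j, c j (f j)) * (Matrix.of fun i j => U i (f j)).det := by
    simp_rw [Matrix.det_apply', Matrix.of_apply, prod_univ_sum, mul_sum]
    rw [sum_comm]
    refine sum_congr rfl fun f _ => sum_congr rfl fun σ _ => ?_
    rw [prod_mul_distrib]; ring
  rw [key, prod_univ_sum, mul_sum]
  refine (norm_sum_le _ _).trans (sum_le_sum fun f _ => ?_)
  rw [norm_mul, norm_prod, prod_mul_distrib, mul_left_comm]
  refine mul_le_mul_of_nonneg_left ?_ (prod_nonneg fun _ _ => norm_nonneg _)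
  by_cases hf : Function.Injective f
  · have h1 : (N : ℝ) * (N - 1) / 2 ≤ ∑ i, (w (f i) : ℝ) :=
      sum_ge_of_injOn_lt_card (fun i => w (f i)) fun i j hij hlt => hf (hw _ _ hij hlt)
    rw [Matrix.det_apply']
    calc _ ≤ ∑ σ : Equiv.Perm ι, (∏ j, X (f j)) * Real.exp (-∑ i, (w (f i) : ℝ)) := by
          refine (norm_sum_le _ _).trans (sum_le_sum fun σ _ => ?_)
          rw [norm_mul, norm_prod]
          have : ‖((Equiv.Perm.sign σ : ℤ) : ℂ)‖ = 1 := by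
            rcases Int.units_eq_one_or (Equiv.Perm.sign σ) with h | h <;> simp [h]
          rw [this, one_mul, ← sum_neg_distrib, Real.exp_sum, ← prod_mul_distrib]
          exact prod_le_prod (fun _ _ => norm_nonneg _) fun i _ => hU _ _
      _ = N.factorial * (Real.exp (-∑ i, (w (f i) : ℝ)) * ∏ j, X (f j)) := by
          rw [sum_const, card_univ, Fintype.card_perm, nsmul_eq_mul]; ring
      _ ≤ _ := by
          rw [mul_assoc]
          gcongr
          exact prod_nonneg fun _ _ => hX _
  · have : (Matrix.of fun i j => U i (f j)).det = 0 := by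
      simp only [Function.Injective, not_forall] at hf
      obtain ⟨i, j, hij, hne⟩ := hf
      exact Matrix.det_zero_of_column_eq hne fun k => by simp [hij]
    rw [this, norm_zero]
    have := prod_nonneg (s := univ) fun j (_ : j ∈ univ) => hX (f j)
    positivity

lemma norm_det_le_of_hasSum {ι A : Type*} [Fintype ι] [DecidableEq ι] (w : A → ℕ)
    (hw : ∀ a b, w a = w b → w a < Fintype.card ι → a = b) (c U : ι → A → ℂ) (X : A → ℝ)
    (hX : ∀ a, 0 ≤ X a) (hU : ∀ i a, ‖U i a‖ ≤ X a * Real.exp (-(w a)))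
    (M : Matrix ι ι ℂ) (hM : ∀ i j, HasSum (fun a => c j a * U i a) (M i j))
    (Y : ι → ℝ) (hY : ∀ j s, ∑ a ∈ s, ‖c j a‖ * X a ≤ Y j) :
    ‖M.det‖ ≤ (Fintype.card ι).factorial *
        Real.exp (-((Fintype.card ι : ℝ) * (Fintype.card ι - 1) / 2)) * ∏ j, Y j := by
  have h1 : Filter.Tendsto (fun s : Finset A => (Matrix.of fun i j => ∑ a ∈ s, c j a * U i a))
      Filter.atTop (nhds M) :=
    tendsto_pi_nhds.2 fun i => tendsto_pi_nhds.2 fun j => hM i j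
  have h2 := ((Continuous.matrix_det continuous_id).tendsto M).comp h1
  refine le_of_tendsto h2.norm (Filter.Eventually.of_forall fun s => ?_)
  refine (norm_det_le_of_finset s w hw c U X hX hU).trans ?_
  refine mul_le_mul_of_nonneg_left ?_ (by positivity)
  exact prod_le_prod (fun j _ => sum_nonneg fun a _ => mul_nonneg (norm_nonneg _) (hX a))
    fun j _ => hY j s


lemma hasSum_mul_prod {𝕜 : Type*} [NormedField 𝕜] [CompleteSpace 𝕜] {f g : ℕ → 𝕜} {a b : 𝕜}
    (hf : HasSum f a) (hg : HasSum g b) (hf' : Summable fun n => ‖f n‖)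
    (hg' : Summable fun n => ‖g n‖) : HasSum (fun p : ℕ × ℕ => f p.1 * g p.2) (a * b) :=
  hf.mul hg (summable_mul_of_summable_norm hf' hg')

lemma hasSum_pow_mul_exp {𝕜 : Type*} [NormedField 𝕜] [CompleteSpace 𝕜] (e : 𝕜 → 𝕜)
    (h0 : ∀ z : 𝕜, HasSum (fun n : ℕ => z ^ n / n.factorial) (e z))
    (hn : ∀ z : 𝕜, Summable fun n : ℕ => ‖z ^ n / n.factorial‖)
    (he : ∀ z w, e (z + w) = e z * e w) (k : ℕ) (x y t s : 𝕜) :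
    HasSum (fun a : ℕ × ℕ => ((if k ≤ a.1 then x ^ (a.1 - k) / (a.1 - k).factorial else 0) *
      (y ^ a.2 / a.2.factorial)) * (t ^ a.1 * s ^ a.2)) (t ^ k * e (x * t + y * s)) := by
  obtain ⟨f, hf⟩ : ∃ f : ℕ → 𝕜, f = fun a =>
    (if k ≤ a then x ^ (a - k) / (a - k).factorial else 0) * t ^ a := ⟨_, rfl⟩
  have hfk : (fun n => f (n + k)) = fun n => t ^ k * ((x * t) ^ n / n.factorial) := by
    funext n
    simp only [hf]
    rw [if_pos (Nat.le_add_left k n), Nat.add_sub_cancel, pow_add, mul_pow]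
    ring
  have h1 : HasSum f (t ^ k * e (x * t)) := by
    rw [← hasSum_nat_add_iff' k]
    have : ∑ i ∈ range k, f i = 0 :=
      sum_eq_zero fun i hi => by
        simp only [hf]
        rw [if_neg (by simpa using hi), zero_mul]
    rw [this, sub_zero, hfk]
    exact (h0 (x * t)).mul_left (t ^ k)
  have h1n : Summable fun a : ℕ => ‖f a‖ := by
    rw [← summable_nat_add_iff k]
    have : (fun n => ‖f (n + k)‖) = fun n => ‖t ^ k‖ * ‖(x * t) ^ n / n.factorial‖ := by
      funext n
      rw [← norm_mul]
      exact congrArg norm (congrFun hfk n)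
    rw [this]
    exact (hn (x * t)).mul_left ‖t ^ k‖
  have h3 := hasSum_mul_prod h1 (h0 (y * s)) h1n (hn (y * s))
  rw [mul_assoc, ← he] at h3
  have h4 : (fun a : ℕ × ℕ => ((if k ≤ a.1 then x ^ (a.1 - k) / (a.1 - k).factorial else 0) *
      (y ^ a.2 / a.2.factorial)) * (t ^ a.1 * s ^ a.2)) =
      fun a : ℕ × ℕ => f a.1 * ((y * s) ^ a.2 / a.2.factorial) := by
    funext a
    simp only [hf, mul_pow]
    ring
  rw [h4]
  exact h3

lemma norm_det_exp_le {ι : Type*} [Fintype ι] [DecidableEq ι] (k l t s : ι → ℕ) (K L : ℕ)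
    (τ S : ℝ) (x Λ : ℂ) (hk : ∀ j, k j ≤ K) (hl : ∀ j, l j ≤ L) (ht : ∀ i, (t i : ℝ) ≤ τ)
    (hs : ∀ i, (s i : ℝ) ≤ S) (hτ : 1 ≤ τ) (hS : 0 ≤ S) :
    ‖(Matrix.of fun i j : ι =>
      (t i : ℂ) ^ k j * Complex.exp (l j * (t i * x + s i * Λ))).det‖ ≤
      (Fintype.card ι).factorial *
        Real.exp (-((Fintype.card ι : ℝ) * (Fintype.card ι - 1) / 2)) *
        ((Real.exp 1 * τ) ^ K * Real.exp (Real.exp 1 * L * τ * ‖x‖ +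
          L * S * ‖Λ‖ * Real.exp (Fintype.card ι))) ^ (Fintype.card ι) := by
  set N := Fintype.card ι with hN
  have he : 1 ≤ Real.exp 1 * τ := by
    have := Real.add_one_le_exp (1 : ℝ)
    nlinarith
  have key := norm_det_le_of_hasSum (ι := ι) (A := ℕ × ℕ)
    (fun a => if a.2 = 0 then a.1 else N) ?_
    (fun j a => (if k j ≤ a.1 then (l j * x) ^ (a.1 - k j) / (a.1 - k j).factorial else 0) *
      ((l j * Λ) ^ a.2 / a.2.factorial))
    (fun i a => (t i : ℂ) ^ a.1 * (s i : ℂ) ^ a.2)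
    (fun a => (Real.exp 1 * τ) ^ a.1 * (S * Real.exp N) ^ a.2) (fun a => by positivity) ?_
    (Matrix.of fun i j : ι => (t i : ℂ) ^ k j * Complex.exp (l j * (t i * x + s i * Λ))) ?_
    (fun _ => (Real.exp 1 * τ) ^ K * Real.exp (Real.exp 1 * L * τ * ‖x‖ +
          L * S * ‖Λ‖ * Real.exp N)) ?_
  · simpa using key
  · rintro ⟨a, μ⟩ ⟨b, ν⟩ h1 h2
    simp only at h1 h2
    split_ifs at h1 h2 <;> first | omega | (simp; omega)
  · rintro i ⟨a, μ⟩
    rw [norm_mul, norm_pow, norm_pow, Complex.norm_natCast, Complex.norm_natCast]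
    have h1 : (t i : ℝ) ^ a ≤ τ ^ a := pow_le_pow_left₀ (by positivity) (ht i) _
    have h2 : (s i : ℝ) ^ μ ≤ S ^ μ := pow_le_pow_left₀ (by positivity) (hs i) _
    refine (mul_le_mul h1 h2 (by positivity) (by positivity)).trans ?_
    dsimp only
    split_ifs with h
    · rw [h, mul_pow, ← Real.exp_nat_mul, mul_one, pow_zero, pow_zero, mul_one, mul_one,
        mul_right_comm, ← Real.exp_add]
      simp
    · rw [mul_pow, mul_pow, ← Real.exp_nat_mul, ← Real.exp_nat_mul]
      have h3 : 1 ≤ Real.exp (a * 1) * Real.exp (μ * N) * Real.exp (-N) := by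
        rw [← Real.exp_add, ← Real.exp_add, Real.one_le_exp_iff]
        have : (1 : ℝ) ≤ μ := by exact_mod_cast Nat.one_le_iff_ne_zero.2 h
        have h4 : (0 : ℝ) ≤ N := by positivity
        have h5 : (0 : ℝ) ≤ a := by positivity
        nlinarith
      have h6 : 0 ≤ τ ^ a * S ^ μ := by positivity
      nlinarith
  · intro i j
    have h := hasSum_pow_mul_exp Complex.exp
      (fun z => by rw [Complex.exp_eq_exp_ℂ]; exact NormedSpace.expSeries_div_hasSum_exp z)
      (fun z => NormedSpace.norm_expSeries_div_summable z) Complex.exp_add (k j) (l j * x) (l j * Λ)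
          (t i : ℂ) (s i)
    rwa [show (l j * x * t i + l j * Λ * s i : ℂ) = l j * (t i * x + s i * Λ) by ring] at h
  · intro j fs
    have h := hasSum_pow_mul_exp Real.exp
      (fun z => by rw [Real.exp_eq_exp_ℝ]; exact NormedSpace.expSeries_div_hasSum_exp z)
      (fun z => NormedSpace.norm_expSeries_div_summable z) Real.exp_add (k j) (‖(l j * x)‖)
          (‖l j * Λ‖) (Real.exp 1 * τ)
      (S * Real.exp N)
    have h1 : ∀ a : ℕ × ℕ,
        ‖(if k j ≤ a.1 then (l j * x) ^ (a.1 - k j) / ((a.1 - k j).factorial : ℂ) else 0) *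
        ((l j * Λ) ^ a.2 / a.2.factorial)‖ * ((Real.exp 1 * τ) ^ a.1 * (S * Real.exp N) ^ a.2) =
        ((if k j ≤ a.1 then ‖(l j * x)‖ ^ (a.1 - k j) / ((a.1 - k j).factorial : ℝ) else 0) *
        (‖l j * Λ‖ ^ a.2 / a.2.factorial)) * ((Real.exp 1 * τ) ^ a.1 * (S * Real.exp N) ^ a.2) := by
      intro a
      congr 1
      rw [norm_mul, norm_div, norm_pow, Complex.norm_natCast]
      split_ifs
      · rw [norm_div, norm_pow, Complex.norm_natCast]
      · simp
    have hl' : (l j : ℝ) ≤ L := by exact_mod_cast hl j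
    calc _ ≤ (Real.exp 1 * τ) ^ k j * Real.exp (‖(l j * x)‖ * (Real.exp 1 * τ) +
          ‖l j * Λ‖ * (S * Real.exp N)) := by
          refine (sum_congr rfl fun a _ => h1 a).trans_le (sum_le_hasSum _ (fun a _ => ?_) h)
          split_ifs <;> positivity
      _ ≤ _ := by
          have h2 : ‖(l j * x)‖ * (Real.exp 1 * τ) ≤ Real.exp 1 * L * τ * ‖x‖ := by
            rw [norm_mul, Complex.norm_natCast]
            calc _ = (l j : ℝ) * (‖x‖ * (Real.exp 1 * τ)) := by ring
              _ ≤ L * (‖x‖ * (Real.exp 1 * τ)) := by gcongr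
              _ = _ := by ring
          have h3 : ‖l j * Λ‖ * (S * Real.exp N) ≤ L * S * ‖Λ‖ * Real.exp N := by
            rw [norm_mul, Complex.norm_natCast]
            calc _ = (l j : ℝ) * (‖Λ‖ * (S * Real.exp N)) := by ring
              _ ≤ L * (‖Λ‖ * (S * Real.exp N)) := by gcongr
              _ = _ := by ring
          exact mul_le_mul (pow_le_pow_right₀ he (hk j))
            (Real.exp_le_exp.2 (add_le_add h2 h3)) (by positivity) (by positivity)


lemma exists_submatrix_det_ne_zero {m n F : Type*} [Fintype n] [DecidableEq n] [Field F]
    (A : Matrix m n F) (h : ∀ v, A.mulVec v = 0 → v = 0) :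
    ∃ e : n → m, (A.submatrix e id).det ≠ 0 := by
  have hspan : Submodule.span F (Set.range A) = ⊤ := by
    by_contra hne
    obtain ⟨f, hf, hle⟩ := Submodule.exists_le_ker_of_lt_top _ (lt_top_iff_ne_top.2 hne)
    apply hf
    have h1 := h (fun j => f (Pi.single j 1)) (by
      funext i
      have h2 : f (A i) = 0 := hle (Submodule.subset_span ⟨i, rfl⟩)
      rw [pi_eq_sum_univ' (A i), map_sum] at h2
      simp only [map_smul, smul_eq_mul] at h2
      simpa [Matrix.mulVec, dotProduct] using h2)
    refine LinearMap.pi_ext' fun j => LinearMap.ext_ring ?_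
    simpa using congrFun h1 j
  obtain ⟨f, hf, hs, hli⟩ := Submodule.exists_fun_fin_finrank_span_eq F (Set.range A)
  have hcard : Fintype.card n = Module.finrank F (Submodule.span F (Set.range A)) := by
    rw [hspan, finrank_top, Module.finrank_fintype_fun_eq_card]
  let σ : n ≃ Fin _ := Fintype.equivFinOfCardEq hcard
  choose e he using hf
  refine ⟨fun i => e (σ i), ?_⟩
  have h1 : LinearIndependent F (A.submatrix (fun i => e (σ i)) id) := by
    have : A.submatrix (fun i => e (σ i)) id = f ∘ σ := by
      funext i
      exact he (σ i)
    rw [this]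
    exact hli.comp _ σ.injective
  have h2 := Matrix.linearIndependent_rows_iff_isUnit.1 h1
  exact ((Matrix.isUnit_iff_isUnit_det _).1 h2).ne_zero

open Polynomial in
lemma det_comp_add_ne_zero {I F : Type*} [Fintype I] [DecidableEq I] [Field F] (Q : I → F[X])
    (hQ : ∀ l, Q l ≠ 0) (t : I → F) (B : Matrix I I F) (hB : B.det ≠ 0) :
    (Matrix.of fun j l => C (B j l) * (Q l).comp (X + C (t j))).det ≠ 0 ∧
    (Matrix.of fun j l => C (B j l) * (Q l).comp (X + C (t j))).det.natDegree ≤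
      ∑ l, (Q l).natDegree := by
  have hc : ∀ l j, ((Q l).comp (X + C (t j))) ≠ 0 := fun l j h => by
    rw [comp_eq_zero_iff] at h
    rcases h with h | h
    · exact hQ l h
    · have := congrArg natDegree h.2
      simp at this
  have hd : ∀ σ : Equiv.Perm I, (∏ l, (Q l).comp (X + C (t (σ l)))).natDegree =
      ∑ l, (Q l).natDegree := fun σ => by
    rw [natDegree_prod _ _ fun l _ => hc l _]
    simp [natDegree_comp]
  have hl : ∀ σ : Equiv.Perm I, (∏ l, (Q l).comp (X + C (t (σ l)))).coeff (∑ l, (Q l).natDegree) =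
      ∏ l, (Q l).leadingCoeff := fun σ => by
    rw [← hd σ, coeff_natDegree, leadingCoeff_prod]
    refine prod_congr rfl fun l _ => ?_
    rw [leadingCoeff_comp (by simp)]
    simp
  have hdet : (Matrix.of fun j l => C (B j l) * (Q l).comp (X + C (t j))).det =
      ∑ σ : Equiv.Perm I, C (((Equiv.Perm.sign σ : ℤ) : F) * ∏ l, B (σ l) l) *
        ∏ l, (Q l).comp (X + C (t (σ l))) := by
    rw [Matrix.det_apply']
    refine sum_congr rfl fun σ _ => ?_
    simp only [Matrix.of_apply, prod_mul_distrib, C_mul, map_prod, map_intCast]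
    ring
  rw [hdet]
  refine ⟨fun h => ?_, ?_⟩
  · have := congrArg (fun p => coeff p (∑ l, (Q l).natDegree)) h
    simp only [finsetSum_coeff, coeff_C_mul, hl, coeff_zero, ← sum_mul, ← Matrix.det_apply'] at this
    exact mul_ne_zero hB (prod_ne_zero_iff.2 fun l _ => leadingCoeff_ne_zero.2 (hQ l)) this
  · refine natDegree_sum_le_of_forall_le _ _ fun σ _ => ?_
    exact (natDegree_C_mul_le _ _).trans (hd σ).le

open Polynomial in
lemma eq_zero_of_vanishing {F : Type*} [Field F] [CharZero F] (w₁ w₂ : F) (hw₁ : w₁ ≠ 0)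
    (hw₂ : w₂ ≠ 0) (K L R S q : ℕ) (hq : R ≤ q) (hRS : K * L ≤ R * S) (p : Fin L → ℕ × ℕ)
    (hp : ∀ i, (p i).1 < L ∧ (p i).2 < L)
    (hpi : Function.Injective fun i => w₁ ^ (p i).1 * w₂ ^ (p i).2) (c : Fin K × Fin L → F)
    (hc : ∀ r < R + L, ∀ s < S + L,
      ∑ j, c j * (((r + q * s : ℕ) : F) ^ (j.1 : ℕ) * (w₁ ^ r * w₂ ^ s) ^ (j.2 : ℕ)) = 0) :
    c = 0 := by
  classical
  by_contra hne
  let Q : Fin L → F[X] := fun l => ∑ k : Fin K, C (c (k, l)) * X ^ (k : ℕ)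
  have hQc : ∀ k l, (Q l).coeff (k : Fin K) = c (k, l) := fun k l => by
    simp only [Q, finsetSum_coeff, coeff_C_mul, coeff_X_pow]
    rw [sum_eq_single k]
    · simp
    · intro b _ hb
      rw [if_neg (fun h => hb (Fin.ext h.symm)), mul_zero]
    · simp
  have hQd : ∀ l, (Q l).natDegree ≤ K - 1 := fun l =>
    natDegree_sum_le_of_forall_le _ _ fun k _ =>
      (natDegree_C_mul_X_pow_le _ _).trans (by omega)
  have hQe : ∀ l x, (Q l).eval x = ∑ k : Fin K, c (k, l) * x ^ (k : ℕ) := fun l x => by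
    simp [Q, eval_finsetSum]
  have hP : ∀ r < R + L, ∀ s < S + L,
      ∑ l : Fin L, (Q l).eval ((r + q * s : ℕ) : F) * (w₁ ^ r * w₂ ^ s) ^ (l : ℕ) = 0 := by
    intro r hr s hs
    rw [← hc r hr s hs, Fintype.sum_prod_type_right]
    refine sum_congr rfl fun l _ => ?_
    rw [hQe, sum_mul]
    exact sum_congr rfl fun k _ => by ring
  let I := {l : Fin L // Q l ≠ 0}
  obtain ⟨⟨k₀, l₀⟩, hk₀⟩ : ∃ j, c j ≠ 0 := by
    by_contra! h
    exact hne (funext h)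
  have hl₀ : Q l₀ ≠ 0 := fun h => hk₀ (by rw [← hQc, h, coeff_zero])
  have hsum : ∀ g : Fin L → F, (∀ l, Q l = 0 → g l = 0) → ∑ l, g l = ∑ l : I, g l := by
    intro g hg
    rw [← sum_subtype (univ.filter fun l => Q l ≠ 0) (by simp) g]
    exact (sum_filter_of_ne (p := fun l => Q l ≠ 0) fun l _ h hl => h (hg l hl)).symm
  let w : Fin L → F := fun i => w₁ ^ (p i).1 * w₂ ^ (p i).2
  obtain ⟨e, he⟩ := exists_submatrix_det_ne_zero (n := I)
    (Matrix.of fun (j : Fin L) (l : I) => w j ^ (l.1 : ℕ)) (fun v hv => by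
      have hdet := Matrix.det_vandermonde_ne_zero_iff.2 hpi
      let v' : Fin L → F := fun l => if h : Q l ≠ 0 then v ⟨l, h⟩ else 0
      have h1 : (Matrix.vandermonde w).mulVec v' = 0 := by
        funext j
        have h2 := congrFun hv j
        simp only [Matrix.mulVec, dotProduct, Matrix.of_apply, Pi.zero_apply] at h2
        simp only [Matrix.mulVec, dotProduct, Matrix.vandermonde_apply, Pi.zero_apply]
        rw [← h2, hsum (fun l => w j ^ (l : ℕ) * v' l) fun l hl => by simp [v', hl]]
        exact sum_congr rfl fun l _ => by simp only [v', dif_pos l.2]; rfl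
      have h3 := Matrix.eq_zero_of_mulVec_eq_zero hdet h1
      funext l
      have := congrFun h3 l.1
      simp only [v', dif_pos l.2, Pi.zero_apply] at this
      exact this)
  obtain ⟨hD, hdeg⟩ := det_comp_add_ne_zero (fun l : I => Q l.1) (fun l => l.2)
    (fun j => (((p (e j)).1 + q * (p (e j)).2 : ℕ) : F)) _ he
  set D := (Matrix.of fun (j l : I) => C (((Matrix.of fun (j : Fin L) (l : I) =>
    w j ^ (l.1 : ℕ)).submatrix e id) j l) *
    (Q l.1).comp (X + C (((p (e j)).1 + q * (p (e j)).2 : ℕ) : F))).det with hDdef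
  have hroot : ∀ r < R, ∀ s < S, D.eval ((r + q * s : ℕ) : F) = 0 := by
    intro r hr s hs
    rw [hDdef, ← coe_evalRingHom, RingHom.map_det, ← Matrix.exists_mulVec_eq_zero_iff]
    refine ⟨fun l => (w₁ ^ r * w₂ ^ s) ^ (l.1 : ℕ), fun h => ?_, ?_⟩
    · have := congrFun h ⟨l₀, hl₀⟩
      simp [hw₁, hw₂] at this
    · funext j
      have hr' := (hp (e j)).1
      have hs' := (hp (e j)).2
      have h1 := hP (r + (p (e j)).1) (by omega) (s + (p (e j)).2) (by omega)
      rw [hsum _ fun l hl => by rw [hl, eval_zero, zero_mul]] at h1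
      rw [Pi.zero_apply, ← h1]
      simp only [Matrix.mulVec, dotProduct, RingHom.mapMatrix_apply, Matrix.map_apply,
        Matrix.of_apply, Matrix.submatrix_apply, id, coe_evalRingHom, eval_mul, eval_C, eval_comp,
        eval_add, eval_X, w]
      refine sum_congr rfl fun l _ => ?_
      rw [mul_comm (_ ^ _) (eval _ _), mul_assoc, ← mul_pow]
      congr 2
      · push_cast
        ring
      · rw [pow_add, pow_add]
        ring
  have hinj : Set.InjOn (fun x : ℕ × ℕ => ((x.1 + q * x.2 : ℕ) : F))
      (range R ×ˢ range S : Finset (ℕ × ℕ)) := by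
    rintro ⟨r, s⟩ h1 ⟨r', s'⟩ h2 h
    simp only [coe_product, Set.mem_prod, coe_range, Set.mem_Iio] at h1 h2
    have h3 : r + q * s = r' + q * s' := by exact Nat.cast_injective (R := F) h
    have hr : r = r' := by
      have := congrArg (· % q) h3
      simpa [Nat.mod_eq_of_lt (h1.1.trans_le hq), Nat.mod_eq_of_lt (h2.1.trans_le hq)] using this
    subst hr
    have hs : s = s' := Nat.eq_of_mul_eq_mul_left (by omega) (Nat.add_left_cancel h3)
    rw [hs]
  have h1 : R * S ≤ D.natDegree := by
    have h2 : ((range R ×ˢ range S).image (fun x : ℕ × ℕ => ((x.1 + q * x.2 : ℕ) : F))).card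
        = R * S := by
      rw [card_image_of_injOn hinj, card_product, card_range, card_range]
    rw [← h2]
    refine (card_le_card fun x hx => ?_).trans
      ((Multiset.toFinset_card_le D.roots).trans (card_roots' D))
    obtain ⟨⟨r, s⟩, hrs, rfl⟩ := mem_image.1 hx
    rw [mem_product, mem_range, mem_range] at hrs
    rw [Multiset.mem_toFinset, mem_roots hD]
    exact hroot r hrs.1 s hrs.2
  have h2 : ∑ l : I, (Q l.1).natDegree ≤ L * (K - 1) := by
    calc _ ≤ ∑ l : I, (K - 1) := sum_le_sum fun l _ => hQd _
      _ = Fintype.card I * (K - 1) := by simp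
      _ ≤ _ := by
        gcongr
        exact (Fintype.card_subtype_le (fun l : Fin L => Q l ≠ 0)).trans (Fintype.card_fin L).le
  have hK := k₀.2
  have hL := l₀.2
  have h3 : L * (K - 1) < K * L := by
    rw [mul_comm]
    exact Nat.mul_lt_mul_of_pos_right (by omega) (by omega)
  omega

lemma exists_interpolation_det_ne_zero {F : Type*} [Field F] [CharZero F] (w₁ w₂ : F)
    (hw₁ : w₁ ≠ 0) (hw₂ : w₂ ≠ 0) (K L R S q : ℕ) (hq : R ≤ q) (hRS : K * L ≤ R * S)
    (p : Fin L → ℕ × ℕ) (hp : ∀ i, (p i).1 < L ∧ (p i).2 < L)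
    (hpi : Function.Injective fun i => w₁ ^ (p i).1 * w₂ ^ (p i).2) :
    ∃ r s : Fin K × Fin L → ℕ, (∀ i, r i < R + L) ∧ (∀ i, s i < S + L) ∧
      (Matrix.of fun i j : Fin K × Fin L => ((r i + q * s i : ℕ) : F) ^ (j.1 : ℕ) *
        (w₁ ^ r i * w₂ ^ s i) ^ (j.2 : ℕ)).det ≠ 0 := by
  obtain ⟨e, he⟩ := exists_submatrix_det_ne_zero
    (Matrix.of fun (i : Fin (R + L) × Fin (S + L)) (j : Fin K × Fin L) =>
      ((i.1 + q * i.2 : ℕ) : F) ^ (j.1 : ℕ) * (w₁ ^ (i.1 : ℕ) * w₂ ^ (i.2 : ℕ)) ^ (j.2 : ℕ))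
    fun c hc => eq_zero_of_vanishing w₁ w₂ hw₁ hw₂ K L R S q hq hRS p hp hpi c
      fun r hr s hs => by
        have := congrFun hc (⟨r, hr⟩, ⟨s, hs⟩)
        rw [Pi.zero_apply] at this
        rw [← this]
        exact sum_congr rfl fun j _ => by rw [mul_comm]; rfl
  exact ⟨fun i => (e i).1, fun i => (e i).2, fun i => (e i).1.2, fun i => (e i).2.2, he⟩


/-- Liouville's inequality. -/
lemma one_le_norm_mul_pow {E : Type*} [Field E] [NumberField E] (φ : E →+* ℂ) (z : E) (hz : z ≠ 0)
    (A X : ℝ) (a : ℤ) (haA : |(a : ℝ)| ≤ A) (ha : a ≠ 0) (hint : IsIntegral ℤ ((a : E) * z))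
    (hX : 1 ≤ X) (hb : ∀ ψ : E →+* ℂ, ‖ψ z‖ ≤ X) :
    1 ≤ ‖φ z‖ * (A * X) ^ Module.finrank ℚ E := by
  classical
  have ha1 : 1 ≤ |(a : ℝ)| := by exact_mod_cast Int.one_le_abs ha
  have hA : 1 ≤ A := ha1.trans haA
  have hne : (a : E) * z ≠ 0 := mul_ne_zero (by exact_mod_cast ha) hz
  have h1 : (1 : ℝ) ≤ ∏ ψ : E →ₐ[ℚ] ℂ, ‖ψ ((a : E) * z)‖ := by
    rw [← norm_prod, ← Algebra.norm_eq_prod_embeddings]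
    obtain ⟨m, hm⟩ := IsIntegrallyClosed.isIntegral_iff.1 (Algebra.isIntegral_norm ℚ hint)
    have hm0 : m ≠ 0 := by
      rintro rfl
      rw [map_zero] at hm
      exact hne (Algebra.norm_eq_zero_iff.1 hm.symm)
    rw [← hm]
    simp only [eq_intCast, map_intCast]
    rw [Complex.norm_intCast]
    exact_mod_cast Int.one_le_abs hm0
  have h2 : ∏ ψ : E →ₐ[ℚ] ℂ, ‖ψ ((a : E) * z)‖ ≤
      ∏ ψ : E →ₐ[ℚ] ℂ, (A * X) * if ψ = φ.toRatAlgHom then ‖φ z‖ else 1 := by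
    refine prod_le_prod (fun _ _ => norm_nonneg _) fun ψ _ => ?_
    rw [map_mul, norm_mul, map_intCast, Complex.norm_intCast]
    split_ifs with h
    · rw [h]
      change |(a : ℝ)| * ‖φ z‖ ≤ _
      have : 1 * ‖φ z‖ ≤ X * ‖φ z‖ := by gcongr
      nlinarith [norm_nonneg (φ z), mul_le_mul haA (le_refl (X * ‖φ z‖)) (by positivity)
          (by positivity)]
    · rw [mul_one]
      exact mul_le_mul haA (hb ψ.toRingHom) (norm_nonneg _) (by positivity)
  rw [prod_mul_distrib, prod_ite_eq' univ, if_pos (mem_univ _), prod_const, card_univ,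
    AlgHom.card ℚ E ℂ] at h2
  linarith

lemma factorial_le_exp (N : ℕ) : (N.factorial : ℝ) ≤ Real.exp (N * Real.log N) := by
  rcases Nat.eq_zero_or_pos N with rfl | hN
  · simp
  · rw [mul_comm, Real.exp_mul, Real.exp_log (by positivity), Real.rpow_natCast]
    exact_mod_cast Nat.factorial_le_pow N

lemma norm_det_le {ι : Type*} [Fintype ι] [DecidableEq ι] (M : Matrix ι ι ℂ) (X : ℝ)
    (h : ∀ i j, ‖M i j‖ ≤ X) : ‖M.det‖ ≤ (Fintype.card ι).factorial * X ^ Fintype.card ι := by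
  have := Matrix.det_le (abv := NormedField.toAbsoluteValue ℂ) h
  rw [nsmul_eq_mul] at this
  exact this

lemma one_lt_of_det_ne_zero {E : Type*} [Field E] [NumberField E] (φ : E →+* ℂ)
    (α₁ α₂ : E) (ℓ₁ ℓ₂ : ℂ) (he₁ : Complex.exp ℓ₁ = φ α₁) (he₂ : Complex.exp ℓ₂ = φ α₂)
    (h₁ h₂ : ℝ) (hh₁ : 0 ≤ h₁) (hh₂ : 0 ≤ h₂) (hi : IsIntegral ℤ α₁) (D : ℕ) (hD : D ≠ 0)
    (hi₂ : IsIntegral ℤ ((D : E) * α₂)) (hDh : (D : ℝ) ≤ Real.exp h₂)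
    (hb₁ : ∀ ψ : E →+* ℂ, ‖ψ α₁‖ ≤ Real.exp h₁) (hb₂ : ∀ ψ : E →+* ℂ, ‖ψ α₂‖ ≤ Real.exp h₂)
    (K L R S q : ℕ) (τ : ℝ) (hτ1 : 1 ≤ τ) (hτ : ((R + q * S : ℕ) : ℝ) ≤ τ)
    (hN : 2 * ((Module.finrank ℚ E + 1) * (Real.log (K * L : ℕ) + K * Real.log τ + K +
      2 * L * (R * h₁ + S * h₂)) + 3 * L * τ * ‖ℓ₁‖ + 1) + 1 < (K * L : ℕ))
    (r s : Fin K × Fin L → ℕ) (hr : ∀ i, r i < R) (hs : ∀ i, s i < S)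
    (hdet : (Matrix.of fun i j : Fin K × Fin L => ((r i + q * s i : ℕ) : E) ^ (j.1 : ℕ) *
        (α₁ ^ r i * α₂ ^ s i) ^ (j.2 : ℕ)).det ≠ 0) :
    1 < L * S * ‖ℓ₂ - q * ℓ₁‖ * Real.exp (K * L : ℕ) := by
  by_contra! hsmall
  set M := (Matrix.of fun i j : Fin K × Fin L => ((r i + q * s i : ℕ) : E) ^ (j.1 : ℕ) *
        (α₁ ^ r i * α₂ ^ s i) ^ (j.2 : ℕ)) with hM
  set Λ := ℓ₂ - q * ℓ₁ with hΛ
  set N := K * L with hNdef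
  set d := Module.finrank ℚ E with hd
  have hcard : Fintype.card (Fin K × Fin L) = N := by simp [hNdef]
  have hti : ∀ i, ((r i + q * s i : ℕ) : ℝ) ≤ τ := fun i => by
    refine le_trans ?_ hτ
    have h1 := (hr i).le
    have h2 := (hs i).le
    exact_mod_cast Nat.add_le_add h1 (Nat.mul_le_mul_left q h2)
  have hφ : φ M.det = (Matrix.of fun i j : Fin K × Fin L => ((r i + q * s i : ℕ) : ℂ) ^ (j.1 : ℕ) *
      Complex.exp ((j.2 : ℕ) * ((r i + q * s i : ℕ) * ℓ₁ + s i * Λ))).det := by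
    rw [RingHom.map_det]
    congr 1
    ext i j
    simp only [RingHom.mapMatrix_apply, Matrix.map_apply, hM, Matrix.of_apply, map_mul, map_pow,
      map_natCast, ← he₁, ← he₂, ← Complex.exp_nat_mul, ← Complex.exp_add]
    congr 2
    rw [hΛ]
    push_cast
    ring
  have hup := norm_det_exp_le (fun j : Fin K × Fin L => (j.1 : ℕ)) (fun j => (j.2 : ℕ))
    (fun i => r i + q * s i) s K L τ S ℓ₁ Λ (fun j => j.1.2.le) (fun j => j.2.2.le) hti
    (fun i => by exact_mod_cast (hs i).le) hτ1 (by positivity)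
  rw [← hφ, hcard] at hup
  have hint : IsIntegral ℤ (((D ^ (S * L * N) : ℕ) : ℤ) * M.det : E) := by
    have h1 : (((D ^ (S * L * N) : ℕ) : ℤ) * M.det : E) = (((D : E) ^ (S * L)) • M).det := by
      rw [Matrix.det_smul, hcard]
      push_cast
      rw [← pow_mul]
    rw [h1]
    refine IsIntegral.det fun i j => ?_
    rw [Matrix.smul_apply, smul_eq_mul, hM, Matrix.of_apply]
    obtain ⟨m, hm⟩ := Nat.exists_eq_add_of_le
      (Nat.mul_le_mul (hs i).le j.2.2.le)
    rw [hm, pow_add, show ((D : E) ^ (s i * (j.2 : ℕ)) * D ^ m * (((r i + q * s i : ℕ) : E) ^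
      (j.1 : ℕ) * (α₁ ^ r i * α₂ ^ s i) ^ (j.2 : ℕ))) = (D : E) ^ m * ((r i + q * s i : ℕ) : E) ^
      (j.1 : ℕ) * ((α₁ ^ r i) * (D * α₂) ^ s i) ^ (j.2 : ℕ) by
        rw [mul_pow, mul_pow, mul_pow, mul_pow, pow_mul]; ring]
    have hnat : ∀ n : ℕ, IsIntegral ℤ (n : E) := fun n => by
      exact_mod_cast (isIntegral_algebraMap (R := ℤ) (A := E) (x := (n : ℤ)))
    exact (((hnat D).pow m).mul ((hnat _).pow _)).mul (((hi.pow _).mul (hi₂.pow _)).pow _)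
  have hψ : ∀ ψ : E →+* ℂ, ‖ψ M.det‖ ≤
      Real.exp (N * (Real.log N + K * Real.log τ + L * (R * h₁ + S * h₂))) := by
    intro ψ
    rw [RingHom.map_det]
    refine (norm_det_le _ (Real.exp (K * Real.log τ + L * (R * h₁ + S * h₂))) fun i j => ?_).trans
        ?_
    · simp only [RingHom.mapMatrix_apply, Matrix.map_apply, hM, Matrix.of_apply, map_mul, map_pow,
        map_natCast, norm_mul, norm_pow, Complex.norm_natCast]
      rw [Real.exp_add]
      refine mul_le_mul ?_ ?_ (by positivity) (by positivity)
      · rw [Real.exp_nat_mul, Real.exp_log (by positivity)]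
        exact (pow_le_pow_left₀ (by positivity) (hti i) _).trans
          (pow_le_pow_right₀ hτ1 j.1.2.le)
      · have hr' : (r i : ℝ) ≤ R := by exact_mod_cast (hr i).le
        have hs' : (s i : ℝ) ≤ S := by exact_mod_cast (hs i).le
        have hj' : ((j.2 : ℕ) : ℝ) ≤ L := by exact_mod_cast j.2.2.le
        calc _ ≤ (Real.exp h₁ ^ r i * Real.exp h₂ ^ s i) ^ (j.2 : ℕ) := by
              gcongr
              · exact hb₁ ψ
              · exact hb₂ ψ
          _ = Real.exp ((j.2 : ℕ) * (r i * h₁ + s i * h₂)) := by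
              rw [← Real.exp_nat_mul, ← Real.exp_nat_mul, ← Real.exp_add, ← Real.exp_nat_mul]
          _ ≤ _ := Real.exp_le_exp.2 (by gcongr)
    · rw [hcard, ← Real.exp_nat_mul]
      refine (mul_le_mul_of_nonneg_right (factorial_le_exp N) (Real.exp_pos _).le).trans ?_
      rw [← Real.exp_add]
      exact Real.exp_le_exp.2 (by apply le_of_eq; ring)
  have hlogτ : 0 ≤ Real.log τ := Real.log_nonneg hτ1
  have hlogN : 0 ≤ Real.log N := Real.log_natCast_nonneg N
  have hlow := one_le_norm_mul_pow φ M.det hdet (Real.exp (N * (L * (S * h₂)))) _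
    ((D ^ (S * L * N) : ℕ) : ℤ) ?_ (by exact_mod_cast pow_ne_zero _ hD) hint
    (Real.one_le_exp (by positivity)) hψ
  swap
  · rw [abs_of_nonneg (by positivity)]
    push_cast
    refine (pow_le_pow_left₀ (by positivity) hDh _).trans ?_
    rw [← Real.exp_nat_mul]
    exact Real.exp_le_exp.2 (by push_cast; apply le_of_eq; ring)
  rw [← Real.exp_add, ← Real.exp_nat_mul] at hlow
  have hup2 : ‖φ M.det‖ ≤ Real.exp (N * (Real.log N - (N - 1) / 2 + K * (1 + Real.log τ) +
      3 * L * τ * ‖ℓ₁‖ + 1)) := by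
    refine hup.trans ?_
    have h1 : (Real.exp 1 * τ) ^ K = Real.exp (K * (1 + Real.log τ)) := by
      rw [Real.exp_nat_mul, Real.exp_add, Real.exp_log (by positivity)]
    rw [h1, ← Real.exp_add, ← Real.exp_nat_mul]
    refine (mul_le_mul_of_nonneg_right (mul_le_mul_of_nonneg_right (factorial_le_exp N)
      (Real.exp_pos _).le) (Real.exp_pos _).le).trans ?_
    rw [← Real.exp_add, ← Real.exp_add]
    refine Real.exp_le_exp.2 ?_
    have h2 : Real.exp 1 * L * τ * ‖ℓ₁‖ ≤ 3 * L * τ * ‖ℓ₁‖ := by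
      have := Real.exp_one_lt_d9
      gcongr
      linarith
    have h3 := mul_le_mul_of_nonneg_left (add_le_add h2 hsmall) (Nat.cast_nonneg (α := ℝ) N)
    nlinarith
  have h3 : 1 ≤ Real.exp (N * (Real.log N - (N - 1) / 2 + K * (1 + Real.log τ) +
      3 * L * τ * ‖ℓ₁‖ + 1) + d * (N * (L * (S * h₂)) +
      N * (Real.log N + K * Real.log τ + L * (R * h₁ + S * h₂)))) := by
    rw [Real.exp_add]
    exact hlow.trans (mul_le_mul_of_nonneg_right hup2 (Real.exp_pos _).le)
  rw [Real.one_le_exp_iff] at h3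
  have hNpos : (0 : ℝ) < N := lt_of_le_of_lt (by positivity) hN
  have h4 : 0 ≤ (Real.log N - (N - 1) / 2 + K * (1 + Real.log τ) +
      3 * L * τ * ‖ℓ₁‖ + 1) + d * ((L * (S * h₂)) +
      (Real.log N + K * Real.log τ + L * (R * h₁ + S * h₂))) := by
    refine nonneg_of_mul_nonneg_right (a := (N : ℝ)) ?_ hNpos
    linarith
  have h5 : (0 : ℝ) ≤ L * (R * h₁ + S * h₂) := by positivity
  have h6 : (0 : ℝ) ≤ d * (L * (R * h₁)) := by positivity
  have h7 : (0 : ℝ) ≤ d * K := by positivity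
  nlinarith

lemma two_log {E : Type*} [Field E] [NumberField E] (φ : E →+* ℂ)
    (α₁ α₂ : E) (ℓ₁ ℓ₂ : ℂ) (he₁ : Complex.exp ℓ₁ = φ α₁) (he₂ : Complex.exp ℓ₂ = φ α₂)
    (h₁ h₂ : ℝ) (hh₁ : 0 ≤ h₁) (hh₂ : 0 ≤ h₂) (hi : IsIntegral ℤ α₁) (D : ℕ) (hD : D ≠ 0)
    (hi₂ : IsIntegral ℤ ((D : E) * α₂)) (hDh : (D : ℝ) ≤ Real.exp h₂)
    (hb₁ : ∀ ψ : E →+* ℂ, ‖ψ α₁‖ ≤ Real.exp h₁) (hb₂ : ∀ ψ : E →+* ℂ, ‖ψ α₂‖ ≤ Real.exp h₂)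
    (K L R S q : ℕ) (τ : ℝ) (hτ1 : 1 ≤ τ) (hτ : ((R + L + q * (S + L) : ℕ) : ℝ) ≤ τ)
    (hq : R ≤ q) (hRS : K * L ≤ R * S) (hα : α₂ ≠ α₁ ^ q)
    (hN : 2 * ((Module.finrank ℚ E + 1) * (Real.log (K * L : ℕ) + K * Real.log τ + K +
      2 * L * ((R + L : ℕ) * h₁ + (S + L : ℕ) * h₂)) + 3 * L * τ * ‖ℓ₁‖ + 1) + 1 < (K * L : ℕ)) :
    1 < L * (S + L : ℕ) * ‖ℓ₂ - q * ℓ₁‖ * Real.exp (K * L : ℕ) := by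
  have hα₁ : α₁ ≠ 0 := fun h => Complex.exp_ne_zero ℓ₁ (by rw [he₁, h, map_zero])
  have hα₂ : α₂ ≠ 0 := fun h => Complex.exp_ne_zero ℓ₂ (by rw [he₂, h, map_zero])
  have main : ∀ p : Fin L → ℕ × ℕ, (∀ i, (p i).1 < L ∧ (p i).2 < L) →
      (Function.Injective fun i => α₁ ^ (p i).1 * α₂ ^ (p i).2) →
      1 < L * (S + L : ℕ) * ‖ℓ₂ - q * ℓ₁‖ * Real.exp (K * L : ℕ) := by
    intro p hp hpi
    obtain ⟨r, s, hr, hs, hdet⟩ := exists_interpolation_det_ne_zero α₁ α₂ hα₁ hα₂ K L R S q hq hRS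
      p hp hpi
    exact one_lt_of_det_ne_zero φ α₁ α₂ ℓ₁ ℓ₂ he₁ he₂ h₁ h₂ hh₁ hh₂ hi D hD hi₂ hDh hb₁ hb₂ K L
      (R + L) (S + L) q τ hτ1 hτ hN r s hr hs hdet
  have tors : ∀ α : E, α ≠ 0 → ¬ (Function.Injective fun i : Fin L => α ^ (i : ℕ)) →
      ∃ a : ℕ, 0 < a ∧ a ≤ L ∧ α ^ a = 1 := by
    intro α hα h
    simp only [Function.Injective, not_forall] at h
    obtain ⟨i, j, hij, hne⟩ := h
    wlog hlt : i < j generalizing i j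
    · exact this j i hij.symm (Ne.symm hne) (lt_of_le_of_ne (not_lt.1 hlt) (Ne.symm hne))
    refine ⟨j - i, by simpa using hlt, by omega, ?_⟩
    have h2 : α ^ (j : ℕ) = α ^ (i : ℕ) * α ^ ((j : ℕ) - i) := by
      rw [← pow_add]
      congr 1
      have : (i : ℕ) < j := hlt
      omega
    have h3 : α ^ (i : ℕ) * α ^ ((j : ℕ) - i) = α ^ (i : ℕ) * 1 := by
      rw [← h2, mul_one]
      exact hij.symm
    exact mul_left_cancel₀ (pow_ne_zero _ hα) h3
  by_cases hinj₁ : Function.Injective fun i : Fin L => α₁ ^ (i : ℕ)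
  · exact main (fun i => (i, 0)) (fun i => ⟨i.2, by have := i.2; dsimp; omega⟩)
      (by simpa using hinj₁)
  by_cases hinj₂ : Function.Injective fun i : Fin L => α₂ ^ (i : ℕ)
  · exact main (fun i => (0, i)) (fun i => ⟨by have := i.2; dsimp; omega, i.2⟩)
      (by simpa using hinj₂)
  obtain ⟨a, ha, haL, ha1⟩ := tors α₁ hα₁ hinj₁
  obtain ⟨b, hb, hbL, hb1⟩ := tors α₂ hα₂ hinj₂
  have h1 : Complex.exp ((a * b : ℕ) * (ℓ₂ - q * ℓ₁)) = 1 := by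
    rw [show ((a * b : ℕ) * (ℓ₂ - q * ℓ₁) : ℂ) = (a : ℂ) * ((b : ℂ) * ℓ₂) -
      ((b * q : ℕ) : ℂ) * ((a : ℂ) * ℓ₁) by push_cast; ring, Complex.exp_sub, Complex.exp_nat_mul,
      Complex.exp_nat_mul, Complex.exp_nat_mul _ (b * q), Complex.exp_nat_mul, he₁, he₂,
          ← map_pow φ α₂,
      ← map_pow φ α₁, hb1, ha1]
    simp
  obtain ⟨k, hk⟩ := Complex.exp_eq_one_iff.1 h1
  have hk0 : k ≠ 0 := by
    rintro rfl
    rw [Int.cast_zero, zero_mul, mul_eq_zero] at hk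
    rcases hk with hk | hk
    · have : a * b ≠ 0 := by positivity
      exact this (by exact_mod_cast hk)
    · apply hα
      apply φ.injective
      rw [map_pow, ← he₁, ← he₂, ← Complex.exp_nat_mul, sub_eq_zero.1 hk]
  have hk1 : (1 : ℝ) ≤ |(k : ℝ)| := by exact_mod_cast Int.one_le_abs hk0
  have h2 : 1 < (a * b : ℕ) * ‖ℓ₂ - q * ℓ₁‖ := by
    have := congrArg norm hk
    rw [norm_mul, norm_mul, Complex.norm_natCast, Complex.norm_intCast] at this
    rw [this]
    have h3 : ‖(2 * Real.pi * Complex.I : ℂ)‖ = 2 * Real.pi := by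
      simp [abs_of_pos Real.pi_pos]
    rw [h3]
    nlinarith [Real.pi_gt_three]
  refine h2.trans_le ?_
  have h4 : ((a * b : ℕ) : ℝ) ≤ L * (S + L : ℕ) := by
    exact_mod_cast Nat.mul_le_mul haL (hbL.trans (by omega))
  calc ((a * b : ℕ) : ℝ) * ‖ℓ₂ - q * ℓ₁‖ ≤ L * (S + L : ℕ) * ‖ℓ₂ - q * ℓ₁‖ := by gcongr
    _ ≤ _ := le_mul_of_one_le_right (by positivity) (Real.one_le_exp (by positivity))


lemma exists_simultaneous_approx {J : Type*} [Fintype J] (b : J → ℤ) (B W : ℕ) (hB : 0 < B)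
    (hW : 0 < W) : ∃ m : ℕ, 0 < m ∧ m ≤ W ^ Fintype.card J ∧
      ∃ p : J → ℤ, ∀ j, |m * b j - B * p j| * W ≤ B := by
  classical
  have hB' : (0 : ℤ) < B := by exact_mod_cast hB
  have hW' : (0 : ℤ) < W := by exact_mod_cast hW
  let f : Fin (W ^ Fintype.card J + 1) → (J → Fin W) := fun i j =>
    ⟨(((i : ℕ) * b j) % B * W / B).toNat, by
      have h1 := Int.emod_lt_of_pos ((i : ℕ) * b j) hB'
      rw [Int.toNat_lt' (by omega)]
      exact Int.ediv_lt_of_lt_mul hB' (by nlinarith)⟩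
  obtain ⟨i, i', hne, hf⟩ := Fintype.exists_ne_map_eq_of_card_lt f (by simp)
  wlog hlt : i < i' generalizing i i'
  · exact this i' i hne.symm hf.symm (lt_of_le_of_ne (not_lt.1 hlt) hne.symm)
  have hlt' : (i : ℕ) < i' := hlt
  refine ⟨i' - i, by omega, by omega, fun j => ((i' : ℕ) * b j) / B - ((i : ℕ) * b j) / B,
    fun j => ?_⟩
  beta_reduce
  have h := congrArg Fin.val (congrFun hf j)
  simp only [f] at h
  have hi := Int.emod_add_mul_ediv ((i : ℕ) * b j) B
  have hi' := Int.emod_add_mul_ediv ((i' : ℕ) * b j) B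
  have hn := Int.emod_nonneg ((i : ℕ) * b j) hB'.ne'
  have hn' := Int.emod_nonneg ((i' : ℕ) * b j) hB'.ne'
  generalize ((i : ℕ) * b j) % (B : ℤ) = ρ at *
  generalize ((i' : ℕ) * b j) % (B : ℤ) = ρ' at *
  generalize ((i : ℕ) * b j) / (B : ℤ) = u at *
  generalize ((i' : ℕ) * b j) / (B : ℤ) = u' at *
  have h0 : 0 ≤ ρ * W / B := Int.ediv_nonneg (by positivity) hB'.le
  have h0' : 0 ≤ ρ' * W / B := Int.ediv_nonneg (by positivity) hB'.le
  have heq : ρ * W / B = ρ' * W / B := by omega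
  have h1 := Int.emod_add_mul_ediv (ρ * W) B
  have h2 := Int.emod_add_mul_ediv (ρ' * W) B
  have h3 := Int.emod_lt_of_pos (ρ * W) hB'
  have h4 := Int.emod_lt_of_pos (ρ' * W) hB'
  have h5 := Int.emod_nonneg (ρ * W) hB'.ne'
  have h6 := Int.emod_nonneg (ρ' * W) hB'.ne'
  rw [heq] at h1
  have h7 : ((i' - i : ℕ) : ℤ) * b j - B * (u' - u) = ρ' - ρ := by
    rw [Nat.cast_sub hlt'.le]
    linarith
  rw [h7, ← abs_of_pos hW', ← abs_mul, abs_le]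
  constructor <;> nlinarith

lemma norm_prod_zpow_le {J E : Type*} [Fintype J] [Field E] (ψ : E →+* ℂ) (ε : J → E)
    (h : ℝ) (h1 : ∀ j, ‖ψ (ε j)‖ ≤ Real.exp h) (h2 : ∀ j, ‖ψ (ε j)⁻¹‖ ≤ Real.exp h)
    (b : J → ℤ) (M : ℝ) (hb : ∀ j, |(b j : ℝ)| ≤ M) (hh : 0 ≤ h) :
    ‖ψ (∏ j, ε j ^ b j)‖ ≤ Real.exp (Fintype.card J * (M * h)) := by
  rw [map_prod, norm_prod]
  calc _ ≤ ∏ j : J, Real.exp (M * h) := by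
        refine prod_le_prod (fun _ _ => norm_nonneg _) fun j _ => ?_
        have h3 : ∀ n : ℕ, (n : ℝ) ≤ M → Real.exp h ^ n ≤ Real.exp (M * h) := fun n hn => by
          rw [← Real.exp_nat_mul]
          exact Real.exp_le_exp.2 (by gcongr)
        obtain ⟨n, hn | hn⟩ := (b j).eq_nat_or_neg
        · have := hb j
          rw [hn] at this ⊢
          rw [zpow_natCast, map_pow, norm_pow]
          exact (pow_le_pow_left₀ (norm_nonneg _) (h1 j) n).trans (h3 n (by simpa using this))
        · have := hb j
          rw [hn] at this ⊢
          rw [zpow_neg, zpow_natCast, ← inv_pow, map_pow, norm_pow]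
          exact (pow_le_pow_left₀ (norm_nonneg _) (h2 j) n).trans (h3 n (by simpa using this))
    _ = _ := by rw [prod_const, card_univ, ← Real.exp_nat_mul]

lemma isIntegral_prod_zpow {J E : Type*} [Fintype J] [Field E] (ε : J → E)
    (h1 : ∀ j, IsIntegral ℤ (ε j)) (h2 : ∀ j, IsIntegral ℤ (ε j)⁻¹) (b : J → ℤ) :
    IsIntegral ℤ (∏ j, ε j ^ b j) := by
  refine IsIntegral.prod _ fun j _ => ?_
  obtain ⟨n, hn | hn⟩ := (b j).eq_nat_or_neg
  · rw [hn, zpow_natCast]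
    exact (h1 j).pow n
  · rw [hn, zpow_neg, zpow_natCast, ← inv_pow]
    exact (h2 j).pow n

lemma exp_sum_int_mul {J E : Type*} [Fintype J] [Field E] (φ : E →+* ℂ) (ε : J → E) (ℓ : J → ℂ)
    (hℓ : ∀ j, Complex.exp (ℓ j) = φ (ε j)) (b : J → ℤ) :
    Complex.exp (∑ j, b j * ℓ j) = φ (∏ j, ε j ^ b j) := by
  rw [Complex.exp_sum, map_prod]
  refine prod_congr rfl fun j _ => ?_
  rw [Complex.exp_int_mul, hℓ, map_zpow₀]

lemma norm_sum_int_mul_le {J : Type*} [Fintype J] (ℓ : J → ℂ) (h M : ℝ) (hℓ : ∀ j, ‖ℓ j‖ ≤ h)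
    (b : J → ℤ) (hb : ∀ j, |(b j : ℝ)| ≤ M) (hM : 0 ≤ M) :
    ‖∑ j, b j * ℓ j‖ ≤ Fintype.card J * (M * h) := by
  refine (norm_sum_le _ _).trans ?_
  rw [← nsmul_eq_mul, ← card_univ]
  refine sum_le_card_nsmul _ _ _ fun j _ => ?_
  rw [norm_mul, Complex.norm_intCast]
  exact mul_le_mul (hb j) (hℓ j) (norm_nonneg _) hM

set_option maxHeartbeats 1000000 in
/-- The parameters chosen for the interpolation determinant meet its size requirement. -/
lemma two_log_params (c G m Y q B d x h₁ h₂ : ℝ) (L W K N R S τ : ℝ)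
    (hc : 1 ≤ c) (hG : 1 ≤ G) (hm : 1 ≤ m) (hY : 1 ≤ Y) (hq : 1 ≤ q) (hYq : Y ≤ q) (hqB : q * m ≤ B)
    (hd : 1 ≤ d) (hdc : d ≤ c) (hh₁ : h₁ = 2 * c ^ 2 * m) (hh₂ : h₂ = 3 * c ^ 2 * Y)
    (hx : q * x ≤ h₂ + 1)
    (hx0 : 0 ≤ x) (hL : L = 80 * c * G) (hW : W = 10 ^ 4 * c ^ 3 * L) (hK : K = 10 ^ 4 * c ^ 3 * W *
        Y * m)
    (hN : N = K * L) (hR : R = W * Y + L) (hS : S = W * m + L) (hτ : τ = R + q * S)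
    (hWB : 4 * W ≤ B) (hNB : N ≤ B) (hBG : Real.log B ≤ G) :
    2 * ((d + 1) * (Real.log N + K * Real.log τ + K + 2 * L * (R * h₁ + S * h₂)) +
      3 * L * τ * x + 1) + 1 < N := by
  have hL80 : 80 ≤ L := by nlinarith
  have hc3 : 1 ≤ c ^ 3 := one_le_pow₀ hc
  have hc2 : 1 ≤ c ^ 2 := one_le_pow₀ hc
  have hWL : L ≤ W := by
    rw [hW]
    exact le_mul_of_one_le_left (by linarith) (by linarith)
  have hW0 : 80 ≤ W := hL80.trans hWL
  have hYm : 1 ≤ Y * m := one_le_mul_of_one_le_of_one_le hY hm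
  have hWYm : W ≤ W * (Y * m) := le_mul_of_one_le_right (by linarith) hYm
  have hKW : W ≤ K := by
    calc W ≤ 10 ^ 4 * c ^ 3 * (W * (Y * m)) :=
          hWYm.trans (le_mul_of_one_le_left (by positivity) (by linarith))
      _ = K := by rw [hK]; ring
  have hK0 : 0 ≤ K := by linarith
  have hNpos : 1 ≤ N := by
    rw [hN]
    exact one_le_mul_of_one_le_of_one_le (by linarith) (by linarith)
  have hlogN : Real.log N ≤ G := (Real.log_le_log (by linarith) hNB).trans hBG
  have hR2 : R ≤ 2 * (W * Y) := by
    have : W ≤ W * Y := le_mul_of_one_le_right (by linarith) hY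
    rw [hR]
    linarith
  have hS2 : S ≤ 2 * (W * m) := by
    have : W ≤ W * m := le_mul_of_one_le_right (by linarith) hm
    rw [hS]
    linarith
  have hR0 : 0 ≤ R := by rw [hR]; positivity
  have hS0 : 1 ≤ S := by
    have : 0 ≤ W * m := by positivity
    rw [hS]
    linarith
  have hτ2 : τ ≤ 4 * (W * (q * m)) := by
    rw [hτ]
    have h1 : q * S ≤ q * (2 * (W * m)) := by gcongr
    have h2 : W * Y ≤ W * (q * m) := by
      have : q ≤ q * m := le_mul_of_one_le_right (by linarith) hm
      gcongr
      linarith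
    linarith
  have hτ1 : 1 ≤ τ := by
    have := one_le_mul_of_one_le_of_one_le hq hS0
    rw [hτ]
    linarith
  have hB1 : 1 ≤ B := by linarith
  have hlogτ : Real.log τ ≤ 2 * G := by
    have h1 : τ ≤ B * B := by
      calc τ ≤ (4 * W) * (q * m) := by linarith
        _ ≤ B * B := by gcongr
    have h2 := Real.log_le_log (by linarith) h1
    rw [Real.log_mul (by linarith) (by linarith)] at h2
    linarith
  have h1 : R * h₁ + S * h₂ ≤ 10 * c ^ 2 * (W * (Y * m)) := by
    rw [hh₁, hh₂]
    have h2 : R * (2 * c ^ 2 * m) ≤ 2 * (W * Y) * (2 * c ^ 2 * m) := by gcongr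
    have h3 : S * (3 * c ^ 2 * Y) ≤ 2 * (W * m) * (3 * c ^ 2 * Y) := by gcongr
    linarith
  have h2 : 3 * L * τ * x ≤ 48 * c ^ 2 * (L * W * (Y * m)) := by
    calc 3 * L * τ * x ≤ 3 * L * (4 * (W * (q * m))) * x := by gcongr
      _ = 12 * L * W * m * (q * x) := by ring
      _ ≤ 12 * L * W * m * (4 * c ^ 2 * Y) := by
          refine mul_le_mul_of_nonneg_left ?_ (by positivity)
          rw [hh₂] at hx
          have := one_le_mul_of_one_le_of_one_le hc2 hY
          linarith
      _ = _ := by ring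
  have hbr : Real.log N + K * Real.log τ + K + 2 * L * (R * h₁ + S * h₂) ≤
      4 * (K * G) + 20 * c ^ 2 * (L * W * (Y * m)) := by
    have h3 : K * Real.log τ ≤ K * (2 * G) := by gcongr
    have h4 : 2 * L * (R * h₁ + S * h₂) ≤ 2 * L * (10 * c ^ 2 * (W * (Y * m))) := by gcongr
    have h5 : K * 1 ≤ K * G := by gcongr
    have h6 : 1 * G ≤ K * G := by
      gcongr
      linarith
    linarith
  have hbr2 : (d + 1) * (Real.log N + K * Real.log τ + K + 2 * L * (R * h₁ + S * h₂)) ≤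
      (2 * c) * (4 * (K * G) + 20 * c ^ 2 * (L * W * (Y * m))) := by
    have : 0 ≤ 4 * (K * G) + 20 * c ^ 2 * (L * W * (Y * m)) := by positivity
    calc _ ≤ (d + 1) * (4 * (K * G) + 20 * c ^ 2 * (L * W * (Y * m))) := by gcongr
      _ ≤ _ := by
        gcongr
        linarith
  have hN1 : N = 80 * (c * G * K) := by rw [hN, hL]; ring
  have hN2 : N = 10 ^ 4 * (c ^ 3 * (L * W * (Y * m))) := by rw [hN, hK]; ring
  have h3 : c ^ 2 * (L * W * (Y * m)) ≤ c ^ 3 * (L * W * (Y * m)) := by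
    have : c ^ 2 ≤ c ^ 3 := pow_le_pow_right₀ hc (by norm_num)
    gcongr
  have h4 : 1 ≤ c * G * K := by
    have : 1 ≤ c * G := one_le_mul_of_one_le_of_one_le hc hG
    exact one_le_mul_of_one_le_of_one_le this (by linarith)
  have h5 : (2 * c) * (4 * (K * G) + 20 * c ^ 2 * (L * W * (Y * m))) = 8 * (c * G * K) +
    40 * (c ^ 3 * (L * W * (Y * m))) := by ring
  linarith


/-- Division of the exponents `b` by a common natural number `q` with small remainders. -/
lemma exists_div_exponents {J : Type*} [Fintype J] (b : J → ℤ) (B W c : ℕ) (hW : 0 < W)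
    (hg : Fintype.card J ≤ c) (hb : ∀ j, |b j| ≤ B) (hB : 4 * W ^ (2 * c + 2) ≤ B) :
    ∃ (m q Y : ℕ) (p : J → ℤ), 1 ≤ m ∧ 1 ≤ Y ∧ W * Y ≤ q ∧ q * m ≤ B ∧ (∀ j, |p j| ≤ 2 * m) ∧
      ∀ j, |b j - q * p j| ≤ 2 * Y := by
  have hWc : 0 < W ^ c := by positivity
  have hB' : 4 * (W ^ c * W ^ c * W ^ 2) ≤ B := by
    refine le_trans (le_of_eq ?_) hB
    ring
  have hB0 : 0 < B := lt_of_lt_of_le (by positivity) hB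
  obtain ⟨m, hm, hmW, p, hp⟩ := exists_simultaneous_approx b B W hB0 hW
  have hmP : m ≤ W ^ c := hmW.trans (Nat.pow_le_pow_right hW hg)
  have hq : 4 * W ^ c * W ^ 2 ≤ B / m := by
    rw [Nat.le_div_iff_mul_le hm]
    calc 4 * W ^ c * W ^ 2 * m ≤ 4 * W ^ c * W ^ 2 * W ^ c := by gcongr
      _ ≤ B := by linarith
  have hY : 4 * W ^ c * W ≤ B / m / W := by
    rw [Nat.le_div_iff_mul_le hW]
    linarith
  have hY2 : 2 * m + 1 ≤ B / m / W := by
    refine le_trans ?_ hY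
    have : W ^ c ≤ W ^ c * W := Nat.le_mul_of_pos_right _ hW
    linarith
  have hp2 : ∀ j, |p j| ≤ 2 * m := by
    intro j
    have h1 : |m * b j - B * p j| ≤ B := by
      refine le_trans ?_ (hp j)
      exact le_mul_of_one_le_right (abs_nonneg _) (by exact_mod_cast hW)
    have h2 : (B : ℤ) * |p j| ≤ B * (m + 1) := by
      have h3 : |(B : ℤ) * p j| ≤ |(m : ℤ) * b j| + |m * b j - B * p j| := by
        have := abs_sub ((m : ℤ) * b j) (m * b j - B * p j)
        simpa using this
      rw [abs_mul, abs_mul, Nat.abs_cast, Nat.abs_cast] at h3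
      have h4 : (m : ℤ) * |b j| ≤ m * B := mul_le_mul_of_nonneg_left (hb j) (by positivity)
      linarith
    have := le_of_mul_le_mul_left h2 (by exact_mod_cast hB0)
    omega
  refine ⟨m, B / m, B / m / W, p, hm, by omega, Nat.mul_div_le _ _, Nat.div_mul_le_self _ _, hp2,
    fun j => ?_⟩
  have h1 : B < m * (B / m + 1) := Nat.lt_mul_div_succ B hm
  have h2 : B / m < W * (B / m / W + 1) := Nat.lt_mul_div_succ _ hW
  have h3 : m * (B / m) ≤ B := Nat.mul_div_le _ _
  generalize B / m / W = Y at *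
  generalize B / m = q at *
  have h4 : (m : ℤ) * (b j - q * p j) = (m * b j - B * p j) + (B - m * q) * p j := by ring
  have h5 : (m : ℤ) * |b j - q * p j| ≤ |m * b j - B * p j| + m * (2 * m) := by
    rw [← Nat.abs_cast m, ← abs_mul, Nat.abs_cast, h4]
    refine (abs_add_le _ _).trans (add_le_add le_rfl ?_)
    rw [abs_mul]
    have h6 : |(B : ℤ) - m * q| ≤ m := by
      have h3' : (m : ℤ) * q ≤ B := by exact_mod_cast h3
      have h1' : (B : ℤ) < m * (q + 1) := by exact_mod_cast h1
      rw [abs_le]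
      constructor <;> linarith
    exact mul_le_mul h6 (hp2 j) (abs_nonneg _) (by positivity)
  have h7 : (m : ℤ) * W * |b j - q * p j| ≤ B + m * W * (2 * m) := by
    calc (m : ℤ) * W * |b j - q * p j| = (m * |b j - q * p j|) * W := by ring
      _ ≤ (|m * b j - B * p j| + m * (2 * m)) * W := by gcongr
      _ = |m * b j - B * p j| * W + m * W * (2 * m) := by ring
      _ ≤ _ := by linarith [hp j]
  have h8 : (B : ℤ) < m * W * (Y + 1) := by
    have : B < m * (W * (Y + 1)) := h1.trans_le (Nat.mul_le_mul_left m h2)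
    rw [← mul_assoc] at this
    exact_mod_cast this
  have h9 : (m : ℤ) * W * |b j - q * p j| < m * W * (Y + 1 + 2 * m) := by linarith
  have h10 := lt_of_mul_lt_mul_left h9 (by positivity)
  have hY2' : (2 * m + 1 : ℤ) ≤ Y := by exact_mod_cast hY2
  linarith

set_option maxHeartbeats 800000 in
/-- A lower bound `exp (-B / J₀)` for linear forms in logarithms with coefficients at most `B`. -/
lemma norm_linear_form_ge {J E : Type*} [Fintype J] [Field E] [NumberField E] (φ : E →+* ℂ)
    (c J₀ G B W : ℕ) (h : ℝ) (hc : 1 ≤ c) (hJ₀ : 1 ≤ J₀) (hG : 1 ≤ G) (hd : Module.finrank ℚ E ≤ c)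
    (hg : Fintype.card J ≤ c) (hh : 0 ≤ h) (hhc : h ≤ c) (hW : W = 10 ^ 4 * c ^ 3 * (80 * c * G))
    (hBW : 4 * (2 * J₀ * W ^ 2) ^ (2 * c + 2) ≤ B) (hBG : Real.log B ≤ G)
    (ε : J → E) (hε1 : ∀ j, IsIntegral ℤ (ε j)) (hε2 : ∀ j, IsIntegral ℤ (ε j)⁻¹)
    (hε3 : ∀ j (ψ : E →+* ℂ), ‖ψ (ε j)‖ ≤ Real.exp h)
    (hε4 : ∀ j (ψ : E →+* ℂ), ‖ψ (ε j)⁻¹‖ ≤ Real.exp h)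
    (ℓ : J → ℂ) (hℓ : ∀ j, Complex.exp (ℓ j) = φ (ε j)) (hℓh : ∀ j, ‖ℓ j‖ ≤ h)
    (η : E) (ℓ₀ : ℂ) (hℓ₀ : Complex.exp ℓ₀ = φ η) (hℓ₀h : ‖ℓ₀‖ ≤ h) (D : ℕ) (hD : D ≠ 0)
    (hDη : IsIntegral ℤ ((D : E) * η)) (hDh : (D : ℝ) ≤ Real.exp h)
    (hη : ∀ ψ : E →+* ℂ, ‖ψ η‖ ≤ Real.exp h) (b : J → ℤ) (hb : ∀ j, |b j| ≤ B)
    (hne : η * ∏ j, ε j ^ b j ≠ 1) :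
    Real.exp (-(B / J₀)) ≤ ‖ℓ₀ + ∑ j, b j * ℓ j‖ := by
  by_contra! hlt
  have hε0 : ∀ j, ε j ≠ 0 := fun j hj => Complex.exp_ne_zero (ℓ j) (by rw [hℓ, hj, map_zero])
  have hc' : (1 : ℝ) ≤ c := by exact_mod_cast hc
  have hJ₀' : (1 : ℝ) ≤ J₀ := by exact_mod_cast hJ₀
  have hG' : (1 : ℝ) ≤ G := by exact_mod_cast hG
  have hWpos : 0 < W := by rw [hW]; positivity
  have hW0 : 0 < 2 * J₀ * W ^ 2 := by positivity
  obtain ⟨m, q, Y, p, hm, hY, hYq, hqB, hp, hr⟩ :=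
    exists_div_exponents b B (2 * J₀ * W ^ 2) c hW0 hg hb hBW
  have hm' : (1 : ℝ) ≤ m := by exact_mod_cast hm
  have hY' : (1 : ℝ) ≤ Y := by exact_mod_cast hY
  have hYm : 1 ≤ Y * m := one_le_mul_of_one_le_of_one_le hY hm
  set L := 80 * c * G with hL
  set K := 10 ^ 4 * c ^ 3 * W * Y * m with hK
  have hLpos : 1 ≤ L := by
    have : 1 ≤ 80 * c * G := by
      have : 0 < 80 * c * G := by positivity
      omega
    exact this
  have hKL : K * L = W * W * Y * m := by
    rw [hK]
    nth_rewrite 3 [hW]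
    ring
  have hLW : 2 * L ≤ W := by
    rw [hW]
    have : 0 < c ^ 3 := by positivity
    exact Nat.mul_le_mul_right L (by omega)
  have hWq : W * Y ≤ q := by
    refine le_trans (Nat.mul_le_mul_right Y ?_) hYq
    nlinarith
  have hYq' : Y ≤ q := le_trans (Nat.le_mul_of_pos_left Y hWpos) hWq
  have hNB : J₀ * (2 * (K * L)) ≤ B := by
    calc J₀ * (2 * (K * L)) = 2 * J₀ * W ^ 2 * Y * m := by rw [hKL]; ring
      _ ≤ q * m := Nat.mul_le_mul_right m hYq
      _ ≤ B := hqB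
  have hp' : ∀ j, |((-p j : ℤ) : ℝ)| ≤ 2 * m := fun j => by
    rw [Int.cast_neg, abs_neg]
    exact_mod_cast hp j
  have hr' : ∀ j, |((b j - q * p j : ℤ) : ℝ)| ≤ 2 * Y := fun j => by exact_mod_cast hr j
  have hg' : (Fintype.card J : ℝ) ≤ c := by exact_mod_cast hg
  have hH2 : h + Fintype.card J * (2 * Y * h) ≤ 3 * c ^ 2 * Y := by
    calc h + Fintype.card J * (2 * Y * h) ≤ c + c * (2 * Y * c) := by gcongr
      _ = c * 1 * 1 + 2 * c ^ 2 * Y := by ring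
      _ ≤ c * c * Y + 2 * c ^ 2 * Y := by gcongr
      _ = _ := by ring
  have hhY : h ≤ 3 * c ^ 2 * Y := le_trans (le_add_of_nonneg_right (by positivity)) hH2
  have hsum : ℓ₀ + ∑ j, ((b j - q * p j : ℤ) : ℂ) * ℓ j - q * ∑ j, ((-p j : ℤ) : ℂ) * ℓ j =
      ℓ₀ + ∑ j, b j * ℓ j := by
    rw [add_sub_assoc, mul_sum, ← sum_sub_distrib]
    congr 1
    refine sum_congr rfl fun j _ => ?_
    push_cast
    ring
  have hx : (q : ℝ) * ‖∑ j, ((-p j : ℤ) : ℂ) * ℓ j‖ ≤ 3 * c ^ 2 * Y + 1 := by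
    have h1 : (q : ℂ) * ∑ j, ((-p j : ℤ) : ℂ) * ℓ j =
        (ℓ₀ + ∑ j, ((b j - q * p j : ℤ) : ℂ) * ℓ j) - (ℓ₀ + ∑ j, b j * ℓ j) := by
      rw [← hsum]
      ring
    rw [← Complex.norm_natCast, ← norm_mul, h1]
    refine (norm_sub_le _ _).trans (add_le_add ((norm_add_le _ _).trans ?_) (hlt.le.trans ?_))
    · exact (add_le_add hℓ₀h (norm_sum_int_mul_le ℓ h (2 * Y) hℓh _ hr' (by positivity))).trans hH2
    · rw [Real.exp_le_one_iff, neg_nonpos]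
      positivity
  have hprod : (η * ∏ j, ε j ^ (b j - q * p j)) = (∏ j, ε j ^ (-p j)) ^ q *
      (η * ∏ j, ε j ^ b j) := by
    rw [← prod_pow, mul_left_comm, ← prod_mul_distrib]
    congr 1
    refine prod_congr rfl fun j _ => ?_
    rw [← zpow_natCast, ← zpow_mul, ← zpow_add₀ (hε0 j)]
    congr 1
    ring
  have hα1 : (∏ j, ε j ^ (-p j)) ≠ 0 := prod_ne_zero_iff.2 fun j _ => zpow_ne_zero _ (hε0 j)
  have key := two_log φ (∏ j, ε j ^ (-p j)) (η * ∏ j, ε j ^ (b j - q * p j))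
    (∑ j, ((-p j : ℤ) : ℂ) * ℓ j) (ℓ₀ + ∑ j, ((b j - q * p j : ℤ) : ℂ) * ℓ j)
    (exp_sum_int_mul φ ε ℓ hℓ _)
    (by rw [Complex.exp_add, hℓ₀, exp_sum_int_mul φ ε ℓ hℓ, map_mul])
    (2 * c ^ 2 * m) (3 * c ^ 2 * Y) (by positivity) (by positivity)
    (isIntegral_prod_zpow ε hε1 hε2 _) D hD
    (by rw [← mul_assoc]; exact hDη.mul (isIntegral_prod_zpow ε hε1 hε2 _))
    (hDh.trans (Real.exp_le_exp.2 hhY))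
    (fun ψ => (norm_prod_zpow_le ψ ε h (fun j => hε3 j ψ) (fun j => hε4 j ψ) _ _ hp' hh).trans
      (Real.exp_le_exp.2 (by
        calc Fintype.card J * (2 * m * h) ≤ c * (2 * m * c) := by gcongr
          _ = 2 * c ^ 2 * m := by ring)))
    (fun ψ => by
      rw [map_mul, norm_mul]
      refine (mul_le_mul (hη ψ) (norm_prod_zpow_le ψ ε h (fun j => hε3 j ψ) (fun j => hε4 j ψ) _ _
        hr' hh) (norm_nonneg _) (Real.exp_pos _).le).trans ?_
      rw [← Real.exp_add]
      exact Real.exp_le_exp.2 hH2)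
    K L (W * Y) (W * m) q ((W * Y + L + q * (W * m + L) : ℕ) : ℝ)
    (by
      have : 1 ≤ W * Y + L + q * (W * m + L) := by
        have := Nat.zero_le (q * (W * m + L))
        have := Nat.zero_le (W * Y)
        omega
      exact_mod_cast this)
    le_rfl hWq (by rw [hKL]; apply le_of_eq; ring)
    (by
      intro heq
      rw [hprod] at heq
      exact hne (mul_left_cancel₀ (pow_ne_zero q hα1) (heq.trans (mul_one _).symm)))
    (two_log_params c G m Y q B (Module.finrank ℚ E) ‖∑ j, ((-p j : ℤ) : ℂ) * ℓ j‖ (2 * c ^ 2 * m)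
      (3 * c ^ 2 * Y) L W K ((K * L : ℕ) : ℝ) ((W * Y + L : ℕ) : ℝ) ((W * m + L : ℕ) : ℝ) _
      hc' hG' hm' hY' (by exact_mod_cast hY.trans hYq') (by exact_mod_cast hYq')
      (by exact_mod_cast hqB) (by exact_mod_cast Module.finrank_pos) (by exact_mod_cast hd) rfl rfl
      hx (norm_nonneg _) (by rw [hL]; push_cast; ring)
      (by rw [hW]; push_cast; ring) (by rw [hK]; push_cast; ring) (by push_cast; ring)
      (by push_cast; ring) (by push_cast; ring) (by push_cast; ring)
      (by
        have : 4 * W ≤ B := by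
          refine le_trans (Nat.mul_le_mul_left 4 ?_) hBW
          calc W ≤ 2 * J₀ * W ^ 2 := by nlinarith
            _ ≤ _ := Nat.le_self_pow (by omega) _
        exact_mod_cast this)
      (by
        have : K * L ≤ B := by
          refine le_trans ?_ hNB
          nlinarith [Nat.zero_le (K * L)]
        exact_mod_cast this)
      hBG)
  have hLS : L * (W * m + L) ≤ K * L := by
    rw [mul_comm K L]
    refine Nat.mul_le_mul_left L ?_
    have h1 : L ≤ W * m := by nlinarith
    have h2 : W * m ≤ W * m * Y := Nat.le_mul_of_pos_right _ hY
    have h3 : 2 * (W * m * Y) ≤ K := by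
      rw [hK]
      have : 0 < c ^ 3 := by positivity
      calc 2 * (W * m * Y) ≤ (10 ^ 4 * c ^ 3) * (W * m * Y) := Nat.mul_le_mul_right _ (by omega)
        _ = _ := by ring
    omega
  rw [hsum] at key
  have h1 : (L * (W * m + L : ℕ) : ℝ) ≤ Real.exp (K * L : ℕ) := by
    have h2 : ((L * (W * m + L) : ℕ) : ℝ) ≤ (K * L : ℕ) := by exact_mod_cast hLS
    have h3 := Real.add_one_le_exp ((K * L : ℕ) : ℝ)
    push_cast at h2 h3 ⊢
    linarith
  have h4 : ((J₀ : ℝ) * (2 * (K * L : ℕ))) ≤ B := by exact_mod_cast hNB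
  have h5 : ((K * L : ℕ) : ℝ) + (-(B / J₀)) + (K * L : ℕ) ≤ 0 := by
    have : (2 * (K * L : ℕ) : ℝ) ≤ B / J₀ := by
      rw [le_div_iff₀ (by linarith)]
      linarith
    linarith
  have h6 : L * (W * m + L : ℕ) * ‖ℓ₀ + ∑ j, b j * ℓ j‖ * Real.exp (K * L : ℕ) ≤ 1 := by
    calc _ ≤ Real.exp (K * L : ℕ) * Real.exp (-(B / J₀)) * Real.exp (K * L : ℕ) := by
          gcongr
      _ = Real.exp (((K * L : ℕ) : ℝ) + (-(B / J₀)) + (K * L : ℕ)) := by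
          rw [← Real.exp_add, ← Real.exp_add]
      _ ≤ 1 := Real.exp_le_one_iff.2 h5
  linarith


lemma norm_log_le {z : ℂ} {h : ℝ} (hz : z ≠ 0) (h1 : ‖z‖ ≤ Real.exp h) (h2 : ‖z⁻¹‖ ≤ Real.exp h) :
    ‖Complex.log z‖ ≤ h + 4 := by
  have h3 : |Real.log ‖z‖| ≤ h := by
    have hpos := norm_pos_iff.2 hz
    rw [abs_le]
    constructor
    · have := Real.log_le_log (norm_pos_iff.2 (inv_ne_zero hz)) h2
      rw [Real.log_exp, norm_inv, Real.log_inv] at this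
      linarith
    · have := Real.log_le_log hpos h1
      rwa [Real.log_exp] at this
  refine (Complex.norm_le_abs_re_add_abs_im _).trans ?_
  rw [Complex.log_re, Complex.log_im]
  have h4 := Complex.abs_arg_le_pi z
  have h5 := Real.pi_lt_four
  linarith

/-- A lower bound for `|φ v - 1|`, where `v` is a product of powers of units. -/
lemma norm_sub_one_ge {J E : Type*} [Fintype J] [Field E] [NumberField E] (φ : E →+* ℂ)
    (c J₀ G B B₀ W : ℕ) (h : ℝ) (hc : 1 ≤ c) (hJ₀ : 1 ≤ J₀) (hG : 1 ≤ G)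
        (hd : Module.finrank ℚ E ≤ c)
    (hg : Fintype.card J + 1 ≤ c) (hh : 0 ≤ h) (hhc : h + 7 ≤ c)
    (hW : W = 10 ^ 4 * c ^ 3 * (80 * c * G))
    (hBW : 4 * (2 * J₀ * W ^ 2) ^ (2 * c + 2) ≤ B) (hBG : Real.log B ≤ G) (hB₀ : 1 ≤ B₀)
    (hBB₀ : 2 * c ^ 2 * B₀ ≤ B)
    (ε : J → E) (hε0 : ∀ j, ε j ≠ 0) (hε1 : ∀ j, IsIntegral ℤ (ε j))
    (hε2 : ∀ j, IsIntegral ℤ (ε j)⁻¹)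
    (hε3 : ∀ j (ψ : E →+* ℂ), ‖ψ (ε j)‖ ≤ Real.exp h)
    (hε4 : ∀ j (ψ : E →+* ℂ), ‖ψ (ε j)⁻¹‖ ≤ Real.exp h)
    (η : E) (hη0 : η ≠ 0) (D : ℕ) (hD : D ≠ 0)
    (hDη : IsIntegral ℤ ((D : E) * η)) (hDh : (D : ℝ) ≤ Real.exp h)
    (hη : ∀ ψ : E →+* ℂ, ‖ψ η‖ ≤ Real.exp h) (hη' : ∀ ψ : E →+* ℂ, ‖ψ η⁻¹‖ ≤ Real.exp h)
    (b : J → ℤ) (hb : ∀ j, |b j| ≤ B₀)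
    (hne : η * ∏ j, ε j ^ b j ≠ 1) :
    Real.exp (-(B / J₀)) / 2 ≤ ‖φ (η * ∏ j, ε j ^ b j) - 1‖ := by
  have hBc : 0 ≤ (B / J₀ : ℝ) := by positivity
  have hexp : Real.exp (-(B / J₀)) ≤ 1 := Real.exp_le_one_iff.2 (by linarith)
  by_cases hz : 1 / 2 < ‖φ (η * ∏ j, ε j ^ b j) - 1‖
  · linarith
  rw [not_lt] at hz
  set z := φ (η * ∏ j, ε j ^ b j) with hzdef
  have hv0 : η * ∏ j, ε j ^ b j ≠ 0 :=
    mul_ne_zero hη0 (prod_ne_zero_iff.2 fun j _ => zpow_ne_zero _ (hε0 j))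
  have hz0 : z ≠ 0 := by rwa [hzdef, Ne, map_eq_zero]
  have hlog : ‖Complex.log z‖ ≤ 3 / 2 * ‖z - 1‖ := by
    have := Complex.norm_log_one_add_half_le_self hz
    rwa [add_sub_cancel] at this
  have hφε : ∀ j, φ (ε j) ≠ 0 := fun j => by rw [Ne, map_eq_zero]; exact hε0 j
  have hφη : φ η ≠ 0 := by rwa [Ne, map_eq_zero]
  have hℓ : ∀ j, Complex.exp (Complex.log (φ (ε j))) = φ (ε j) := fun j => Complex.exp_log (hφε j)
  have hℓh : ∀ j, ‖Complex.log (φ (ε j))‖ ≤ h + 4 := fun j =>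
    norm_log_le (hφε j) (hε3 j φ) (by rw [← map_inv₀]; exact hε4 j φ)
  have hℓ₀h : ‖Complex.log (φ η)‖ ≤ h + 4 :=
    norm_log_le hφη (hη φ) (by rw [← map_inv₀]; exact hη' φ)
  obtain ⟨n, hn⟩ : ∃ n : ℤ, Complex.log z =
      Complex.log (φ η) + ∑ j, b j * Complex.log (φ (ε j)) + n * (2 * Real.pi * Complex.I) := by
    rw [← Complex.exp_eq_exp_iff_exists_int, Complex.exp_log hz0, Complex.exp_add,
      Complex.exp_log hφη, exp_sum_int_mul φ ε _ hℓ, ← map_mul]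
  have hc' : (1 : ℝ) ≤ c := by exact_mod_cast hc
  have hB₀' : (1 : ℝ) ≤ B₀ := by exact_mod_cast hB₀
  have hg' : (Fintype.card J : ℝ) + 1 ≤ c := by exact_mod_cast hg
  have hnB : |n| ≤ B := by
    have h1 : ‖(n * (2 * Real.pi * Complex.I) : ℂ)‖ ≤ c ^ 2 * B₀ + 1 := by
      rw [show (n * (2 * Real.pi * Complex.I) : ℂ) = Complex.log z -
        (Complex.log (φ η) + ∑ j, b j * Complex.log (φ (ε j))) by rw [hn]; ring]
      refine (norm_sub_le _ _).trans ?_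
      have h2 := norm_add_le (Complex.log (φ η)) (∑ j, b j * Complex.log (φ (ε j)))
      have h3 := norm_sum_int_mul_le (fun j => Complex.log (φ (ε j))) (h + 4) B₀ hℓh b
        (fun j => by exact_mod_cast hb j) (by positivity)
      have h4 : (Fintype.card J : ℝ) * (B₀ * (h + 4)) ≤ (c - 1) * (B₀ * c) := by
        gcongr
        · linarith
        · linarith
      have h5 : (h + 4 : ℝ) ≤ c * B₀ := by nlinarith
      nlinarith
    rw [norm_mul, Complex.norm_intCast, show ‖(2 * Real.pi * Complex.I : ℂ)‖ = 2 * Real.pi by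
      simp [abs_of_pos Real.pi_pos]] at h1
    have h6 : |(n : ℝ)| ≤ B := by
      have h7 : (2 * c ^ 2 * B₀ : ℝ) ≤ B := by exact_mod_cast hBB₀
      have h8 : |(n : ℝ)| ≤ |(n : ℝ)| * (2 * Real.pi) :=
        le_mul_of_one_le_right (abs_nonneg _) (by linarith [Real.pi_gt_three])
      have h9 : (1 : ℝ) ≤ c ^ 2 * B₀ := by nlinarith [one_le_pow₀ hc' (n := 2)]
      linarith
    exact_mod_cast h6
  have hbB : ∀ j, |b j| ≤ B := fun j => (hb j).trans (by
    have : B₀ ≤ B := by nlinarith [Nat.one_le_pow 2 c hc]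
    exact_mod_cast this)
  have key := norm_linear_form_ge (J := Option J) φ c J₀ G B W (h + 7) hc hJ₀ hG hd
      (by simpa using hg)
    (by linarith) hhc hW hBW hBG (fun j => j.elim 1 ε)
    (fun j => by cases j with
      | none => exact isIntegral_one
      | some j => exact hε1 j)
    (fun j => by cases j with
      | none => simpa using isIntegral_one
      | some j => exact hε2 j)
    (fun j ψ => by cases j with
      | none => simpa using (by linarith : 0 ≤ h + 7)
      | some j => exact (hε3 j ψ).trans (Real.exp_le_exp.2 (by linarith)))
    (fun j ψ => by cases j with
      | none => simpa using (by linarith : 0 ≤ h + 7)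
      | some j => exact (hε4 j ψ).trans (Real.exp_le_exp.2 (by linarith)))
    (fun j => j.elim (2 * Real.pi * Complex.I) fun j => Complex.log (φ (ε j)))
    (fun j => by cases j with
      | none => simp
      | some j => exact hℓ j)
    (fun j => by cases j with
      | none =>
        simp only [Option.elim]
        rw [show ‖(2 * Real.pi * Complex.I : ℂ)‖ = 2 * Real.pi by simp [abs_of_pos Real.pi_pos]]
        linarith [Real.pi_lt_d2]
      | some j => exact (hℓh j).trans (by linarith))
    η (Complex.log (φ η)) (Complex.exp_log hφη) (hℓ₀h.trans (by linarith)) D hD hDη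
    (hDh.trans (Real.exp_le_exp.2 (by linarith)))
    (fun ψ => (hη ψ).trans (Real.exp_le_exp.2 (by linarith)))
    (fun j => j.elim n b)
    (fun j => by cases j with
      | none => exact hnB
      | some j => exact hbB j)
    (by simpa [Fintype.prod_option] using hne)
  rw [Fintype.sum_option] at key
  simp only [Option.elim] at key
  rw [add_comm ((n : ℂ) * _), ← add_assoc, ← hn] at key
  linarith [Real.exp_pos (-(B / J₀ : ℝ))]


/-- `norm_sub_one_ge` with the auxiliary parameters chosen. -/
lemma norm_sub_one_ge_of_exp_le {J E : Type*} [Fintype J] [Field E] [NumberField E] (φ : E →+* ℂ)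
    (c J₀ B B₀ : ℕ) (h : ℝ) (hc : 1 ≤ c) (hJ₀ : 1 ≤ J₀) (hd : Module.finrank ℚ E ≤ c)
    (hg : Fintype.card J + 1 ≤ c) (hh : 0 ≤ h) (hhc : h + 7 ≤ c)
    (hB : Real.exp (10 ^ 8 * (c + J₀) ^ 2) ≤ B) (hB₀ : 1 ≤ B₀)
    (hBB₀ : 2 * c ^ 2 * B₀ ≤ B)
    (ε : J → E) (hε0 : ∀ j, ε j ≠ 0) (hε1 : ∀ j, IsIntegral ℤ (ε j))
    (hε2 : ∀ j, IsIntegral ℤ (ε j)⁻¹)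
    (hε3 : ∀ j (ψ : E →+* ℂ), ‖ψ (ε j)‖ ≤ Real.exp h)
    (hε4 : ∀ j (ψ : E →+* ℂ), ‖ψ (ε j)⁻¹‖ ≤ Real.exp h)
    (η : E) (hη0 : η ≠ 0) (D : ℕ) (hD : D ≠ 0)
    (hDη : IsIntegral ℤ ((D : E) * η)) (hDh : (D : ℝ) ≤ Real.exp h)
    (hη : ∀ ψ : E →+* ℂ, ‖ψ η‖ ≤ Real.exp h) (hη' : ∀ ψ : E →+* ℂ, ‖ψ η⁻¹‖ ≤ Real.exp h)
    (b : J → ℤ) (hb : ∀ j, |b j| ≤ B₀)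
    (hne : η * ∏ j, ε j ^ b j ≠ 1) :
    Real.exp (-(B / J₀)) / 2 ≤ ‖φ (η * ∏ j, ε j ^ b j) - 1‖ := by
  have hc' : (1 : ℝ) ≤ c := by exact_mod_cast hc
  have hJ' : (1 : ℝ) ≤ J₀ := by exact_mod_cast hJ₀
  have hBpos : (0 : ℝ) < B := (Real.exp_pos _).trans_le hB
  set g := Real.log B with hg'
  have hgs : 10 ^ 8 * (c + J₀ : ℝ) ^ 2 ≤ g := (Real.le_log_iff_exp_le hBpos).2 hB
  set s : ℝ := c + J₀ with hs
  have hs1 : 1 ≤ s := by linarith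
  have hg1 : 10 ^ 8 ≤ g := by nlinarith
  set r := √g with hr
  have hrg : r ^ 2 = g := Real.sq_sqrt (by linarith)
  have hrs : 10 ^ 4 * s ≤ r := Real.le_sqrt_of_sq_le (by nlinarith)
  have hG : ((⌈g⌉₊ : ℕ) : ℝ) ≤ 2 * g := by
    have := Nat.ceil_lt_add_one (by linarith : 0 ≤ g)
    linarith
  have hG1 : 1 ≤ ⌈g⌉₊ := Nat.one_le_ceil_iff.2 (by linarith)
  refine norm_sub_one_ge φ c J₀ ⌈g⌉₊ B B₀ _ h hc hJ₀ hG1 hd hg hh hhc rfl ?_ (Nat.le_ceil _) hB₀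
      hBB₀
    ε hε0 hε1 hε2 hε3 hε4 η hη0 D hD hDη hDh hη hη' b hb hne
  have hW : ((10 ^ 4 * c ^ 3 * (80 * c * ⌈g⌉₊) : ℕ) : ℝ) ≤ g ^ 3 := by
    push_cast
    have h1 : (c : ℝ) ^ 2 ≤ g / 10 ^ 8 := by
      have : (c : ℝ) ^ 2 ≤ s ^ 2 := by gcongr; linarith
      linarith
    calc _ = 8 * 10 ^ 5 * ((c : ℝ) ^ 2) ^ 2 * (⌈g⌉₊ : ℕ) := by ring
      _ ≤ 8 * 10 ^ 5 * (g / 10 ^ 8) ^ 2 * (2 * g) := by gcongr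
      _ = (16 / 10 ^ 11) * g ^ 3 := by ring
      _ ≤ g ^ 3 := by
        have : 0 ≤ g ^ 3 := by positivity
        linarith
  have h2 : (2 * J₀ * ((10 ^ 4 * c ^ 3 * (80 * c * ⌈g⌉₊) : ℕ) : ℝ) ^ 2) ≤ g ^ 7 := by
    have h3 : (2 * J₀ : ℝ) ≤ g := by nlinarith
    calc _ ≤ g * (g ^ 3) ^ 2 := by gcongr
      _ = g ^ 7 := by ring
  have h4 : g ≤ Real.exp (2 * r) := by
    rw [← hrg, two_mul, Real.exp_add, sq]
    have := Real.add_one_le_exp r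
    have hr0 : 0 ≤ r := Real.sqrt_nonneg _
    gcongr <;> linarith
  have h5 : (4 : ℝ) ≤ Real.exp 2 := by
    rw [show (2 : ℝ) = 1 + 1 by norm_num, Real.exp_add]
    nlinarith [Real.add_one_le_exp (1 : ℝ)]
  have h6 : (4 * (2 * J₀ * ((10 ^ 4 * c ^ 3 * (80 * c * ⌈g⌉₊) : ℕ) : ℝ) ^ 2) ^ (2 * c + 2)) ≤
      (B : ℝ) := by
    calc _ ≤ Real.exp 2 * ((Real.exp (2 * r)) ^ 7) ^ (2 * c + 2) := by
          gcongr
          exact h2.trans (by gcongr)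
      _ = Real.exp (2 + 14 * r * (2 * c + 2)) := by
          rw [← Real.exp_nat_mul, ← Real.exp_nat_mul, ← Real.exp_add]
          congr 1
          push_cast
          ring
      _ ≤ Real.exp g := by
          rw [Real.exp_le_exp, ← hrg]
          nlinarith
      _ = B := Real.exp_log hBpos
  exact_mod_cast h6

end BakerHyperelliptic

namespace BakerHyperelliptic
open Finset NumberField

/-- A natural number exceeding the Minkowski constant of a number field. -/
noncomputable def minkowskiConst (K : Type*) [Field K] [NumberField K] : ℕ :=
  2 ^ Module.finrank ℚ K * ((discr K).natAbs + 1)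

lemma one_le_minkowskiConst (K : Type*) [Field K] [NumberField K] : 1 ≤ minkowskiConst K :=
  Nat.one_le_iff_ne_zero.2 (by unfold minkowskiConst; positivity)

open MeasureTheory mixedEmbedding in
lemma exists_mem_fractionalIdeal_le {K : Type*} [Field K] [NumberField K]
    (I : (FractionalIdeal (nonZeroDivisors (𝓞 K)) K)ˣ) (f : InfinitePlace K → ℝ) (hf : ∀ w, 0 < f w)
    (h : minkowskiConst K * ((FractionalIdeal.absNorm I.1 : ℚ) : ℝ) ≤ ∏ w, f w ^ w.mult) :
    ∃ a ∈ (I : FractionalIdeal (nonZeroDivisors (𝓞 K)) K), a ≠ 0 ∧ ∀ w : InfinitePlace K, w a ≤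
        f w := by
  classical
  have hN : 0 < ((FractionalIdeal.absNorm I.1 : ℚ) : ℝ) := by
    have h1 := FractionalIdeal.absNorm_nonneg I.1
    have h2 : FractionalIdeal.absNorm I.1 ≠ 0 := by
      rw [Ne, FractionalIdeal.absNorm_eq_zero_iff]
      exact I.ne_zero
    exact_mod_cast lt_of_le_of_ne h1 h2.symm
  obtain ⟨a, ha, ha0, hlt⟩ := exists_ne_zero_mem_ideal_lt K (f := fun w => (f w).toNNReal) I (by
    rw [minkowskiBound, volume_fundamentalDomain_fractionalIdealLatticeBasis,
      volume_fundamentalDomain_latticeBasis, convexBodyLT_volume, mixedEmbedding.finrank]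
    set N : ℝ := ((FractionalIdeal.absNorm I.1 : ℚ) : ℝ) with hNdef
    have h1 : (2 : ENNReal)⁻¹ ^ InfinitePlace.nrComplexPlaces K *
        (NNReal.sqrt ‖discr K‖₊ : ENNReal) ≤
        NNReal.sqrt ‖discr K‖₊ :=
      mul_le_of_le_one_left' (pow_le_one' (by simp) _)
    have h2 : ∏ w, ENNReal.ofNNReal (f w).toNNReal ^ w.mult ≤ (convexBodyLTFactor K : ENNReal) *
        ∏ w, ENNReal.ofNNReal (f w).toNNReal ^ w.mult :=
      le_mul_of_one_le_left' (by exact_mod_cast one_le_convexBodyLTFactor K)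
    have h3 : ∏ w, ENNReal.ofNNReal (f w).toNNReal ^ w.mult =
        ENNReal.ofReal (∏ w, f w ^ w.mult) := by
      rw [ENNReal.ofReal_prod_of_nonneg fun w _ => pow_nonneg (hf w).le _]
      exact prod_congr rfl fun w _ => (ENNReal.ofReal_pow (hf w).le _).symm
    have h4 : ENNReal.ofReal N * (NNReal.sqrt ‖discr K‖₊ : ENNReal) * 2 ^ Module.finrank ℚ K =
        ENNReal.ofReal (N * √(|discr K| : ℤ) * 2 ^ Module.finrank ℚ K) := by
      rw [ENNReal.ofReal_mul (by positivity), ENNReal.ofReal_mul (by positivity),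
        ENNReal.ofReal_pow (by norm_num)]
      congr 2
      · congr 1
        rw [Real.toNNReal_of_nonneg (Real.sqrt_nonneg _)]
        ext
        simp [Int.norm_eq_abs]
      · norm_num
    refine lt_of_le_of_lt (mul_le_mul_left (mul_le_mul_right h1 _) _) ?_
    push_cast
    refine lt_of_lt_of_le ?_ h2
    rw [h3, h4, ENNReal.ofReal_lt_ofReal_iff (prod_pos fun w _ => pow_pos (hf w) _)]
    refine lt_of_lt_of_le ?_ h
    rw [minkowskiConst]
    push_cast
    have h5 : √((|discr K| : ℤ) : ℝ) < (discr K).natAbs + 1 := by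
      rw [Nat.cast_natAbs]
      have h6 : (0 : ℝ) ≤ ((|discr K| : ℤ) : ℝ) := by exact_mod_cast abs_nonneg _
      rw [Real.sqrt_lt' (by linarith)]
      nlinarith
    rw [mul_comm _ N, mul_assoc, mul_comm (√_)]
    gcongr
    exact_mod_cast h5)
  exact ⟨a, ha, ha0, fun w => by simpa [(hf w).le] using (hlt w).le⟩

lemma exists_ringOfIntegers_le {K : Type*} [Field K] [NumberField K] (f : InfinitePlace K → ℝ)
    (hf : ∀ w, 0 < f w) (h : minkowskiConst K ≤ ∏ w, f w ^ w.mult) :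
    ∃ a : 𝓞 K, a ≠ 0 ∧ ∀ w : InfinitePlace K, w a ≤ f w := by
  obtain ⟨a, ha, ha0, hle⟩ := exists_mem_fractionalIdeal_le (K := K) 1 f hf (by simpa using h)
  obtain ⟨b, rfl⟩ := (FractionalIdeal.mem_one_iff _).1 ha
  exact ⟨b, by rintro rfl; simp at ha0, hle⟩

lemma prod_eq_natAbs_norm {K : Type*} [Field K] [NumberField K] (y : 𝓞 K) :
    ∏ w : InfinitePlace K, w (y : K) ^ w.mult = ((Algebra.norm ℤ y).natAbs : ℝ) := by
  rw [InfinitePlace.prod_eq_abs_norm, ← Algebra.coe_norm_int, Nat.cast_natAbs]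
  simp

lemma one_le_natAbs_norm {K : Type*} [Field K] [NumberField K] {y : 𝓞 K} (hy : y ≠ 0) :
    1 ≤ (Algebra.norm ℤ y).natAbs :=
  Nat.one_le_iff_ne_zero.2 (Int.natAbs_ne_zero.2 (Algebra.norm_ne_zero_iff.2 hy))

lemma exists_ringOfIntegers_small {K : Type*} [Field K] [NumberField K] (w₁ : InfinitePlace K)
    {t : ℝ} (ht : 0 < t) :
    ∃ y : 𝓞 K, y ≠ 0 ∧ (Algebra.norm ℤ y).natAbs ≤ minkowskiConst K ∧
      ∀ w, w ≠ w₁ → w (y : K) ≤ t ∧ t / minkowskiConst K ≤ w (y : K) := by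
  classical
  set Q := minkowskiConst K with hQ
  have hQ1 : (1 : ℝ) ≤ Q := by exact_mod_cast one_le_minkowskiConst K
  obtain ⟨g, hg1, hg2⟩ := mixedEmbedding.adjust_f K (f := fun _ => t.toNNReal) (w₁ := w₁)
      (Q : NNReal)
    (fun w _ => by simpa using ht)
  have hg2' : ∏ w, (g w : ℝ) ^ w.mult = Q := by exact_mod_cast congrArg NNReal.toReal hg2
  have hg0 : ∀ w, (0 : ℝ) < g w := by
    intro w
    refine lt_of_le_of_ne (NNReal.coe_nonneg _) fun h0 => ?_
    have : ∏ w, (g w : ℝ) ^ w.mult = 0 :=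
      prod_eq_zero (mem_univ w) (by rw [← h0, zero_pow InfinitePlace.mult_ne_zero])
    linarith
  obtain ⟨y, hy0, hy⟩ := exists_ringOfIntegers_le (fun w => (g w : ℝ)) hg0 hg2'.ge
  have hN := prod_eq_natAbs_norm y
  refine ⟨y, hy0, ?_, fun w hw => ?_⟩
  · have : ((Algebra.norm ℤ y).natAbs : ℝ) ≤ Q := by
      rw [← hN, ← hg2']
      exact prod_le_prod (fun w _ => by positivity) fun w _ => by gcongr; exact hy w
    exact_mod_cast this
  · have hgt : (g w : ℝ) = t := by rw [hg1 w hw]; exact Real.coe_toNNReal _ ht.le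
    refine ⟨hgt ▸ hy w, ?_⟩
    by_contra! hlt
    have h1 : (1 : ℝ) ≤ ∏ w : InfinitePlace K, w (y : K) ^ w.mult := by
      rw [hN]
      exact_mod_cast one_le_natAbs_norm hy0
    have h2 : ∏ w' ∈ univ.erase w, w' (y : K) ^ w'.mult ≤ ∏ w' ∈ univ.erase w,
        (g w' : ℝ) ^ w'.mult :=
      prod_le_prod (fun w _ => by positivity) fun w _ => by gcongr; exact hy w
    rw [← mul_prod_erase _ _ (mem_univ w)] at h1 hg2'
    have hr : w (y : K) / t < 1 / Q := by
      rw [div_lt_div_iff₀ ht (by linarith)]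
      rw [lt_div_iff₀ (by linarith)] at hlt
      linarith
    have hr0 : 0 ≤ w (y : K) / t := by positivity
    have h3 : (w (y : K) / t) ^ w.mult < 1 / Q := by
      refine lt_of_le_of_lt (pow_le_of_le_one hr0 (hr.le.trans ?_) InfinitePlace.mult_ne_zero) hr
      exact div_le_one_of_le₀ hQ1 (by linarith)
    have h4 : (w (y : K)) ^ w.mult = (w (y : K) / t) ^ w.mult * g w ^ w.mult := by
      rw [hgt, div_pow, div_mul_cancel₀ _ (pow_ne_zero _ ht.ne')]
    have h5 : (w (y : K) / t) ^ w.mult *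
        ((g w : ℝ) ^ w.mult * ∏ w' ∈ univ.erase w, (g w' : ℝ) ^ w'.mult) < 1 := by
      rw [hg2']
      rwa [lt_div_iff₀ (by linarith)] at h3
    have h6 : (w (y : K)) ^ w.mult * ∏ w' ∈ univ.erase w, w' (y : K) ^ w'.mult ≤
        (w (y : K) / t) ^ w.mult * ((g w : ℝ) ^ w.mult * ∏ w' ∈ univ.erase w,
            (g w' : ℝ) ^ w'.mult) := by
      rw [h4, mul_assoc]
      gcongr
    linarith

lemma dvd_of_repr_emod_eq {K : Type*} [Field K] [NumberField K] {y z : 𝓞 K}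
    (h : ∀ i, (RingOfIntegers.basis K).repr y i % ((Algebra.norm ℤ y).natAbs : ℤ) =
      (RingOfIntegers.basis K).repr z i % ((Algebra.norm ℤ y).natAbs : ℤ)) : y ∣ z := by
  have h1 : y ∣ ((Algebra.norm ℤ y).natAbs : 𝓞 K) := by
    rw [← Ideal.absNorm_span_singleton, ← Ideal.mem_span_singleton]
    exact Ideal.absNorm_mem _
  have h2 : ((Algebra.norm ℤ y).natAbs : 𝓞 K) ∣ z - y := by
    choose q hq using fun i => Int.ModEq.dvd (h i)
    refine ⟨∑ i, q i • RingOfIntegers.basis K i, ?_⟩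
    rw [← nsmul_eq_mul, ← natCast_zsmul, smul_sum, ← (RingOfIntegers.basis K).sum_repr (z - y)]
    refine sum_congr rfl fun i _ => ?_
    rw [smul_smul, ← hq i, map_sub, Finsupp.sub_apply]
  exact (dvd_sub_left (dvd_refl y)).1 (h1.trans h2)

/-- A bound for the logarithms of a system of independent units. -/
noncomputable def unitBound (K : Type*) [Field K] [NumberField K] : ℝ :=
  Module.finrank ℚ K * (((minkowskiConst K + 1) ^ (Module.finrank ℚ K + 1) + 2) *
    (1 + Real.log (minkowskiConst K)))

lemma sum_mult_mul_log {K : Type*} [Field K] [NumberField K] {x : K} (hx : x ≠ 0) :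
    ∑ w : InfinitePlace K, w.mult * Real.log (w x) = Real.log |(Algebra.norm ℚ x : ℝ)| := by
  rw [show |(Algebra.norm ℚ x : ℝ)| = ((|Algebra.norm ℚ x| : ℚ) : ℝ) by simp,
    ← InfinitePlace.prod_eq_abs_norm, Real.log_prod fun w _ => ?_]
  · exact sum_congr rfl fun w _ => (Real.log_pow _ _).symm
  · exact pow_ne_zero _ ((map_ne_zero _).2 hx)

lemma sum_mult_mul_log_unit {K : Type*} [Field K] [NumberField K] (ε : (𝓞 K)ˣ) :
    ∑ w : InfinitePlace K, w.mult * Real.log (w (ε : K)) = 0 := by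
  rw [sum_mult_mul_log (by simp)]
  have : |(Algebra.norm ℚ (ε : K) : ℝ)| = 1 := by
    have := Units.norm K ε
    exact_mod_cast congrArg (Rat.cast : ℚ → ℝ) this
  rw [this, Real.log_one]

lemma exists_unit_of_place {K : Type*} [Field K] [NumberField K] (w₁ : InfinitePlace K) :
    ∃ ε : (𝓞 K)ˣ, (∀ w, w ≠ w₁ → Real.log (w (ε : K)) ≤ -1) ∧
      ∀ w : InfinitePlace K, |Real.log (w (ε : K))| ≤ unitBound K := by
  classical
  set Q := minkowskiConst K with hQ
  set d := Module.finrank ℚ K with hd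
  have hQ1 : (1 : ℝ) ≤ Q := by exact_mod_cast one_le_minkowskiConst K
  have hlogQ : 0 ≤ Real.log Q := Real.log_nonneg hQ1
  set ℓ : ℝ := 1 + Real.log Q with hℓ
  choose y hy0 hyN hy using fun k : ℕ =>
    exists_ringOfIntegers_small w₁ (Real.exp_pos (-(k * ℓ)))
  have hlog : ∀ k w, w ≠ w₁ → -(k * ℓ) - Real.log Q ≤ Real.log (w (y k : K)) ∧
      Real.log (w (y k : K)) ≤ -(k * ℓ) := by
    intro k w hw
    have hpos : 0 < w (y k : K) := InfinitePlace.pos_iff.2 (by simpa using hy0 k)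
    constructor
    · have := Real.log_le_log (by positivity) (hy k w hw).2
      rwa [Real.log_div (Real.exp_pos _).ne' (by linarith), Real.log_exp] at this
    · have := Real.log_le_log hpos (hy k w hw).1
      rwa [Real.log_exp] at this
  let I := Module.Free.ChooseBasisIndex ℤ (𝓞 K)
  have hI : Fintype.card I = d := by
    rw [← Module.finrank_eq_card_chooseBasisIndex, RingOfIntegers.rank]
  let F : Fin ((Q + 1) ^ (d + 1) + 1) → Fin (Q + 1) × (I → Fin (Q + 1)) := fun k =>
    (⟨(Algebra.norm ℤ (y k)).natAbs, Nat.lt_succ_of_le (hyN k)⟩, fun i =>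
      ⟨((RingOfIntegers.basis K).repr (y k) i % ((Algebra.norm ℤ (y k)).natAbs : ℤ)).toNat, by
        have h1 := one_le_natAbs_norm (hy0 k)
        have h2 := Int.emod_lt_of_pos ((RingOfIntegers.basis K).repr (y k) i)
          (b := ((Algebra.norm ℤ (y k)).natAbs : ℤ)) (by omega)
        have h3 := hyN k
        omega⟩)
  obtain ⟨k, j, hkj, hF⟩ : ∃ k j, k ≠ j ∧ F k = F j :=
    Fintype.exists_ne_map_eq_of_card_lt F (by simp [hI, pow_succ, mul_comm])
  have key : ∀ k j, F k = F j → y k ∣ y j := by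
    intro k j hF
    have h1 : (Algebra.norm ℤ (y k)).natAbs = (Algebra.norm ℤ (y j)).natAbs := by
      simpa [F] using congrArg (fun p => (p.1 : ℕ)) hF
    refine dvd_of_repr_emod_eq fun i => ?_
    have h2 : ((RingOfIntegers.basis K).repr (y k) i % ((Algebra.norm ℤ (y k)).natAbs : ℤ)).toNat =
        ((RingOfIntegers.basis K).repr (y j) i % ((Algebra.norm ℤ (y j)).natAbs : ℤ)).toNat :=
      congrArg (fun p => (p.2 i : ℕ)) hF
    rw [← h1] at h2
    have h3 : ((Algebra.norm ℤ (y k)).natAbs : ℤ) ≠ 0 := by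
      have := one_le_natAbs_norm (hy0 k)
      omega
    have h4 := Int.emod_nonneg ((RingOfIntegers.basis K).repr (y k) i) h3
    have h5 := Int.emod_nonneg ((RingOfIntegers.basis K).repr (y j) i) h3
    omega
  wlog hlt : j < k generalizing k j
  · exact this j k hkj.symm hF.symm (lt_of_le_of_ne (not_lt.1 hlt) hkj)
  obtain ⟨ε, hε⟩ := associated_of_dvd_dvd (key j k hF.symm) (key k j hF)
  have hεlog : ∀ w : InfinitePlace K, Real.log (w (ε : K)) = Real.log (w (y k : K)) - Real.log
      (w (y j : K)) := by
    intro w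
    have hj : w (y j : K) ≠ 0 := (map_ne_zero _).2 (by simpa using hy0 j)
    have h1 : w (y k : K) = w (y j : K) * w (ε : K) := by rw [← hε]; simp
    rw [h1, Real.log_mul hj ((map_ne_zero _).2 (by simp))]
    ring
  have hkj' : (j : ℝ) + 1 ≤ k := by exact_mod_cast hlt
  have hkle : (k : ℝ) ≤ (Q + 1) ^ (d + 1) := by exact_mod_cast Nat.lt_succ_iff.1 k.2
  have hj0 : (0 : ℝ) ≤ j := by positivity
  have hd1 : (1 : ℝ) ≤ d := by exact_mod_cast Module.finrank_pos (R := ℚ) (M := K)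
  set U : ℝ := ((Q + 1) ^ (d + 1) + 2) * ℓ with hU
  have hU0 : 0 ≤ U := by positivity
  have hne : ∀ w, w ≠ w₁ → |Real.log (w (ε : K))| ≤ U := by
    intro w hw
    obtain ⟨h1, h2⟩ := hlog k w hw
    obtain ⟨h3, h4⟩ := hlog j w hw
    rw [hεlog, abs_le]
    constructor <;> nlinarith
  refine ⟨ε, fun w hw => ?_, fun w => ?_⟩
  · obtain ⟨h1, h2⟩ := hlog k w hw
    obtain ⟨h3, h4⟩ := hlog j w hw
    rw [hεlog]
    nlinarith
  · change _ ≤ d * U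
    by_cases hw : w = w₁
    · subst hw
      have h1 := sum_mult_mul_log_unit ε
      rw [← add_sum_erase _ _ (mem_univ w)] at h1
      have h2 : |∑ v ∈ univ.erase w, v.mult * Real.log (v (ε : K))| ≤ d * U := by
        refine (abs_sum_le_sum_abs _ _).trans ?_
        calc ∑ v ∈ univ.erase w, |v.mult * Real.log (v (ε : K))|
            ≤ ∑ v ∈ univ.erase w, v.mult * U := by
              refine sum_le_sum fun v hv => ?_
              rw [abs_mul, Nat.abs_cast]
              gcongr
              exact hne v (ne_of_mem_erase hv)
          _ ≤ ∑ v : InfinitePlace K, v.mult * U :=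
              sum_le_sum_of_subset_of_nonneg (erase_subset _ _) fun v _ _ => by positivity
          _ = d * U := by
              rw [← sum_mul, hd, ← InfinitePlace.sum_mult_eq]
              push_cast
              rfl
      rw [eq_neg_of_add_eq_zero_right h1, abs_neg, abs_mul, Nat.abs_cast] at h2
      refine le_trans (le_mul_of_one_le_left (abs_nonneg _) ?_) h2
      exact_mod_cast InfinitePlace.mult_pos
    · exact (hne w hw).trans (le_mul_of_one_le_left hU0 hd1)


lemma sum_abs_le_sum_abs_mulVec {J : Type*} [Fintype J] (A : Matrix J J ℝ)
    (hA : ∀ v, ∑ w, |A w v| + 1 ≤ 2 * |A v v|) (x : J → ℝ) :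
    ∑ v, |x v| ≤ ∑ w, |A.mulVec x w| := by
  classical
  have h1 : ∀ w, 2 * (|A w w| * |x w|) - ∑ v, |A w v| * |x v| ≤ |A.mulVec x w| := by
    intro w
    rw [Matrix.mulVec, dotProduct, ← add_sum_erase univ _ (mem_univ w),
      ← add_sum_erase univ (fun v => A w v * x v) (mem_univ w)]
    have h2 := abs_sub (A w w * x w + ∑ v ∈ univ.erase w, A w v * x v)
      (∑ v ∈ univ.erase w, A w v * x v)
    rw [add_sub_cancel_right, abs_mul] at h2
    have h3 := abs_sum_le_sum_abs (fun v => A w v * x v) (univ.erase w)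
    simp only [abs_mul] at h3
    linarith
  calc ∑ v, |x v| ≤ ∑ v, (2 * |A v v| - ∑ w, |A w v|) * |x v| := by
        refine sum_le_sum fun v _ => le_mul_of_one_le_left (abs_nonneg _) ?_
        linarith [hA v]
    _ = ∑ w, (2 * (|A w w| * |x w|) - ∑ v, |A w v| * |x v|) := by
        rw [sum_sub_distrib, sum_comm, ← sum_sub_distrib]
        refine sum_congr rfl fun v _ => ?_
        rw [sub_mul, sum_mul, mul_assoc]
    _ ≤ _ := sum_le_sum fun w _ => h1 w

lemma exists_mulVec_eq {J : Type*} [Fintype J] (A : Matrix J J ℝ)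
    (hA : ∀ v, ∑ w, |A w v| + 1 ≤ 2 * |A v v|) (y : J → ℝ) :
    ∃ x, A.mulVec x = y ∧ ∀ v, |x v| ≤ ∑ w, |y w| := by
  classical
  have hinj : Function.Injective A.mulVecLin := by
    rw [← LinearMap.ker_eq_bot, LinearMap.ker_eq_bot']
    intro x hx
    have h1 := sum_abs_le_sum_abs_mulVec A hA x
    rw [← Matrix.mulVecLin_apply, hx] at h1
    simp only [Pi.zero_apply, abs_zero, sum_const_zero] at h1
    funext v
    have h2 := single_le_sum (f := fun v => |x v|) (fun v _ => abs_nonneg _) (mem_univ v)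
    exact abs_nonpos_iff.1 (h2.trans h1)
  obtain ⟨x, hx⟩ := LinearMap.injective_iff_surjective.1 hinj y
  refine ⟨x, hx, fun v => ?_⟩
  have h1 := sum_abs_le_sum_abs_mulVec A hA x
  rw [← Matrix.mulVecLin_apply, hx] at h1
  exact (single_le_sum (f := fun v => |x v|) (fun v _ => abs_nonneg _) (mem_univ v)).trans h1

lemma sum_abs_ite_add_one_le {J : Type*} [Fintype J] [DecidableEq J] (a : J → ℝ) (v w₀ : J)
    (hv : v ≠ w₀) (ha : ∀ w, w ≠ v → a w ≤ -1) (hs : ∑ w, a w = 0) :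
    ∑ w, |if w = w₀ then 0 else a w| + 1 ≤ 2 * |a v| := by
  have h1 : ∑ w ∈ univ.erase v, |a w| = a v := by
    rw [← add_sum_erase _ _ (mem_univ v)] at hs
    rw [eq_neg_of_add_eq_zero_left hs, ← sum_neg_distrib]
    refine sum_congr rfl fun w hw => abs_of_nonpos ?_
    linarith [ha w (ne_of_mem_erase hw)]
  have h2 : ∑ w, |a w| = |a v| + a v := by rw [← add_sum_erase _ _ (mem_univ v), h1]
  have h3 : ∑ w, |if w = w₀ then 0 else a w| + |a w₀| = ∑ w, |a w| := by
    rw [← add_sum_erase _ _ (mem_univ w₀), ← add_sum_erase univ (fun w => |a w|) (mem_univ w₀)]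
    rw [if_pos rfl, abs_zero, zero_add, add_comm]
    congr 1
    exact sum_congr rfl fun w hw => by rw [if_neg (ne_of_mem_erase hw)]
  have h4 : 1 ≤ |a w₀| := by
    have := ha w₀ hv.symm
    rw [abs_of_nonpos (by linarith)]
    linarith
  linarith [le_abs_self (a v)]

lemma card_infinitePlace_le (K : Type*) [Field K] [NumberField K] :
    Fintype.card (InfinitePlace K) ≤ Module.finrank ℚ K := by
  rw [← InfinitePlace.sum_mult_eq, Fintype.card, card_eq_sum_ones]
  exact sum_le_sum fun w _ => InfinitePlace.mult_pos

/-- Every nonzero element of bounded norm is a bounded element times a product of powers of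
fixed bounded units, with controlled exponents. -/
lemma exists_unit_decomposition (K : Type*) [Field K] [NumberField K] :
    ∃ ε : InfinitePlace K → (𝓞 K)ˣ,
        (∀ v (w : InfinitePlace K), |Real.log (w (ε v : K))| ≤ unitBound K) ∧
      ∀ (e : K) (M : ℝ), e ≠ 0 → |Real.log (Algebra.norm ℚ e : ℝ)| ≤ M →
        ∃ (b : InfinitePlace K → ℤ) (η : K), e = η * ∏ v, (ε v : K) ^ b v ∧
          (∀ v, |(b v : ℝ)| ≤ ∑ w : InfinitePlace K, w.mult * |Real.log (w e)| + 1) ∧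
          ∀ w : InfinitePlace K, |Real.log (w η)| ≤ M + (Module.finrank ℚ K : ℝ) ^ 2 *
              unitBound K := by
  classical
  choose ε hε1 hε2 using exists_unit_of_place (K := K)
  refine ⟨ε, hε2, fun e M he hM => ?_⟩
  set U := unitBound K with hU
  set d := Module.finrank ℚ K with hd
  have hd1 : (1 : ℝ) ≤ d := by exact_mod_cast Module.finrank_pos (R := ℚ) (M := K)
  obtain ⟨w₀⟩ : Nonempty (InfinitePlace K) := inferInstance
  have hU0 : 0 ≤ U := (abs_nonneg _).trans (hε2 w₀ w₀)
  have hM0 : 0 ≤ M := (abs_nonneg _).trans hM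
  let A : Matrix (InfinitePlace K) (InfinitePlace K) ℝ := fun w v =>
    if v = w₀ then if w = w₀ then 1 else 0
    else if w = w₀ then 0 else w.mult * Real.log (w (ε v : K))
  have hA : ∀ v, ∑ w, |A w v| + 1 ≤ 2 * |A v v| := by
    intro v
    by_cases hv : v = w₀
    · subst hv
      simp only [A, if_true]
      simp only [apply_ite abs, abs_one, abs_zero, sum_ite_eq', mem_univ, if_true]
      norm_num
    · simp only [A, if_neg hv]
      refine sum_abs_ite_add_one_le (fun w : InfinitePlace K => (w.mult : ℝ) *
          Real.log (w (ε v : K))) v w₀ hv (fun w hw => ?_)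
        (sum_mult_mul_log_unit _)
      have h1 : (1 : ℝ) ≤ w.mult := by exact_mod_cast InfinitePlace.mult_pos
      have h2 := hε1 v w hw
      nlinarith
  obtain ⟨x, hx, hxle⟩ := exists_mulVec_eq A hA
    (fun w => if w = w₀ then 0 else w.mult * Real.log (w e))
  have hx0 : x w₀ = 0 := by
    have := congrFun hx w₀
    simpa [Matrix.mulVec, dotProduct, A] using this
  have hxw : ∀ w, w ≠ w₀ → Real.log (w e) = ∑ v, x v * Real.log (w (ε v : K)) := by
    intro w hw
    have h1 := congrFun hx w
    simp only [Matrix.mulVec, dotProduct, A, if_neg hw] at h1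
    have h2 : ∑ v, (w.mult : ℝ) * (x v * Real.log (w (ε v : K))) = w.mult * Real.log (w e) := by
      rw [← h1]
      refine sum_congr rfl fun v _ => ?_
      by_cases hv : v = w₀
      · rw [hv, hx0]; simp
      · rw [if_neg hv]; ring
    rw [← mul_sum] at h2
    exact (mul_left_cancel₀ (by exact_mod_cast InfinitePlace.mult_ne_zero) h2).symm
  have hxe : ∀ v, |x v| ≤ ∑ w : InfinitePlace K, w.mult * |Real.log (w e)| := by
    intro v
    refine (hxle v).trans (sum_le_sum fun w _ => ?_)
    split_ifs
    · rw [abs_zero]; positivity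
    · rw [abs_mul, Nat.abs_cast]
  have hε0 : ∀ v, (ε v : K) ≠ 0 := fun v => by simp
  set P : K := ∏ v, (ε v : K) ^ ⌊x v⌋ with hP
  have hP0 : P ≠ 0 := prod_ne_zero_iff.2 fun v _ => zpow_ne_zero _ (hε0 v)
  have hPlog : ∀ w : InfinitePlace K, Real.log (w P) = ∑ v, ⌊x v⌋ * Real.log (w (ε v : K)) := by
    intro w
    rw [hP, map_prod, Real.log_prod fun v _ => (map_ne_zero _).2 (zpow_ne_zero _ (hε0 v))]
    refine sum_congr rfl fun v _ => ?_
    rw [map_zpow₀, Real.log_zpow]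
  have hηlog : ∀ w : InfinitePlace K, Real.log (w (e / P)) = Real.log (w e) - Real.log (w P) := by
    intro w
    rw [map_div₀, Real.log_div ((map_ne_zero _).2 he) ((map_ne_zero _).2 hP0)]
  have hfl : ∀ v, |x v - ⌊x v⌋| ≤ 1 := fun v => by
    rw [abs_of_nonneg (by linarith [Int.floor_le (x v)])]
    linarith [Int.lt_floor_add_one (x v)]
  have hne : ∀ w, w ≠ w₀ → |Real.log (w (e / P))| ≤ d * U := by
    intro w hw
    rw [hηlog, hPlog, hxw w hw, ← sum_sub_distrib]
    refine (abs_sum_le_sum_abs _ _).trans ?_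
    calc ∑ v, |x v * Real.log (w (ε v : K)) - ⌊x v⌋ * Real.log (w (ε v : K))|
        ≤ ∑ v : InfinitePlace K, U := by
          refine sum_le_sum fun v _ => ?_
          rw [← sub_mul, abs_mul]
          exact (mul_le_of_le_one_left (abs_nonneg _) (hfl v)).trans (hε2 v w)
      _ ≤ d * U := by
          rw [sum_const, nsmul_eq_mul]
          gcongr
          exact card_infinitePlace_le K
  refine ⟨fun v => ⌊x v⌋, e / P, (div_mul_cancel₀ _ hP0).symm, fun v => ?_, fun w => ?_⟩
  · have h1 := abs_sub_abs_le_abs_sub (⌊x v⌋ : ℝ) (x v)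
    rw [abs_sub_comm] at h1
    linarith [hfl v, hxe v]
  · by_cases hw : w = w₀
    · subst hw
      have h1 : ∑ v : InfinitePlace K, v.mult * Real.log (v (e / P)) =
          Real.log (Algebra.norm ℚ e : ℝ) := by
        rw [← Real.log_abs, ← sum_mult_mul_log he]
        have h2 : ∑ v : InfinitePlace K, v.mult * Real.log (v P) = 0 := by
          simp only [hPlog, mul_sum]
          rw [sum_comm]
          refine sum_eq_zero fun v _ => ?_
          rw [← mul_zero (⌊x v⌋ : ℝ), ← sum_mult_mul_log_unit (ε v), mul_sum]
          exact sum_congr rfl fun _ _ => by ring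
        simp only [hηlog, mul_sub, sum_sub_distrib, h2, sub_zero]
      rw [← add_sum_erase _ _ (mem_univ w)] at h1
      have h2 : |∑ v ∈ univ.erase w, v.mult * Real.log (v (e / P))| ≤ d * (d * U) := by
        refine (abs_sum_le_sum_abs _ _).trans ?_
        calc ∑ v ∈ univ.erase w, |v.mult * Real.log (v (e / P))|
            ≤ ∑ v ∈ univ.erase w, v.mult * (d * U) := by
              refine sum_le_sum fun v hv => ?_
              rw [abs_mul, Nat.abs_cast]
              gcongr
              exact hne v (ne_of_mem_erase hv)
          _ ≤ ∑ v : InfinitePlace K, v.mult * (d * U) :=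
              sum_le_sum_of_subset_of_nonneg (erase_subset _ _) fun v _ _ => by positivity
          _ = d * (d * U) := by
              rw [← sum_mul, hd, ← InfinitePlace.sum_mult_eq]
              push_cast
              rfl
      have h3 : |w.mult * Real.log (w (e / P))| ≤ M + d * (d * U) := by
        rw [eq_sub_of_add_eq h1]
        exact (abs_sub _ _).trans (add_le_add hM h2)
      rw [abs_mul, Nat.abs_cast] at h3
      have h4 : |Real.log (w (e / P))| ≤ w.mult * |Real.log (w (e / P))| :=
        le_mul_of_one_le_left (abs_nonneg _) (by exact_mod_cast InfinitePlace.mult_pos)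
      linarith
    · have h1 : d * U ≤ d ^ 2 * U := by
        gcongr
        nlinarith
      linarith [hne w hw]


lemma norm_le_exp_of_abs_log_le {K : Type*} [Field K] [NumberField K] {x : K} (hx : x ≠ 0) {h : ℝ}
    (hxh : ∀ w : InfinitePlace K, |Real.log (w x)| ≤ h) (ψ : K →+* ℂ) :
    ‖ψ x‖ ≤ Real.exp h ∧ ‖ψ x⁻¹‖ ≤ Real.exp h := by
  have h1 := hxh (InfinitePlace.mk ψ)
  rw [InfinitePlace.apply] at h1
  have hpos : 0 < ‖ψ x‖ := norm_pos_iff.2 ((map_ne_zero _).2 hx)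
  rw [map_inv₀, norm_inv]
  rw [abs_le] at h1
  refine ⟨(Real.log_le_iff_le_exp hpos).1 h1.2, (Real.log_le_iff_le_exp (by positivity)).1 ?_⟩
  rw [Real.log_inv]
  linarith

lemma exists_place_log_le {K : Type*} [Field K] [NumberField K] {u : K} (hu : u ≠ 0) {M T : ℝ}
    (hM : 0 ≤ M) (hMT : M < T) (hN : |Real.log (Algebra.norm ℚ u : ℝ)| ≤ M)
    (w₀ : InfinitePlace K) (hw₀ : |Real.log (w₀ u)| = T) :
    ∃ w : InfinitePlace K, Real.log (w u) ≤ -((T - M) / Module.finrank ℚ K) := by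
  have hd1 : (1 : ℝ) ≤ Module.finrank ℚ K := by
    exact_mod_cast Module.finrank_pos (R := ℚ) (M := K)
  have hTM : (T - M) / Module.finrank ℚ K ≤ T - M := div_le_self (by linarith) hd1
  have hTM0 : 0 < (T - M) / Module.finrank ℚ K := div_pos (by linarith) (by linarith)
  rcases abs_cases (Real.log (w₀ u)) with ⟨h1, -⟩ | ⟨h1, -⟩
  · by_contra! hlt
    have h2 : ∑ w : InfinitePlace K, w.mult * (Real.log (w u) + (T - M) / Module.finrank ℚ K) =
        Real.log (Algebra.norm ℚ u : ℝ) + (T - M) := by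
      simp only [mul_add, sum_add_distrib]
      rw [sum_mult_mul_log hu, Real.log_abs, ← sum_mul]
      congr 1
      rw [← Nat.cast_sum, InfinitePlace.sum_mult_eq]
      field_simp
    have h3 := single_le_sum (f := fun w : InfinitePlace K =>
      (w.mult : ℝ) * (Real.log (w u) + (T - M) / Module.finrank ℚ K))
      (fun w _ => mul_nonneg (by positivity) (by linarith [hlt w])) (mem_univ w₀)
    have h4 : (1 : ℝ) ≤ w₀.mult := by exact_mod_cast InfinitePlace.mult_pos
    have h5 := (abs_le.1 hN).2
    have h6 : Real.log (w₀ u) + (T - M) / Module.finrank ℚ K ≤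
        w₀.mult * (Real.log (w₀ u) + (T - M) / Module.finrank ℚ K) :=
      le_mul_of_one_le_left (by linarith [hlt w₀]) h4
    linarith
  · exact ⟨w₀, by linarith⟩

lemma sum_mult_mul_abs_log_le {K : Type*} [Field K] [NumberField K] {v : K} (hv : v ≠ 0) {M t : ℝ}
    (ht : 0 ≤ t) (hN : |Real.log (Algebra.norm ℚ v : ℝ)| ≤ M)
    (h : ∀ w : InfinitePlace K, Real.log (w v) ≤ t) :
    ∑ w : InfinitePlace K, w.mult * |Real.log (w v)| ≤ 2 * Module.finrank ℚ K * t + M := by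
  have h1 : ∀ w : InfinitePlace K, w.mult * |Real.log (w v)| ≤
      w.mult * (2 * t) - w.mult * Real.log (w v) := by
    intro w
    rw [← mul_sub]
    gcongr
    rcases abs_cases (Real.log (w v)) with ⟨h2, -⟩ | ⟨h2, -⟩ <;> linarith [h w]
  refine (sum_le_sum fun w _ => h1 w).trans ?_
  rw [sum_sub_distrib, sum_mult_mul_log hv, Real.log_abs, ← sum_mul, ← Nat.cast_sum,
    InfinitePlace.sum_mult_eq]
  linarith [(abs_le.1 hN).1]

lemma abs_log_norm_div_le {K : Type*} [Field K] [NumberField K] {x y : 𝓞 K} (hx : x ≠ 0)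
    (hy : y ≠ 0)
    {M : ℝ} (hxM : ((Algebra.norm ℤ x).natAbs : ℝ) ≤ Real.exp M)
    (hyM : ((Algebra.norm ℤ y).natAbs : ℝ) ≤ Real.exp M) :
    |Real.log (Algebra.norm ℚ (x / y : K) : ℝ)| ≤ M := by
  have key : ∀ z : 𝓞 K, z ≠ 0 → ((Algebra.norm ℤ z).natAbs : ℝ) ≤ Real.exp M →
      0 ≤ Real.log (Algebra.norm ℚ (z : K) : ℝ) ∧ Real.log (Algebra.norm ℚ (z : K) : ℝ) ≤ M := by
    intro z hz hzM
    have h1 : |(Algebra.norm ℚ (z : K) : ℝ)| = ((Algebra.norm ℤ z).natAbs : ℝ) := by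
      rw [← Algebra.coe_norm_int, Nat.cast_natAbs]
      simp
    have h2 : (1 : ℝ) ≤ ((Algebra.norm ℤ z).natAbs : ℝ) := by exact_mod_cast one_le_natAbs_norm hz
    rw [← Real.log_abs, h1]
    exact ⟨Real.log_nonneg h2, (Real.log_le_iff_le_exp (by linarith)).2 hzM⟩
  have h0 : ∀ z : 𝓞 K, z ≠ 0 → (Algebra.norm ℚ (z : K) : ℝ) ≠ 0 := by
    intro z hz
    simpa [Algebra.norm_eq_zero_iff] using hz
  have hy' : (y : K) ≠ 0 := by simpa using hy
  have hdiv : Algebra.norm ℚ (x / y : K) = Algebra.norm ℚ (x : K) / Algebra.norm ℚ (y : K) := by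
    rw [eq_div_iff (by exact_mod_cast h0 y hy), ← map_mul, div_mul_cancel₀ _ hy']
  rw [hdiv, Rat.cast_div, Real.log_div (h0 x hx) (h0 y hy), abs_le]
  obtain ⟨h1, h2⟩ := key x hx hxM
  obtain ⟨h3, h4⟩ := key y hy hyM
  constructor <;> linarith

set_option maxHeartbeats 1000000 in
/-- An effective bound for the solutions of the unit equation in a number field. -/
lemma abs_log_div_le_of_add_eq_zero {K : Type*} [Field K] [NumberField K] (c : ℕ) (M : ℝ)
    (hM : 0 ≤ M)
    (hc : 2 * Module.finrank ℚ K + M + (Module.finrank ℚ K : ℝ) ^ 2 * unitBound K + 8 ≤ c)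
    (e₁ e₂ e₃ : 𝓞 K) (he₁ : e₁ ≠ 0) (he₂ : e₂ ≠ 0) (he₃ : e₃ ≠ 0) (he : e₁ + e₂ + e₃ = 0)
    (hN₁ : ((Algebra.norm ℤ e₁).natAbs : ℝ) ≤ Real.exp M)
    (hN₂ : ((Algebra.norm ℤ e₂).natAbs : ℝ) ≤ Real.exp M)
    (hN₃ : ((Algebra.norm ℤ e₃).natAbs : ℝ) ≤ Real.exp M) (w : InfinitePlace K) :
    |Real.log (w (e₁ / e₃ : K))| ≤ Real.exp (10 ^ 12 * c ^ 10) := by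
  classical
  obtain ⟨ε, hε, hdec⟩ := exists_unit_decomposition K
  set d := Module.finrank ℚ K with hd
  set U := unitBound K with hU
  have hd1 : (1 : ℝ) ≤ d := by exact_mod_cast Module.finrank_pos (R := ℚ) (M := K)
  have hU0 : 0 ≤ U := (abs_nonneg _).trans (hε w w)
  have hUU : U ≤ d ^ 2 * U := le_mul_of_one_le_left hU0 (one_le_pow₀ hd1)
  have hc1 : (10 : ℝ) ≤ c := by linarith
  by_contra! hcon
  obtain ⟨w₀, -, hw₀⟩ := exists_max_image univ
    (fun w : InfinitePlace K => |Real.log (w (e₁ / e₃ : K))|) ⟨w, mem_univ _⟩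
  set u : K := e₁ / e₃ with hu
  set v : K := e₂ / e₃ with hv
  have hE₁ : (e₁ : K) ≠ 0 := by simpa using he₁
  have hE₂ : (e₂ : K) ≠ 0 := by simpa using he₂
  have hE₃ : (e₃ : K) ≠ 0 := by simpa using he₃
  have hu0 : u ≠ 0 := div_ne_zero hE₁ hE₃
  have hv0 : v ≠ 0 := div_ne_zero hE₂ hE₃
  have huv : -v - 1 = u := by
    have : (e₁ : K) + e₂ + e₃ = 0 := by exact_mod_cast congrArg (algebraMap (𝓞 K) K) he
    rw [hu, hv]
    field_simp
    linear_combination -this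
  set T := |Real.log (w₀ u)| with hT
  have hTT : Real.exp (10 ^ 12 * c ^ 10) < T := hcon.trans_le (hw₀ w (mem_univ _))
  have hcexp : (10 ^ 12 * c ^ 10 : ℝ) < T := by
    linarith [Real.add_one_le_exp (10 ^ 12 * c ^ 10 : ℝ)]
  have hcpow : (c : ℝ) ≤ c ^ 10 := le_self_pow₀ (by linarith) (by norm_num)
  have hcT : 2 * (c : ℝ) < T := by linarith
  have hNu := abs_log_norm_div_le he₁ he₃ hN₁ hN₃
  have hNv := abs_log_norm_div_le he₂ he₃ hN₂ hN₃
  obtain ⟨w₁, hw₁⟩ := exists_place_log_le hu0 hM (by linarith) hNu w₀ rfl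
  have hvlog : ∀ w : InfinitePlace K, Real.log (w v) ≤ T + 1 := by
    intro w
    have hw : w v ≤ 1 + w u := by
      have h1 : v = -(1 + u) := by rw [← huv]; ring
      rw [h1]
      have := w.1.add_le 1 u
      have h2 : w (-(1 + u)) = w (1 + u) := w.1.map_neg _
      rw [h2]
      refine this.trans (by rw [map_one]; rfl)
    have h2 : w u ≤ Real.exp T := by
      rw [← Real.log_le_iff_le_exp (InfinitePlace.pos_iff.2 hu0)]
      exact (le_abs_self _).trans (hw₀ w (mem_univ _))
    rw [Real.log_le_iff_le_exp (InfinitePlace.pos_iff.2 hv0), Real.exp_add]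
    have h3 : 1 ≤ Real.exp T := Real.one_le_exp (by linarith)
    have h4 : 2 ≤ Real.exp 1 := by linarith [Real.add_one_le_exp (1 : ℝ)]
    nlinarith
  obtain ⟨b, η, hbη, hb, hη⟩ := hdec v M hv0 hNv
  have hsum := sum_mult_mul_abs_log_le hv0 (by linarith : 0 ≤ T + 1) hNv hvlog
  set B₀ := ⌈c * T⌉₊ with hB₀
  have hB₀1 : c * T ≤ B₀ := Nat.le_ceil _
  have hB₀2 : (B₀ : ℝ) ≤ 2 * (c * T) := by
    have := Nat.ceil_lt_add_one (by positivity : 0 ≤ c * T)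
    have : (1 : ℝ) ≤ c * T := by nlinarith
    linarith
  have hη0 : η ≠ 0 := by
    rintro rfl
    exact hv0 (by rw [hbη, zero_mul])
  have hd0 : (0 : ℝ) ≤ d ^ 2 * U := by positivity
  have hdc : (d : ℝ) ≤ c := by linarith
  have hε0 : ∀ j, (ε j : K) ≠ 0 := fun j => by simp
  have hεi : ∀ j, IsIntegral ℤ (ε j : K) := fun j => RingOfIntegers.isIntegral_coe _
  have hεi' : ∀ j, IsIntegral ℤ (ε j : K)⁻¹ := fun j => by
    have h1 : ((ε j : K))⁻¹ = (((ε j)⁻¹ : (𝓞 K)ˣ) : K) :=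
      inv_eq_of_mul_eq_one_right (by rw [← map_mul, Units.mul_inv, map_one])
    rw [h1]
    exact RingOfIntegers.isIntegral_coe _
  have hexp := fun j => norm_le_exp_of_abs_log_le (hε0 j) (h := M + d ^ 2 * U)
    (fun w => (hε j w).trans (by linarith))
  have hηexp := norm_le_exp_of_abs_log_le hη0 hη
  have hprod : -η * ∏ j, (ε j : K) ^ b j = -v := by rw [hbη, neg_mul]
  have key := norm_sub_one_ge_of_exp_le w₁.embedding c (16 * c ^ 4) (2 * c ^ 2 * B₀) B₀
    (M + d ^ 2 * U) (by exact_mod_cast (by linarith : (1 : ℝ) ≤ c))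
    (by
      have : 0 < c := by exact_mod_cast (by linarith : (0 : ℝ) < c)
      have : 0 < 16 * c ^ 4 := by positivity
      omega)
    (by exact_mod_cast hdc)
    (by
      have h1 : (Fintype.card (InfinitePlace K) : ℝ) ≤ d := by
        exact_mod_cast card_infinitePlace_le K
      exact_mod_cast (by linarith : (Fintype.card (InfinitePlace K) : ℝ) + 1 ≤ c))
    (by linarith) (by linarith)
    (by
      refine (Real.exp_le_exp.2 ?_).trans (hTT.le.trans ?_)
      · push_cast
        have h1 : (c : ℝ) + 16 * c ^ 4 ≤ 17 * c ^ 4 := by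
          have : (c : ℝ) ≤ c ^ 4 := le_self_pow₀ (by linarith) (by norm_num)
          linarith
        calc (10 ^ 8 * (c + 16 * c ^ 4) ^ 2 : ℝ) ≤ 10 ^ 8 * (17 * c ^ 4) ^ 2 := by gcongr
          _ = 289 * 10 ^ 8 * c ^ 8 := by ring
          _ ≤ 10 ^ 12 * c ^ 10 := by
            have : (c : ℝ) ^ 8 ≤ c ^ 10 := pow_le_pow_right₀ (by linarith) (by norm_num)
            have h0 : (0 : ℝ) ≤ c ^ 8 := by positivity
            linarith
      · push_cast
        have : (1 : ℝ) ≤ c ^ 2 := one_le_pow₀ (by linarith)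
        nlinarith)
    (by
      have : (1 : ℝ) ≤ B₀ := by nlinarith
      exact_mod_cast this)
    le_rfl (fun j => (ε j : K)) hε0 hεi hεi' (fun j ψ => (hexp j ψ).1) (fun j ψ => (hexp j ψ).2)
    (-η) (neg_ne_zero.2 hη0) (Algebra.norm ℤ e₃).natAbs
    (by have := one_le_natAbs_norm he₃; omega)
    (by
      have h1 : e₃ ∣ ((Algebra.norm ℤ e₃).natAbs : 𝓞 K) := by
        rw [← Ideal.absNorm_span_singleton, ← Ideal.mem_span_singleton]
        exact Ideal.absNorm_mem _
      obtain ⟨q, hq⟩ := h1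
      have h2 : (((Algebra.norm ℤ e₃).natAbs : ℕ) : K) = e₃ * q := by
        exact_mod_cast congrArg (algebraMap (𝓞 K) K) hq
      have h3 : η = v * ∏ j, (ε j : K) ^ (-b j) := by
        rw [hbη, mul_assoc, ← prod_mul_distrib, prod_eq_one, mul_one]
        intro j _
        rw [← zpow_add₀ (hε0 j), add_neg_cancel, zpow_zero]
      have h4 : (((Algebra.norm ℤ e₃).natAbs : ℕ) : K) * -η =
          -((e₂ * q : 𝓞 K) : K) * ∏ j, (ε j : K) ^ (-b j) := by
        rw [h2, h3, hv]
        push_cast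
        field_simp
      rw [h4]
      exact (RingOfIntegers.isIntegral_coe _).neg.mul (isIntegral_prod_zpow _ hεi hεi' _))
    (hN₃.trans (Real.exp_le_exp.2 (by linarith)))
    (fun ψ => by rw [map_neg, norm_neg]; exact (hηexp ψ).1)
    (fun ψ => by rw [inv_neg, map_neg, norm_neg]; exact (hηexp ψ).2)
    b
    (fun j => by
      have h1 : |(b j : ℝ)| ≤ B₀ := by
        refine (hb j).trans ?_
        nlinarith
      exact_mod_cast h1)
    (by
      rw [hprod]
      intro h1
      exact hu0 (by rw [← huv, h1, sub_self]))
  rw [hprod, ← map_one w₁.embedding, ← map_sub, huv, InfinitePlace.norm_embedding_eq] at key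
  have hB : ((2 * c ^ 2 * B₀ : ℕ) : ℝ) / ((16 * c ^ 4 : ℕ) : ℝ) ≤ T / (4 * d) := by
    push_cast
    rw [div_le_div_iff₀ (by positivity) (by positivity)]
    calc 2 * (c : ℝ) ^ 2 * B₀ * (4 * d) ≤ 2 * (c : ℝ) ^ 2 * (2 * (c * T)) * (4 * c) := by gcongr
      _ = T * (16 * c ^ 4) := by ring
  have h1 : Real.exp (-(T / (4 * d))) / 2 ≤ Real.exp (-((T - M) / d)) := by
    rw [Real.log_le_iff_le_exp (InfinitePlace.pos_iff.2 hu0)] at hw₁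
    refine le_trans ?_ (key.trans hw₁)
    gcongr
  have h2 : Real.exp (-(T / (4 * d)) - 1) ≤ Real.exp (-((T - M) / d)) := by
    refine le_trans ?_ h1
    rw [Real.exp_sub]
    gcongr
    linarith [Real.add_one_le_exp (1 : ℝ)]
  have h3 : (T - M) / d ≤ T / (4 * d) + 1 := by linarith [Real.exp_le_exp.1 h2]
  have h4 : T / (4 * d) + 1 = (T / 4 + d) / d := by
    rw [add_div, div_self (by linarith : (d : ℝ) ≠ 0), div_div]
  rw [h4, div_le_div_iff_of_pos_right (by linarith)] at h3
  linarith

end BakerHyperelliptic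

namespace BakerHyperelliptic
open Finset NumberField Pointwise

lemma pow_finrank_eq_top {K L : Type*} [Field K] [Field L] [Algebra K L] [FiniteDimensional K L]
    (V : Submodule K L) (h1 : 1 ∈ V) (hV : Algebra.adjoin K (V : Set L) = ⊤) :
    V ^ Module.finrank K L = ⊤ := by
  have hone : (1 : Submodule K L) ≤ V := Submodule.one_le.2 h1
  have hmono : Monotone fun k => V ^ k := monotone_nat_of_le_succ fun k => by
    rw [pow_succ]
    exact le_mul_of_one_le_right' hone
  have hstep : ∃ k ≤ Module.finrank K L, V ^ k = V ^ (k + 1) := by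
    by_contra! hne
    have h2 : ∀ k ≤ Module.finrank K L + 1, k ≤ Module.finrank K ↥(V ^ k) := by
      intro k
      induction k with
      | zero => simp
      | succ k ih =>
        intro hk
        have h3 := ih (by omega)
        have h4 := Submodule.finrank_lt_finrank_of_lt
          ((hmono k.le_succ).lt_of_ne (hne k (by omega)))
        exact h3.trans_lt h4
    have h3 := h2 _ le_rfl
    have h4 := Submodule.finrank_le (V ^ (Module.finrank K L + 1))
    omega
  obtain ⟨k, hk, hkk⟩ := hstep
  have hstab : ∀ m, V ^ (k + m) = V ^ k := by
    intro m
    induction m with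
    | zero => rfl
    | succ m ih => rw [← add_assoc, pow_succ, ih, ← pow_succ, ← hkk]
  have h1k : (1 : L) ∈ V ^ k := by
    have : (1 : Submodule K L) ≤ V ^ k := by simpa using hmono (Nat.zero_le k)
    exact Submodule.one_le.1 this
  have hmul : ∀ x y : L, x ∈ V ^ k → y ∈ V ^ k → x * y ∈ V ^ k := by
    intro x y hx hy
    rw [← hstab k, pow_add]
    exact Submodule.mul_mem_mul hx hy
  have hle : V ≤ V ^ k := by
    rw [hkk]
    simpa using hmono (Nat.le_add_left 1 k)
  have h5 : Algebra.adjoin K (V : Set L) ≤ (V ^ k).toSubalgebra h1k hmul :=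
    Algebra.adjoin_le fun x hx => hle hx
  rw [hV] at h5
  refine top_unique fun x _ => hmono hk (h5 (Algebra.mem_top (x := x)))

lemma abs_discr_le {L : Type*} [Field L] [NumberField L] (S : Set L) (A : ℝ) (hA : 1 ≤ A)
    (hS : ∀ s ∈ S, IsIntegral ℤ s) (hSA : ∀ s ∈ S, ∀ ψ : L →+* ℂ, ‖ψ s‖ ≤ A)
    (hgen : Algebra.adjoin ℚ S = ⊤) :
    |(discr L : ℝ)| ≤ ((Module.finrank ℚ L).factorial *
      (A ^ Module.finrank ℚ L) ^ Module.finrank ℚ L) ^ 2 := by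
  classical
  set d := Module.finrank ℚ L with hd
  set V := Submodule.span ℚ (insert 1 S) with hV
  have htop : V ^ d = ⊤ := by
    apply pow_finrank_eq_top V (Submodule.subset_span (Set.mem_insert _ _))
    rw [eq_top_iff, ← hgen]
    exact Algebra.adjoin_mono ((Set.subset_insert _ _).trans Submodule.subset_span)
  rw [hV, Submodule.span_pow] at htop
  have hmem : ∀ k : ℕ, ∀ x ∈ (insert 1 S : Set L) ^ k,
      IsIntegral ℤ x ∧ ∀ ψ : L →+* ℂ, ‖ψ x‖ ≤ A ^ k := by
    intro k
    induction k with
    | zero =>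
      intro x hx
      obtain rfl : x = 1 := by simpa using hx
      exact ⟨isIntegral_one, fun ψ => by simp⟩
    | succ k ih =>
      intro x hx
      rw [pow_succ] at hx
      obtain ⟨y, hy, z, hz, rfl⟩ := Set.mem_mul.1 hx
      have hz' : IsIntegral ℤ z ∧ ∀ ψ : L →+* ℂ, ‖ψ z‖ ≤ A := by
        rcases hz with rfl | hz
        · exact ⟨isIntegral_one, fun ψ => by simpa using hA⟩
        · exact ⟨hS z hz, hSA z hz⟩
      refine ⟨(ih y hy).1.mul hz'.1, fun ψ => ?_⟩
      rw [map_mul, norm_mul, pow_succ]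
      exact mul_le_mul ((ih y hy).2 ψ) (hz'.2 ψ) (norm_nonneg _) (by positivity)
  obtain ⟨s, hs, hspan, hind⟩ := exists_linearIndependent ℚ ((insert 1 S : Set L) ^ d)
  rw [htop] at hspan
  let b : Module.Basis s ℚ L := Module.Basis.mk hind (by rw [Subtype.range_coe, hspan])
  have hb : ∀ i, b i = (i : L) := fun i => by simp [b]
  have : Finite s := Module.Finite.finite_basis b
  have : Fintype s := Fintype.ofFinite s
  have hcard : Fintype.card s = d := (Module.finrank_eq_card_basis b).symm
  have e : s ≃ (L →ₐ[ℚ] ℂ) := Fintype.equivOfCardEq (by rw [hcard, AlgHom.card])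
  have hup : ‖((Algebra.discr ℚ b : ℚ) : ℂ)‖ ≤ (d.factorial * (A ^ d) ^ d) ^ 2 := by
    have h1 := Algebra.discr_eq_det_embeddingsMatrixReindex_pow_two ℚ ℂ b e
    rw [eq_ratCast] at h1
    rw [h1, norm_pow]
    gcongr
    rw [← hcard]
    apply norm_det_le
    intro i j
    rw [hcard]
    have := (hmem d i (hs i.2)).2 ((e j : L →ₐ[ℚ] ℂ) : L →+* ℂ)
    simpa [Algebra.embeddingsMatrixReindex, Algebra.embeddingsMatrix, hb] using this
  set b₀ := (integralBasis L).reindex ((integralBasis L).indexEquiv b) with hb₀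
  have hdisc : (discr L : ℚ) = Algebra.discr ℚ b₀ := by
    rw [coe_discr, hb₀, Module.Basis.coe_reindex, Algebra.discr_reindex]
  have hP := Algebra.discr_of_matrix_vecMul b₀ (b₀.toMatrix b)
  rw [b₀.toMatrix_map_vecMul b, ← hdisc] at hP
  have hint : IsIntegral ℤ (b₀.toMatrix b).det := IsIntegral.det fun i j => by
    rw [Module.Basis.toMatrix_apply, hb₀, Module.Basis.repr_reindex_apply, hb]
    have h1 := integralBasis_repr_apply L ⟨j, (hmem d j (hs j.2)).1⟩
      (((integralBasis L).indexEquiv b).symm i)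
    have h2 : algebraMap (𝓞 L) L ⟨j, (hmem d j (hs j.2)).1⟩ = j := rfl
    rw [h2] at h1
    rw [h1]
    exact isIntegral_algebraMap
  obtain ⟨r, hr⟩ := IsIntegrallyClosed.isIntegral_iff.1 hint
  rw [← hr] at hP
  have hr0 : r ≠ 0 := by
    rintro rfl
    rw [map_zero, zero_pow two_ne_zero, zero_mul] at hP
    exact Algebra.discr_not_zero_of_basis ℚ b hP
  rw [hP] at hup
  have h3 : ‖(((algebraMap ℤ ℚ r) ^ 2 * (discr L : ℚ) : ℚ) : ℂ)‖ = |(r : ℝ)| ^ 2 *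
      |(discr L : ℝ)| := by
    rw [eq_intCast]
    push_cast
    rw [norm_mul, norm_pow, Complex.norm_intCast, Complex.norm_intCast]
  rw [h3] at hup
  have h4 : (1 : ℝ) ≤ |(r : ℝ)| := by exact_mod_cast Int.one_le_abs hr0
  exact (le_mul_of_one_le_left (abs_nonneg _) (one_le_pow₀ h4)).trans hup

end BakerHyperelliptic

namespace BakerHyperelliptic
open Finset NumberField

lemma exists_isIntegral_mul_sq {K : Type*} [Field K] [NumberField K] (β δ h : 𝓞 K) (c y : ℤ)
    (hβ : β ≠ 0) (hc : c ≠ 0) (heq : δ * β + h * β ^ 2 = c * y ^ 2) :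
    ∃ ξ : K, ξ ≠ 0 ∧ IsIntegral ℤ (β * (δ * ξ) ^ 2 : K) ∧
      ∀ w : InfinitePlace K, w (β * (δ * ξ) ^ 2 : K) ≤
        (c.natAbs * minkowskiConst K) ^ 2 * w (δ : K) ^ 2 := by
  set d := Module.finrank ℚ K with hd
  have hd0 : d ≠ 0 := (Module.finrank_pos (R := ℚ) (M := K)).ne'
  set 𝔞 : Ideal (𝓞 K) := Ideal.span {β, (y : 𝓞 K)} with h𝔞
  have hβ𝔞 : β ∈ 𝔞 := Ideal.subset_span (by simp)
  have hy𝔞 : (y : 𝓞 K) ∈ 𝔞 := Ideal.subset_span (by simp)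
  have h𝔞0 : 𝔞 ≠ ⊥ := fun h0 => hβ (by rw [h0] at hβ𝔞; exact Ideal.mem_bot.1 hβ𝔞)
  have hc1 : 1 ≤ c.natAbs := Nat.one_le_iff_ne_zero.2 (Int.natAbs_ne_zero.2 hc)
  have hQ1 := one_le_minkowskiConst K
  set N := (Algebra.norm ℤ β).natAbs with hN
  have hN1 : 1 ≤ N := one_le_natAbs_norm hβ
  set Na := Ideal.absNorm 𝔞 with hNa
  have hNa1 : 1 ≤ Na := Nat.one_le_iff_ne_zero.2 (by rwa [hNa, Ne, Ideal.absNorm_eq_zero_iff])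
  have hnorm : N ≤ c.natAbs ^ d * Na ^ 2 := by
    have h1 : Ideal.span {(c : 𝓞 K)} * 𝔞 ^ 2 ≤ Ideal.span {β} := by
      rw [pow_two, h𝔞, Ideal.span_mul_span', Ideal.span_mul_span', Ideal.span_le]
      rintro _ ⟨_, rfl, _, ⟨a, ha, b, hb, rfl⟩, rfl⟩
      simp only [Set.mem_insert_iff, Set.mem_singleton_iff] at ha hb
      simp only [SetLike.mem_coe, Ideal.mem_span_singleton]
      rcases ha with ha | ha <;> rcases hb with hb | hb <;> rw [ha, hb]
      · exact ⟨c * β, by ring⟩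
      · exact ⟨c * y, by ring⟩
      · exact ⟨c * y, by ring⟩
      · exact ⟨δ + h * β, by linear_combination -heq⟩
    have h2 := Ideal.absNorm_dvd_absNorm_of_le h1
    rw [map_mul, map_pow, Ideal.absNorm_span_singleton, Ideal.absNorm_span_singleton] at h2
    have h3 : (Algebra.norm ℤ (c : 𝓞 K)).natAbs = c.natAbs ^ d := by
      have : (c : 𝓞 K) = algebraMap ℤ (𝓞 K) c := by simp
      rw [this, Algebra.norm_algebraMap, RingOfIntegers.rank, Int.natAbs_pow]
    rw [h3] at h2
    exact Nat.le_of_dvd (by positivity) h2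
  have hunit : (𝔞 : FractionalIdeal (nonZeroDivisors (𝓞 K)) K) ≠ 0 := by
    rwa [Ne, FractionalIdeal.coeIdeal_eq_zero]
  set c₀ : ℝ := c.natAbs * minkowskiConst K with hc₀
  have hc₀1 : 1 ≤ c₀ := by
    rw [hc₀]
    exact_mod_cast Nat.mul_le_mul hc1 hQ1
  have hβw : ∀ w : InfinitePlace K, 0 < w (β : K) := fun w =>
    InfinitePlace.pos_iff.2 (by simpa using hβ)
  obtain ⟨ξ, hξ, hξ0, hξw⟩ := exists_mem_fractionalIdeal_le (Units.mk0 _ hunit)⁻¹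
    (fun w => c₀ / √(w (β : K))) (fun w => by have := hβw w; positivity) (by
      rw [Units.val_inv_eq_inv_val, Units.val_mk0, map_inv₀, FractionalIdeal.coeIdeal_absNorm]
      simp only [div_pow]
      rw [prod_div_distrib, prod_pow_eq_pow_sum, InfinitePlace.sum_mult_eq]
      have h1 : ∏ w : InfinitePlace K, √(w (β : K)) ^ w.mult = √(N : ℝ) := by
        rw [hN, ← prod_eq_natAbs_norm, Real.sqrt_prod _ fun w _ => by have := hβw w; positivity]
        exact prod_congr rfl fun w _ => by
          rw [eq_comm, Real.sqrt_eq_iff_mul_self_eq (by have := hβw w; positivity) (by positivity),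
            ← mul_pow, Real.mul_self_sqrt (hβw w).le]
      rw [h1]
      push_cast
      rw [← div_eq_mul_inv, div_le_div_iff₀ (by positivity) (by positivity)]
      have h2 : √(N : ℝ) ≤ c.natAbs ^ d * Na := by
        rw [Real.sqrt_le_iff]
        refine ⟨by positivity, ?_⟩
        have h3 : (N : ℝ) ≤ c.natAbs ^ d * Na ^ 2 := by exact_mod_cast hnorm
        have h4 : (1 : ℝ) ≤ c.natAbs ^ d := one_le_pow₀ (by exact_mod_cast hc1)
        rw [mul_pow]
        refine h3.trans ?_
        gcongr
        exact le_self_pow₀ h4 two_ne_zero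
      have h5 : (minkowskiConst K : ℝ) ≤ minkowskiConst K ^ d :=
        le_self_pow₀ (by exact_mod_cast hQ1) hd0
      calc (minkowskiConst K : ℝ) * √(N : ℝ) ≤ minkowskiConst K ^ d *
          (c.natAbs ^ d * Na) := by gcongr
        _ = c₀ ^ d * Na := by rw [hc₀, mul_pow]; ring)
  rw [Units.val_inv_eq_inv_val, Units.val_mk0, FractionalIdeal.mem_inv_iff hunit] at hξ
  have hint : ∀ a ∈ 𝔞, IsIntegral ℤ (ξ * a : K) := by
    intro a ha
    obtain ⟨b, hb⟩ := (FractionalIdeal.mem_one_iff _).1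
      (hξ a (FractionalIdeal.mem_coeIdeal_of_mem _ ha))
    rw [← hb]
    exact RingOfIntegers.isIntegral_coe b
  refine ⟨ξ, hξ0, ?_, fun w => ?_⟩
  · have h1 : (δ : K) * β + h * β ^ 2 = (c : 𝓞 K) * (y : 𝓞 K) ^ 2 := by
      exact_mod_cast congrArg (algebraMap (𝓞 K) K) heq
    have h2 : (β * (δ * ξ) ^ 2 : K) = δ * ((c : 𝓞 K) * (ξ * (y : 𝓞 K)) ^ 2 - h * (ξ * β) ^ 2) := by
      linear_combination (δ * ξ ^ 2 : K) * h1
    rw [h2]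
    exact (RingOfIntegers.isIntegral_coe δ).mul (((RingOfIntegers.isIntegral_coe _).mul
      ((hint _ hy𝔞).pow 2)).sub ((RingOfIntegers.isIntegral_coe h).mul ((hint _ hβ𝔞).pow 2)))
  · have h1 := hβw w
    rw [map_mul, map_pow, map_mul, mul_pow]
    calc w (β : K) * (w (δ : K) ^ 2 * w ξ ^ 2)
        ≤ w (β : K) * (w (δ : K) ^ 2 * (c₀ / √(w (β : K))) ^ 2) := by
          gcongr
          exact hξw w
      _ = c₀ ^ 2 * w (δ : K) ^ 2 := by
          rw [div_pow, Real.sq_sqrt h1.le]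
          field_simp


lemma factorial_le_exp_sq (d : ℕ) : (d.factorial : ℝ) ≤ Real.exp (d ^ 2) := by
  have h1 : (d.factorial : ℝ) ≤ d ^ d := by exact_mod_cast Nat.factorial_le_pow d
  refine h1.trans ?_
  have h2 : (d : ℝ) ≤ Real.exp d := by linarith [Real.add_one_le_exp (d : ℝ)]
  calc (d : ℝ) ^ d ≤ Real.exp d ^ d := by gcongr
    _ = Real.exp (d ^ 2) := by rw [← Real.exp_nat_mul, pow_two]

lemma minkowskiConst_le {L : Type*} [Field L] [NumberField L] (S : Set L) (a m : ℝ) (ha : 1 ≤ a)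
    (hm : Module.finrank ℚ L ≤ m) (hS : ∀ s ∈ S, IsIntegral ℤ s)
    (hSA : ∀ s ∈ S, ∀ ψ : L →+* ℂ, ‖ψ s‖ ≤ Real.exp a)
    (hgen : IntermediateField.adjoin ℚ S = ⊤) :
    (minkowskiConst L : ℝ) ≤ Real.exp (6 * a * m ^ 2) := by
  have h1 := abs_discr_le S (Real.exp a) (Real.one_le_exp (by linarith)) hS hSA (by
    rw [← IntermediateField.adjoin_toSubalgebra_of_isAlgebraic fun x _ =>
        Algebra.IsAlgebraic.isAlgebraic x,
      hgen, IntermediateField.top_toSubalgebra])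
  have hd1 : (1 : ℝ) ≤ Module.finrank ℚ L := by
    exact_mod_cast Module.finrank_pos (R := ℚ) (M := L)
  have hf := factorial_le_exp_sq (Module.finrank ℚ L)
  rw [minkowskiConst]
  generalize Module.finrank ℚ L = d at *
  have hm2 : (d : ℝ) ^ 2 ≤ m ^ 2 := by gcongr
  have hm1 : (d : ℝ) ≤ m ^ 2 := by nlinarith
  have h2 : |(discr L : ℝ)| ≤ Real.exp (4 * a * m ^ 2) := by
    refine h1.trans ?_
    calc ((d.factorial : ℝ) * (Real.exp a ^ d) ^ d) ^ 2
        ≤ (Real.exp (d ^ 2) * (Real.exp a ^ d) ^ d) ^ 2 := by gcongr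
      _ = Real.exp (2 * (1 + a) * d ^ 2) := by
        rw [← pow_mul, ← Real.exp_nat_mul, ← Real.exp_add, ← Real.exp_nat_mul]
        push_cast
        ring_nf
      _ ≤ _ := by
        rw [Real.exp_le_exp]
        have : 2 * (1 + a) ≤ 4 * a := by linarith
        gcongr
  push_cast
  rw [Nat.cast_natAbs, Int.cast_abs]
  have h3 : (2 : ℝ) ^ d ≤ Real.exp d := by
    rw [← mul_one (d : ℝ), Real.exp_nat_mul]
    gcongr
    linarith [Real.add_one_le_exp (1 : ℝ)]
  have h4 : |(discr L : ℝ)| + 1 ≤ Real.exp (4 * a * m ^ 2 + 1) := by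
    have h5 : 1 ≤ Real.exp (4 * a * m ^ 2) := Real.one_le_exp (by positivity)
    rw [Real.exp_add]
    nlinarith [Real.add_one_le_exp (1 : ℝ)]
  calc (2 : ℝ) ^ d * (|(discr L : ℝ)| + 1) ≤ Real.exp d * Real.exp (4 * a * m ^ 2 + 1) := by gcongr
    _ = Real.exp (d + (4 * a * m ^ 2 + 1)) := (Real.exp_add _ _).symm
    _ ≤ _ := by
      rw [Real.exp_le_exp]
      nlinarith

lemma unitBound_le {L : Type*} [Field L] [NumberField L] (q m : ℝ) (hq : 1 ≤ q)
    (hm : Module.finrank ℚ L ≤ m) (hQ : (minkowskiConst L : ℝ) ≤ Real.exp q) :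
    unitBound L ≤ Real.exp (8 * m * q) := by
  have hd1 : (1 : ℝ) ≤ Module.finrank ℚ L := by
    exact_mod_cast Module.finrank_pos (R := ℚ) (M := L)
  have hQ1 : (1 : ℝ) ≤ minkowskiConst L := by exact_mod_cast one_le_minkowskiConst L
  rw [unitBound]
  generalize Module.finrank ℚ L = d at *
  generalize (minkowskiConst L : ℝ) = Q at *
  have h1 : Q + 1 ≤ Real.exp (q + 1) := by
    have h5 : 1 ≤ Real.exp q := Real.one_le_exp (by positivity)
    rw [Real.exp_add]
    nlinarith [Real.add_one_le_exp (1 : ℝ)]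
  have h2 : (Q + 1) ^ (d + 1) ≤ Real.exp (2 * m * (q + 1)) := by
    calc (Q + 1) ^ (d + 1) ≤ Real.exp (q + 1) ^ (d + 1) := by gcongr
      _ = Real.exp ((d + 1) * (q + 1)) := by rw [← Real.exp_nat_mul]; push_cast; rfl
      _ ≤ _ := by
        rw [Real.exp_le_exp]
        gcongr
        linarith
  have h3 : (Q + 1) ^ (d + 1) + 2 ≤ Real.exp (2 * m * (q + 1) + 1) := by
    have h5 : 2 * m * (q + 1) + 1 ≤ Real.exp (2 * m * (q + 1)) := Real.add_one_le_exp _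
    have h6 : 4 ≤ 2 * m * (q + 1) := by nlinarith
    rw [Real.exp_add]
    nlinarith [Real.add_one_le_exp (1 : ℝ)]
  have h4 : 1 + Real.log Q ≤ Real.exp q := by
    have : Real.log Q ≤ q := (Real.log_le_iff_le_exp (by linarith)).2 hQ
    linarith [Real.add_one_le_exp q]
  have h5 : (d : ℝ) ≤ Real.exp m := by linarith [Real.add_one_le_exp m]
  have h6 : 0 ≤ 1 + Real.log Q := by linarith [Real.log_nonneg hQ1]
  calc (d : ℝ) * (((Q + 1) ^ (d + 1) + 2) * (1 + Real.log Q))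
      ≤ Real.exp m * (Real.exp (2 * m * (q + 1) + 1) * Real.exp q) := by gcongr
    _ = Real.exp (m + (2 * m * (q + 1) + 1 + q)) := by rw [Real.exp_add m, Real.exp_add _ q]
    _ ≤ _ := by
      rw [Real.exp_le_exp]
      nlinarith

lemma natAbs_norm_le {L : Type*} [Field L] [NumberField L] {x : 𝓞 L} {A : ℝ}
    (h : ∀ ψ : L →+* ℂ, ‖ψ x‖ ≤ A) :
    ((Algebra.norm ℤ x).natAbs : ℝ) ≤ A ^ Module.finrank ℚ L := by
  rw [← prod_eq_natAbs_norm, ← InfinitePlace.sum_mult_eq, ← prod_pow_eq_pow_sum]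
  gcongr with w
  rw [← InfinitePlace.norm_embedding_eq]
  exact h _

lemma natAbs_norm_le_of_dvd {L : Type*} [Field L] [NumberField L] {x y : 𝓞 L} (hxy : x ∣ y)
    (hy : y ≠ 0) : (Algebra.norm ℤ x).natAbs ≤ (Algebra.norm ℤ y).natAbs :=
  Nat.le_of_dvd (one_le_natAbs_norm hy) (Int.natAbs_dvd_natAbs.2 (map_dvd _ hxy))


lemma place_sq_le {L : Type*} [Field L] [NumberField L] (c : ℕ) (M : ℝ) (hM : 0 ≤ M)
    (hc : 2 * Module.finrank ℚ L + M + (Module.finrank ℚ L : ℝ) ^ 2 * unitBound L + 8 ≤ c)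
    (s₁ s₂ s₃ : 𝓞 L) (h₁₂ : s₁ ^ 2 ≠ s₂ ^ 2) (h₁₃ : s₁ ^ 2 ≠ s₃ ^ 2) (h₂₃ : s₂ ^ 2 ≠ s₃ ^ 2)
    (hN₁₂ : ((Algebra.norm ℤ (s₁ ^ 2 - s₂ ^ 2)).natAbs : ℝ) ≤ Real.exp M)
    (hN₁₃ : ((Algebra.norm ℤ (s₁ ^ 2 - s₃ ^ 2)).natAbs : ℝ) ≤ Real.exp M)
    (hN₂₃ : ((Algebra.norm ℤ (s₂ ^ 2 - s₃ ^ 2)).natAbs : ℝ) ≤ Real.exp M)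
    (w : InfinitePlace L) (r : ℝ) (hr : w ((s₂ ^ 2 - s₃ ^ 2 : 𝓞 L) : L) ≤ Real.exp r) :
    w (s₂ : L) ^ 2 ≤ Real.exp (r + 2 * Real.exp (10 ^ 12 * c ^ 10)) := by
  have hdvd : ∀ x y e : 𝓞 L, x ^ 2 ≠ y ^ 2 → e ∣ x ^ 2 - y ^ 2 →
      ((Algebra.norm ℤ (x ^ 2 - y ^ 2)).natAbs : ℝ) ≤ Real.exp M →
      e ≠ 0 ∧ ((Algebra.norm ℤ e).natAbs : ℝ) ≤ Real.exp M := by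
    intro x y e hxy hd hN
    have h0 : x ^ 2 - y ^ 2 ≠ 0 := sub_ne_zero.2 hxy
    refine ⟨fun h => h0 (by rwa [h, zero_dvd_iff] at hd), le_trans ?_ hN⟩
    exact_mod_cast natAbs_norm_le_of_dvd hd h0
  obtain ⟨a0, aN⟩ := hdvd s₂ s₃ (s₂ - s₃) h₂₃ ⟨s₂ + s₃, by ring⟩ hN₂₃
  obtain ⟨a0', aN'⟩ := hdvd s₂ s₃ (s₂ + s₃) h₂₃ ⟨s₂ - s₃, by ring⟩ hN₂₃
  obtain ⟨b0, bN⟩ := hdvd s₁ s₃ (s₃ - s₁) h₁₃ ⟨-s₃ - s₁, by ring⟩ hN₁₃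
  obtain ⟨b0', bN'⟩ := hdvd s₁ s₃ (-s₃ - s₁) h₁₃ ⟨s₃ - s₁, by ring⟩ hN₁₃
  obtain ⟨c0, cN⟩ := hdvd s₁ s₂ (s₁ - s₂) h₁₂ ⟨s₁ + s₂, by ring⟩ hN₁₂
  have h1 := abs_log_div_le_of_add_eq_zero c M hM hc _ _ _ a0 b0 c0 (by ring) aN bN cN w
  have h2 := abs_log_div_le_of_add_eq_zero c M hM hc _ _ _ a0' b0' c0 (by ring) aN' bN' cN w
  set T := Real.exp (10 ^ 12 * c ^ 10) with hT
  have hpos : ∀ x : 𝓞 L, x ≠ 0 → 0 < w (x : L) := fun x hx =>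
    InfinitePlace.pos_iff.2 (by simpa using hx)
  have hprod : Real.log (w ((s₂ - s₃ : 𝓞 L) : L)) + Real.log (w ((s₂ + s₃ : 𝓞 L) : L)) ≤ r := by
    rw [← Real.log_mul (hpos _ a0).ne' (hpos _ a0').ne', ← map_mul, ← map_mul]
    have h3 : (s₂ - s₃) * (s₂ + s₃) = s₂ ^ 2 - s₃ ^ 2 := by ring
    rw [h3, Real.log_le_iff_le_exp (hpos _ (sub_ne_zero.2 h₂₃))]
    exact hr
  rw [map_div₀, Real.log_div (hpos _ a0).ne' (hpos _ c0).ne', abs_le] at h1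
  rw [map_div₀, Real.log_div (hpos _ a0').ne' (hpos _ c0).ne', abs_le] at h2
  have h3 : w ((s₂ - s₃ : 𝓞 L) : L) ≤ Real.exp (r / 2 + T) := by
    rw [← Real.log_le_iff_le_exp (hpos _ a0)]
    linarith
  have h4 : w ((s₂ + s₃ : 𝓞 L) : L) ≤ Real.exp (r / 2 + T) := by
    rw [← Real.log_le_iff_le_exp (hpos _ a0')]
    linarith
  have h5 : w (s₂ : L) ≤ Real.exp (r / 2 + T) := by
    have h6 : w ((s₂ - s₃ : 𝓞 L) + (s₂ + s₃ : 𝓞 L) : L) ≤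
        w ((s₂ - s₃ : 𝓞 L) : L) + w ((s₂ + s₃ : 𝓞 L) : L) := w.1.add_le _ _
    have h7 : ((s₂ - s₃ : 𝓞 L) + (s₂ + s₃ : 𝓞 L) : L) = ((2 : ℕ) : L) * s₂ := by
      push_cast
      ring
    rw [h7, map_mul, InfinitePlace.map_natCast] at h6
    rw [Nat.cast_ofNat] at h6
    linarith
  calc w (s₂ : L) ^ 2 ≤ Real.exp (r / 2 + T) ^ 2 := by gcongr
    _ = Real.exp (r + 2 * T) := by rw [← Real.exp_nat_mul]; push_cast; ring_nf

end BakerHyperelliptic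

namespace BakerHyperelliptic
open Finset NumberField Polynomial

lemma adjoin_preimage_coe_eq_top {k L : Type*} [Field k] [Field L] [Algebra k L] (S : Set L) :
    IntermediateField.adjoin k ((↑) ⁻¹' S : Set (IntermediateField.adjoin k S)) = ⊤ := by
  apply IntermediateField.lift_injective
  rw [IntermediateField.lift_adjoin, IntermediateField.lift_top]
  congr 1
  ext z
  constructor
  · rintro ⟨y, hy, rfl⟩
    exact hy
  · exact fun hz => ⟨⟨z, IntermediateField.subset_adjoin k S hz⟩, hz, rfl⟩

/-- If `F(x) = c y²` and `F(θ) = 0`, then `x - θ` is a bounded integer up to a square. -/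
lemma exists_sub_mul_sq_bounded {K : Type*} [Field K] [NumberField K] (F : ℤ[X]) (θ : K)
    (hθ : IsIntegral ℤ θ) (x c y : ℤ) (A D : ℝ) (hc : c ≠ 0) (hcA : (|c| : ℝ) ≤ A)
    (hF : aeval θ F = 0) (hF' : aeval θ (derivative F) ≠ 0) (hx : (x : K) ≠ θ)
    (heq : F.eval x = c * y ^ 2) (hD : ∀ ψ : K →+* ℂ, ‖ψ (aeval θ (derivative F))‖ ≤ D) :
    ∃ ξ : K, ξ ≠ 0 ∧ IsIntegral ℤ ((x - θ) * ξ ^ 2) ∧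
      ∀ ψ : K →+* ℂ, ‖ψ ((x - θ) * ξ ^ 2)‖ ≤ (A * minkowskiConst K * D) ^ 2 := by
  obtain ⟨t, rfl⟩ : ∃ t : 𝓞 K, (t : K) = θ := ⟨⟨θ, hθ⟩, rfl⟩
  have hFt : aeval t F = 0 := by
    rwa [aeval_algebraMap_apply, FaithfulSMul.algebraMap_eq_zero_iff] at hF
  rw [aeval_algebraMap_apply] at hF' hD
  obtain ⟨k, hk⟩ := binomExpansion (F.map (Int.castRingHom (𝓞 K))) t (x - t)
  rw [derivative_map, ← eq_intCast (Int.castRingHom (𝓞 K)) x, add_sub_cancel, eval_map_apply,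
    eval_map, eval_map, heq] at hk
  change _ = aeval t F + aeval t (derivative F) * _ + _ at hk
  rw [hFt, zero_add] at hk
  set δ := aeval t (derivative F) with hδ
  obtain ⟨ξ, hξ0, hξi, hξ⟩ := exists_isIntegral_mul_sq ((x : 𝓞 K) - t) δ k c y
    (fun h => hx (by rw [sub_eq_zero] at h; rw [← h]; simp)) hc
    (by simpa using hk.symm)
  have hco : ((x - t : 𝓞 K) : K) = x - t := by simp
  rw [hco] at hξi
  refine ⟨δ * ξ, mul_ne_zero hF' hξ0, hξi, fun ψ => ?_⟩
  have h1 := hξ (InfinitePlace.mk ψ)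
  rw [hco, InfinitePlace.apply, InfinitePlace.apply] at h1
  refine h1.trans ?_
  rw [← mul_pow]
  have h2 : ((c.natAbs : ℕ) : ℝ) ≤ A := by
    rw [Nat.cast_natAbs]
    exact_mod_cast hcA
  have h3 := hD ψ
  gcongr
  exact mul_nonneg ((Nat.cast_nonneg _).trans h2) (Nat.cast_nonneg _)


lemma two_le_exp_one : (2 : ℝ) ≤ Real.exp 1 := by linarith [Real.add_one_le_exp (1 : ℝ)]

lemma ten_pow_twelve_mul_pow_le {z c : ℝ} (hz : 1 ≤ z) (hc0 : 0 ≤ c) (hc : c ≤ Real.exp (385 * z)) :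
    10 ^ 12 * c ^ 10 ≤ Real.exp (3900 * z) := by
  have h1 : (10 : ℝ) ^ 12 ≤ Real.exp (48 * z) := by
    have h2 : (10 : ℝ) ^ 12 ≤ Real.exp (48 * 1) := by
      rw [show (48 * 1 : ℝ) = ((48 : ℕ) : ℝ) * 1 by norm_num, Real.exp_nat_mul]
      calc (10 : ℝ) ^ 12 ≤ 2 ^ 48 := by norm_num
        _ ≤ _ := by gcongr; exact two_le_exp_one
    exact h2.trans (Real.exp_le_exp.2 (by linarith))
  calc 10 ^ 12 * c ^ 10 ≤ Real.exp (48 * z) * Real.exp (385 * z) ^ 10 := by gcongr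
    _ = Real.exp (3898 * z) := by
      rw [← Real.exp_nat_mul, ← Real.exp_add]
      push_cast
      ring_nf
    _ ≤ _ := Real.exp_le_exp.2 (by linarith)

lemma exp_add_exp_le {z a T : ℝ} (ha : 1 ≤ a) (haz : a ≤ z)
    (hT : T ≤ Real.exp (Real.exp (3900 * z))) :
    Real.exp a + Real.exp (a + 1 + 2 * T) ≤ Real.exp (Real.exp (Real.exp (4000 * z))) := by
  set E := Real.exp (3900 * z) with hE
  set T' := Real.exp E with hT'
  have h1 : 3900 * z + 1 ≤ E := Real.add_one_le_exp _
  have h2 : E + 1 ≤ T' := Real.add_one_le_exp _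
  have h3 : Real.exp a + Real.exp (a + 1 + 2 * T) ≤ Real.exp (a + 2 + 2 * T') := by
    have h4 : Real.exp a ≤ Real.exp (a + 1 + 2 * T') := Real.exp_le_exp.2 (by linarith)
    have h5 : Real.exp (a + 1 + 2 * T) ≤ Real.exp (a + 1 + 2 * T') := Real.exp_le_exp.2
        (by linarith)
    have h6 : a + 2 + 2 * T' = a + 1 + 2 * T' + 1 := by ring
    rw [h6, Real.exp_add _ 1]
    nlinarith [two_le_exp_one, Real.exp_pos (a + 1 + 2 * T')]
  refine h3.trans (Real.exp_le_exp.2 ?_)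
  have h4 : a + 2 + 2 * T' ≤ Real.exp 2 * T' := by
    have : (3 : ℝ) ≤ Real.exp 2 := by linarith [Real.add_one_le_exp (2 : ℝ)]
    nlinarith
  refine h4.trans ?_
  rw [hT', ← Real.exp_add]
  refine Real.exp_le_exp.2 ?_
  have h5 : Real.exp (4000 * z) = Real.exp (100 * z) * E := by
    rw [hE, ← Real.exp_add]
    ring_nf
  have h6 : 2 ≤ Real.exp (100 * z) := by linarith [Real.add_one_le_exp (100 * z)]
  rw [h5]
  nlinarith

lemma sum_le_exp {m a U d M : ℝ} (hm : 1 ≤ m) (ha : 1 ≤ a) (hd0 : 0 ≤ d) (hd : d ≤ m)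
    (hM : M ≤ 2 * a * m)
    (hU : U ≤ Real.exp (384 * (a * m ^ 5))) :
    2 * d + M + d ^ 2 * U + 9 ≤ Real.exp (385 * (a * m ^ 5)) := by
  have hm2 : m ^ 2 ≤ a * m ^ 5 :=
    (pow_le_pow_right₀ hm (by norm_num)).trans (le_mul_of_one_le_left (by positivity) ha)
  have hm5 : a * m ≤ a * m ^ 5 :=
    mul_le_mul_of_nonneg_left (le_self_pow₀ hm (by norm_num)) (by linarith)
  have hm1 : m ≤ a * m := le_mul_of_one_le_left (by linarith) ha
  set z := a * m ^ 5 with hz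
  have h1 : d ^ 2 * U ≤ z * Real.exp (384 * z) := by
    calc d ^ 2 * U ≤ d ^ 2 * Real.exp (384 * z) := by gcongr
      _ ≤ z * Real.exp (384 * z) := by
        gcongr
        exact (pow_le_pow_left₀ hd0 hd 2).trans hm2
  have h2 := Real.add_one_le_exp (384 * z)
  have h3 := Real.add_one_le_exp z
  have h4 : Real.exp (385 * z) = Real.exp z * Real.exp (384 * z) := by
    rw [← Real.exp_add]
    ring_nf
  rw [h4]
  have h5 : (z + 1) * Real.exp (384 * z) ≤ Real.exp z * Real.exp (384 * z) := by gcongr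
  linarith

lemma aeval_ringHom_apply {R R' : Type*} [CommRing R] [CommRing R'] (ψ : R →+* R') (F : ℤ[X])
    (z : R) :
    aeval (ψ z) F = ψ (aeval z F) :=
  aeval_algHom_apply ψ.toIntAlgHom z F

lemma unitBound_nonneg (K : Type*) [Field K] [NumberField K] : 0 ≤ unitBound K := by
  have h1 : (1 : ℝ) ≤ minkowskiConst K := by exact_mod_cast one_le_minkowskiConst K
  have := Real.log_nonneg h1
  rw [unitBound]
  positivity

set_option maxHeartbeats 1000000 in
/-- The integer points on `F(X) = c y²`, bounded in terms of the field generated by square roots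
of `x - θ` for three simple zeros `θ` of `F`. -/
lemma abs_le_of_sq_roots {K L : Type*} [Field K] [NumberField K] [Field L] [NumberField L]
    [Algebra K L]
    (F : ℤ[X]) (hFm : F.Monic) (θ : Fin 3 → K) (s : Fin 3 → L)
    (x c y : ℤ) (a m : ℝ) (ha : 1 ≤ a) (hm : Module.finrank ℚ L ≤ m)
    (hroot : ∀ z : ℂ, aeval z F = 0 → ‖z‖ ≤ Real.exp a ∧ ‖aeval z (derivative F)‖ ≤ Real.exp a)
    (hc : c ≠ 0) (hca : (|c| : ℝ) ≤ Real.exp a)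
    (hθ : ∀ i, aeval (θ i) F = 0) (hθ' : ∀ i, aeval (θ i) (derivative F) ≠ 0)
    (hxθ : ∀ i, (x : K) ≠ θ i) (hinj : Function.Injective θ)
    (hs : ∀ i, s i ^ 2 = algebraMap K L (x - θ i))
    (hK : IntermediateField.adjoin ℚ (Set.range θ) = ⊤)
    (hL : IntermediateField.adjoin ℚ (Set.range s) = ⊤) (heq : F.eval x = c * y ^ 2) :
    |(x : ℝ)| ≤ Real.exp (Real.exp (Real.exp (4000 * (a * m ^ 5)))) := by
  have hd1 : (1 : ℝ) ≤ Module.finrank ℚ L := by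
    exact_mod_cast Module.finrank_pos (R := ℚ) (M := L)
  have hm1 : 1 ≤ m := hd1.trans hm
  have hθint : ∀ i, IsIntegral ℤ (θ i) := fun i => ⟨F, hFm, by rw [← aeval_def]; exact hθ i⟩
  have hθψ : ∀ i, ∀ ψ : K →+* ℂ, ‖ψ (θ i)‖ ≤ Real.exp a := fun i ψ =>
    (hroot (ψ (θ i)) (by rw [aeval_ringHom_apply, hθ i, map_zero])).1
  have hdKL : Module.finrank ℚ K ≤ Module.finrank ℚ L :=
    LinearMap.finrank_le_finrank_of_injective (f := (IsScalarTower.toAlgHom ℚ K L).toLinearMap)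
      (FaithfulSMul.algebraMap_injective K L)
  have hdK : (Module.finrank ℚ K : ℝ) ≤ m := le_trans (by exact_mod_cast hdKL) hm
  have hQK : (minkowskiConst K : ℝ) ≤ Real.exp (6 * a * m ^ 2) :=
    minkowskiConst_le (Set.range θ) a m ha hdK (by rintro _ ⟨i, rfl⟩; exact hθint i)
      (by rintro _ ⟨i, rfl⟩; exact hθψ i) hK
  have hξ := fun i => exists_sub_mul_sq_bounded F (θ i) (hθint i) x c y (Real.exp a)
    (Real.exp a) hc hca (hθ i) (hθ' i) (hxθ i) heq (fun ψ => by
      rw [← aeval_ringHom_apply]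
      exact (hroot _ (by rw [aeval_ringHom_apply, hθ i, map_zero])).2)
  choose ξ hξ0 hξi hξψ using hξ
  obtain ⟨t, ht⟩ : ∃ t : Fin 3 → L, ∀ i, t i = algebraMap K L (ξ i) * s i := ⟨_, fun _ => rfl⟩
  have ht2 : ∀ i, t i ^ 2 = algebraMap K L ((x - θ i) * ξ i ^ 2) := fun i => by
    rw [map_mul, ← hs, ht, map_pow, mul_pow, mul_comm]
  have htint : ∀ i, IsIntegral ℤ (t i) := fun i =>
    IsIntegral.of_pow two_pos (by rw [ht2]; exact (hξi i).algebraMap)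
  have htψ : ∀ i, ∀ ψ : L →+* ℂ, ‖ψ (t i)‖ ≤ Real.exp (8 * a * m ^ 2) := fun i ψ => by
    have h1 : ‖ψ (t i)‖ ^ 2 ≤ (Real.exp a * minkowskiConst K * Real.exp a) ^ 2 := by
      rw [← norm_pow, ← map_pow, ht2]
      exact hξψ i (ψ.comp (algebraMap K L))
    refine (le_of_sq_le_sq h1 (by positivity)).trans ?_
    calc Real.exp a * minkowskiConst K * Real.exp a
        ≤ Real.exp a * Real.exp (6 * a * m ^ 2) * Real.exp a := by gcongr
      _ = Real.exp (a + 6 * a * m ^ 2 + a) := by rw [Real.exp_add, Real.exp_add]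
      _ ≤ _ := by
        rw [Real.exp_le_exp]
        have : a ≤ a * m ^ 2 := le_mul_of_one_le_right (by linarith) (one_le_pow₀ hm1)
        linarith
  have hQL : (minkowskiConst L : ℝ) ≤ Real.exp (48 * (a * m ^ 4)) := by
    have haa : a ≤ 8 * a * m ^ 2 := by nlinarith [one_le_pow₀ hm1 (n := 2)]
    have h1 := minkowskiConst_le (algebraMap K L '' Set.range θ ∪ Set.range t) (8 * a * m ^ 2) m
        (by linarith) hm
      (by rintro _ (⟨_, ⟨i, rfl⟩, rfl⟩ | ⟨i, rfl⟩); exacts [(hθint i).algebraMap, htint i])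
      (by
        rintro _ (⟨_, ⟨i, rfl⟩, rfl⟩ | ⟨i, rfl⟩) ψ
        exacts [(hθψ i (ψ.comp (algebraMap K L))).trans (Real.exp_le_exp.2 haa), htψ i ψ])
      (by
        rw [eq_top_iff, ← hL, IntermediateField.adjoin_le_iff]
        rintro _ ⟨i, rfl⟩
        have h2 : algebraMap K L (ξ i) ∈
            IntermediateField.adjoin ℚ (algebraMap K L '' Set.range θ ∪ Set.range t) := by
          refine IntermediateField.adjoin.mono _ _ _ Set.subset_union_left ?_
          have h5 := IntermediateField.adjoin_map ℚ (Set.range θ) (IsScalarTower.toAlgHom ℚ K L)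
          rw [hK] at h5
          exact h5.le ⟨ξ i, trivial, rfl⟩
        have h3 : t i ∈ IntermediateField.adjoin ℚ (algebraMap K L '' Set.range θ ∪ Set.range t) :=
          IntermediateField.subset_adjoin _ _ (Or.inr ⟨i, rfl⟩)
        have h4 : s i = t i / algebraMap K L (ξ i) := by
          rw [ht, mul_div_cancel_left₀]
          simpa using hξ0 i
        rw [h4]
        exact div_mem h3 h2)
    refine h1.trans_eq ?_
    ring_nf
  have hU : unitBound L ≤ Real.exp (384 * (a * m ^ 5)) := by
    have h4 : 1 ≤ a * m ^ 4 := one_le_mul_of_one_le_of_one_le ha (one_le_pow₀ hm1)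
    refine (unitBound_le (48 * (a * m ^ 4)) m (by linarith) hm hQL).trans_eq ?_
    ring_nf
  set c₀ := ⌈2 * Module.finrank ℚ L + 2 * a * m + (Module.finrank ℚ L : ℝ) ^ 2 * unitBound L + 8⌉₊
    with hc₀
  have hU0 := unitBound_nonneg L
  have hc₀le : (c₀ : ℝ) ≤ Real.exp (385 * (a * m ^ 5)) := by
    have h1 := sum_le_exp hm1 ha (by linarith) hm (le_refl (2 * a * m)) hU
    have h2 := Nat.ceil_lt_add_one (a := 2 * Module.finrank ℚ L + 2 * a * m +
      (Module.finrank ℚ L : ℝ) ^ 2 * unitBound L + 8) (by positivity)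
    linarith
  have hsint : ∀ i, IsIntegral ℤ (s i) := fun i => IsIntegral.of_pow two_pos (by
    rw [hs]
    exact ((isIntegral_algebraMap (x := x)).sub (hθint i)).algebraMap)
  obtain ⟨S, hS⟩ : ∃ S : Fin 3 → 𝓞 L, ∀ i, algebraMap (𝓞 L) L (S i) = s i :=
    ⟨fun i => ⟨s i, hsint i⟩, fun i => rfl⟩
  have hdiff : ∀ i j, ∀ ψ : L →+* ℂ, ‖ψ (algebraMap (𝓞 L) L (S i ^ 2 - S j ^ 2))‖ ≤
      Real.exp (a + 1) := by
    intro i j ψ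
    have h1 : algebraMap (𝓞 L) L (S i ^ 2 - S j ^ 2) = algebraMap K L (θ j) - algebraMap K L
        (θ i) := by
      rw [map_sub, map_pow, map_pow, hS, hS, hs, hs, map_sub, map_sub]
      ring
    rw [h1, map_sub, Real.exp_add]
    have h2 := norm_sub_le (ψ (algebraMap K L (θ j))) (ψ (algebraMap K L (θ i)))
    have h3 : ∀ i, ‖ψ (algebraMap K L (θ i))‖ ≤ Real.exp a := fun i =>
      hθψ i (ψ.comp (algebraMap K L))
    nlinarith [h3 i, h3 j, two_le_exp_one, Real.exp_pos a]
  have hne : ∀ i j, i ≠ j → S i ^ 2 ≠ S j ^ 2 := fun i j hij h => hij (hinj (by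
    have h1 := congrArg (algebraMap (𝓞 L) L) h
    rw [map_pow, map_pow, hS, hS, hs, hs] at h1
    exact sub_right_injective (FaithfulSMul.algebraMap_injective K L h1)))
  have hN : ∀ i j, ((Algebra.norm ℤ (S i ^ 2 - S j ^ 2)).natAbs : ℝ) ≤ Real.exp (2 * a * m) := by
    intro i j
    refine (natAbs_norm_le (hdiff i j)).trans ?_
    rw [← Real.exp_nat_mul, Real.exp_le_exp]
    nlinarith
  obtain ⟨w⟩ : Nonempty (InfinitePlace L) := inferInstance
  have hw : ∀ z : L, w z = ‖w.embedding z‖ := fun z => (InfinitePlace.norm_embedding_eq w z).symm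
  have hsq := place_sq_le c₀ (2 * a * m) (by positivity) (Nat.le_ceil _) (S 0) (S 1) (S 2)
    (hne _ _ (by decide)) (hne _ _ (by decide)) (hne _ _ (by decide)) (hN _ _) (hN _ _) (hN _ _) w
    (a + 1) ((hw _).trans_le (hdiff _ _ _))
  change w (algebraMap (𝓞 L) L (S 1)) ^ 2 ≤ _ at hsq
  rw [hS] at hsq
  have hz1 : 1 ≤ a * m ^ 5 := one_le_mul_of_one_le_of_one_le ha (one_le_pow₀ hm1)
  have hx : |(x : ℝ)| ≤ Real.exp a + Real.exp (a + 1 + 2 * Real.exp (10 ^ 12 * c₀ ^ 10)) := by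
    have h1 : (x : L) = algebraMap K L (θ 1) + s 1 ^ 2 := by
      rw [hs, map_sub, map_intCast, add_sub_cancel]
    have h2 : |(x : ℝ)| = w (x : L) := by
      rw [hw, map_intCast, Complex.norm_intCast]
    rw [h2, h1]
    refine (w.1.add_le _ _).trans (add_le_add ?_ ?_)
    · exact (hw _).trans_le (hθψ 1 (w.embedding.comp (algebraMap K L)))
    · rw [map_pow]
      exact hsq
  refine hx.trans (exp_add_exp_le ha (le_mul_of_one_le_right (by linarith) (one_le_pow₀ hm1)) ?_)
  exact Real.exp_le_exp.2 (ten_pow_twelve_mul_pow_le hz1 (Nat.cast_nonneg _) hc₀le)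


lemma finrank_adjoin_simple_le {z : ℂ} (G : ℤ[X]) (hG : G ≠ 0) (hz : aeval z G = 0) :
    IsIntegral ℚ z ∧ Module.finrank ℚ (IntermediateField.adjoin ℚ {z}) ≤ G.natDegree := by
  have h0 : G.map (Int.castRingHom ℚ) ≠ 0 := (Polynomial.map_ne_zero_iff (Int.cast_injective)).2 hG
  have h1 : aeval z (G.map (Int.castRingHom ℚ)) = 0 := by
    rw [← hz, ← algebraMap_int_eq, aeval_map_algebraMap]
  have hint : IsIntegral ℚ z := isAlgebraic_iff_isIntegral.1 ⟨_, h0, h1⟩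
  refine ⟨hint, ?_⟩
  rw [IntermediateField.adjoin.finrank hint]
  exact (natDegree_le_of_dvd (minpoly.dvd ℚ z h1) h0).trans natDegree_map_le

lemma finrank_adjoin_range_le (s : Fin 3 → ℂ) (G : ℤ[X]) (hG : G ≠ 0)
    (hs : ∀ i, aeval (s i) G = 0) :
    Module.finrank ℚ (IntermediateField.adjoin ℚ (Set.range s)) ≤ G.natDegree ^ 3 := by
  have hr : Set.range s = {s 0} ∪ {s 1} ∪ {s 2} := by
    ext z
    simp [Fin.exists_fin_succ, eq_comm]
    tauto
  have h := fun i => (finrank_adjoin_simple_le G hG (hs i)).2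
  rw [hr, IntermediateField.adjoin_union, IntermediateField.adjoin_union]
  refine (IntermediateField.finrank_sup_le _ _).trans ?_
  rw [pow_succ, pow_two]
  exact Nat.mul_le_mul ((IntermediateField.finrank_sup_le _ _).trans (Nat.mul_le_mul (h 0) (h 1)))
      (h 2)

set_option maxHeartbeats 1000000 in
/-- A bound for the integer points on `F(X) = c y²`, where `F` is monic with three simple zeros. -/
lemma abs_le_of_simple_roots (F : ℤ[X]) (hFm : F.Monic) (θ : Fin 3 → ℂ)
    (hinj : Function.Injective θ)
    (x c y : ℤ) (a : ℝ) (ha : 1 ≤ a)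
    (hroot : ∀ z : ℂ, aeval z F = 0 → ‖z‖ ≤ Real.exp a ∧ ‖aeval z (derivative F)‖ ≤ Real.exp a)
    (hc : c ≠ 0) (hca : (|c| : ℝ) ≤ Real.exp a)
    (hθ : ∀ i, aeval (θ i) F = 0) (hθ' : ∀ i, aeval (θ i) (derivative F) ≠ 0)
    (hxθ : ∀ i, (x : ℂ) ≠ θ i) (heq : F.eval x = c * y ^ 2) :
    |(x : ℝ)| ≤ Real.exp (Real.exp (Real.exp (4000 * (a * ((2 * F.natDegree : ℝ) ^ 3) ^ 5)))) := by
  have hdeg2 : (C x - X ^ 2 : ℤ[X]).natDegree = 2 := by compute_degree!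
  have hF0 : 0 < F.natDegree := by
    rw [Nat.pos_iff_ne_zero]
    intro h0
    have := hθ 0
    rw [hFm.natDegree_eq_zero.1 h0, map_one] at this
    exact one_ne_zero this
  set G : ℤ[X] := F.comp (C x - X ^ 2) with hG
  have hGdeg : G.natDegree = 2 * F.natDegree := by rw [hG, natDegree_comp, hdeg2, mul_comm]
  have hG0 : G ≠ 0 := by
    rintro h0
    rw [h0, natDegree_zero] at hGdeg
    omega
  choose s hs using fun i => IsAlgClosed.exists_pow_nat_eq ((x : ℂ) - θ i) two_pos
  have hsG : ∀ i, aeval (s i) G = 0 := fun i => by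
    rw [hG, aeval_comp, map_sub, map_pow, aeval_X, aeval_C, hs, algebraMap_int_eq, eq_intCast,
      sub_sub_cancel, hθ]
  set L := IntermediateField.adjoin ℚ (Set.range s) with hL
  set K := IntermediateField.adjoin ℚ (Set.range θ) with hK
  have hsL : ∀ i, s i ∈ L := fun i => IntermediateField.subset_adjoin _ _ ⟨i, rfl⟩
  have hθK : ∀ i, θ i ∈ K := fun i => IntermediateField.subset_adjoin _ _ ⟨i, rfl⟩
  have : FiniteDimensional ℚ L := IntermediateField.finiteDimensional_adjoin (by
    rintro _ ⟨i, rfl⟩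
    exact (finrank_adjoin_simple_le G hG0 (hsG i)).1)
  have : FiniteDimensional ℚ K := IntermediateField.finiteDimensional_adjoin (by
    rintro _ ⟨i, rfl⟩
    exact (finrank_adjoin_simple_le F hFm.ne_zero (hθ i)).1)
  have : NumberField L := { }
  have : NumberField K := { }
  have hKL : K ≤ L := by
    rw [hK, IntermediateField.adjoin_le_iff]
    rintro _ ⟨i, rfl⟩
    have h1 : θ i = (x : ℂ) - s i ^ 2 := by rw [hs, sub_sub_cancel]
    rw [h1]
    exact sub_mem (intCast_mem L x) (pow_mem (hsL i) 2)
  let _ : Algebra K L := (IntermediateField.inclusion hKL).toRingHom.toAlgebra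
  have hval : ∀ z : K, ((algebraMap K L z : L) : ℂ) = z := fun z => rfl
  have hdeg : (Module.finrank ℚ L : ℝ) ≤ (2 * F.natDegree : ℝ) ^ 3 := by
    have h1 := finrank_adjoin_range_le s G hG0 hsG
    rw [hGdeg] at h1
    exact_mod_cast h1
  have hKr : (↑) ⁻¹' Set.range θ = Set.range fun i => (⟨θ i, hθK i⟩ : K) := by
    ext z
    simp [Subtype.ext_iff]
  have hLr : (↑) ⁻¹' Set.range s = Set.range fun i => (⟨s i, hsL i⟩ : L) := by
    ext z
    simp [Subtype.ext_iff]
  have hKg := adjoin_preimage_coe_eq_top (k := ℚ) (Set.range θ)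
  have hLg := adjoin_preimage_coe_eq_top (k := ℚ) (Set.range s)
  rw [hKr] at hKg
  rw [hLr] at hLg
  refine abs_le_of_sq_roots (K := K) (L := L) F hFm (fun i => ⟨θ i, hθK i⟩) (fun i => ⟨s i, hsL i⟩)
    x c y a _ ha hdeg hroot hc hca (fun i => ?_) (fun i h => hθ' i ?_) (fun i h => hxθ i ?_)
    (fun i j h => hinj ?_) (fun i => ?_) hKg hLg heq
  · apply FaithfulSMul.algebraMap_injective K ℂ
    rw [← aeval_ringHom_apply, map_zero]
    exact hθ i
  · have h1 := congrArg (algebraMap K ℂ) h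
    rw [← aeval_ringHom_apply, map_zero] at h1
    exact h1
  · have h1 := congrArg (algebraMap K ℂ) h
    rw [map_intCast] at h1
    exact h1
  · exact congrArg (algebraMap K ℂ) h
  · apply Subtype.ext
    rw [hval]
    push_cast
    exact hs i


lemma norm_le_two_mul_of_monic (F : ℤ[X]) (hF : F.Monic) (B : ℕ) (hB : ∀ i, |F.coeff i| ≤ B)
    (z : ℂ) (hz : aeval z F = 0) : ‖z‖ ≤ 2 * B := by
  have hB1 : (1 : ℝ) ≤ B := by
    have := hB F.natDegree
    rw [hF.coeff_natDegree] at this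
    exact_mod_cast this
  have hm := hF.map (Int.castRingHom ℂ)
  have hr : (F.map (Int.castRingHom ℂ)).IsRoot z := by
    rw [IsRoot.def, eval_map, ← hz]; rfl
  have h : ‖z‖ ≤ (cauchyBound (F.map (Int.castRingHom ℂ)) : ℝ) := by
    exact_mod_cast (hr.norm_lt_cauchyBound hm.ne_zero).le
  have hs : (sup (range (F.map (Int.castRingHom ℂ)).natDegree)
      (‖(F.map (Int.castRingHom ℂ)).coeff ·‖₊)) ≤ (B : NNReal) := by
    refine Finset.sup_le fun i _ => ?_
    rw [coeff_map, ← NNReal.coe_le_coe]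
    simpa [Int.norm_eq_abs] using (by exact_mod_cast hB i : |(F.coeff i : ℝ)| ≤ B)
  have : cauchyBound (F.map (Int.castRingHom ℂ)) ≤ (B : NNReal) + 1 := by
    rw [cauchyBound, hm.leadingCoeff]
    simpa using hs
  have h2 : ((cauchyBound (F.map (Int.castRingHom ℂ)) : NNReal) : ℝ) ≤ B + 1 := by
    exact_mod_cast this
  linarith

lemma norm_aeval_derivative_le (F : ℤ[X]) (B : ℕ) (hB : ∀ i, |F.coeff i| ≤ B) (z : ℂ) (R : ℝ)
    (hR : 1 ≤ R) (hz : ‖z‖ ≤ R) :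
    ‖aeval z (derivative F)‖ ≤ F.natDegree * (B * F.natDegree * R ^ F.natDegree) := by
  rcases Nat.eq_zero_or_pos F.natDegree with h0 | h0
  · simp [h0, derivative_of_natDegree_zero h0]
  rw [aeval_eq_sum_range' (natDegree_derivative_lt h0.ne')]
  refine (norm_sum_le_of_le (n := fun _ => B * F.natDegree * R ^ F.natDegree) _
    fun i hi => ?_).trans_eq (by simp)
  rw [mem_range] at hi
  rw [coeff_derivative, zsmul_eq_mul, norm_mul, norm_pow]
  have h1 : |(F.coeff (i + 1) : ℝ)| ≤ B := by exact_mod_cast hB (i + 1)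
  have h2 : |(i : ℝ) + 1| ≤ F.natDegree := by
    rw [abs_of_nonneg (by positivity)]
    exact_mod_cast hi
  have h3 : ‖(((F.coeff (i + 1) * (i + 1) : ℤ)) : ℂ)‖ ≤ B * F.natDegree := by
    rw [Complex.norm_intCast]
    push_cast
    rw [abs_mul]
    gcongr
  have h4 : ‖z‖ ^ i ≤ R ^ F.natDegree :=
    (pow_le_pow_left₀ (norm_nonneg _) hz i).trans (pow_le_pow_right₀ hR hi.le)
  gcongr

lemma simple_root_scale {p F : ℤ[X]} (hF : F = p.integralNormalization) (hn : 1 ≤ p.natDegree)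
    (z : ℂ) (hz : rootMultiplicity z (p.map (Int.castRingHom ℂ)) = 1) :
    aeval (p.leadingCoeff * z) F = 0 ∧ aeval (p.leadingCoeff * z) (derivative F) ≠ 0 := by
  have hp : p ≠ 0 := by rintro rfl; simp at hn
  have h0 : p.map (Int.castRingHom ℂ) ≠ 0 := (Polynomial.map_ne_zero_iff Int.cast_injective).2 hp
  have hr : aeval z p = 0 := by
    have := (rootMultiplicity_pos h0).1 (by omega : 0 < rootMultiplicity z _)
    rw [IsRoot.def, eval_map] at this
    exact this
  have hr' : aeval z (derivative p) ≠ 0 := by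
    intro h
    have h1 : 1 < rootMultiplicity z (p.map (Int.castRingHom ℂ)) := by
      rw [one_lt_rootMultiplicity_iff_isRoot h0]
      refine ⟨?_, ?_⟩
      · rw [IsRoot.def, eval_map]; exact hr
      · rw [derivative_map, IsRoot.def, eval_map]; exact h
    omega
  have hlc : (p.leadingCoeff : ℂ) ≠ 0 := by exact_mod_cast leadingCoeff_ne_zero.2 hp
  have key : F.comp (C p.leadingCoeff * X) = C (p.leadingCoeff ^ (p.natDegree - 1)) * p := by
    have := integralNormalization_eval₂_leadingCoeff_mul hn (C : ℤ →+* ℤ[X]) X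
    rw [eval₂_C_X] at this
    rw [hF, comp, this, C_pow]
  have key2 := congrArg (fun q => aeval z q) key
  have key3 := congrArg (fun q => aeval z (derivative q)) key
  simp only [derivative_comp, derivative_mul, derivative_C, derivative_X, zero_mul, zero_add,
    mul_one, map_mul, aeval_C, aeval_comp, aeval_X, hr, mul_zero] at key2 key3
  refine ⟨by simpa using key2, fun h => ?_⟩
  simp only [algebraMap_int_eq, eq_intCast] at key3
  rw [h] at key3
  simp at key3
  simp_all

lemma abs_coeff_integralNormalization_le (p : ℤ[X]) (H : ℕ) (hn : 1 ≤ p.natDegree)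
    (hH : ∀ i, |p.coeff i| ≤ H) (i : ℕ) :
    |p.integralNormalization.coeff i| ≤ (H ^ p.natDegree : ℕ) := by
  have hp : p ≠ 0 := by rintro rfl; simp at hn
  have h1 : (1 : ℤ) ≤ H := (Int.one_le_abs (leadingCoeff_ne_zero.2 hp)).trans (hH _)
  push_cast
  by_cases hi : i = p.natDegree
  · rw [hi, integralNormalization_coeff_natDegree hp, abs_one]
    exact one_le_pow₀ h1
  · rw [integralNormalization_coeff_ne_natDegree hi, abs_mul, abs_pow]
    calc |p.coeff i| * |p.leadingCoeff| ^ (p.natDegree - 1 - i)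
        ≤ H * (H : ℤ) ^ (p.natDegree - 1 - i) := by
          gcongr
          · exact hH i
          · exact hH _
      _ = (H : ℤ) ^ (p.natDegree - 1 - i + 1) := by ring
      _ ≤ _ := pow_le_pow_right₀ h1 (by omega)

lemma norm_le_exp_of_root (F : ℤ[X]) (hF : F.Monic) (H : ℕ) (hH : 1 ≤ H) (hn : 1 ≤ F.natDegree)
    (hB : ∀ i, |F.coeff i| ≤ (H ^ F.natDegree : ℕ)) (z : ℂ) (hz : aeval z F = 0) :
    ‖z‖ ≤ Real.exp (5 * F.natDegree ^ 2 * H) ∧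
      ‖aeval z (derivative F)‖ ≤ Real.exp (5 * F.natDegree ^ 2 * H) := by
  have h1 := norm_le_two_mul_of_monic F hF _ hB z hz
  have hH' : (1 : ℝ) ≤ H := by exact_mod_cast hH
  have hHe : (H : ℝ) ≤ Real.exp H := by linarith [Real.add_one_le_exp (H : ℝ)]
  set n := F.natDegree with hn'
  have hn1 : (1 : ℝ) ≤ n := by exact_mod_cast hn
  have hne : (n : ℝ) ≤ Real.exp n := by linarith [Real.add_one_le_exp (n : ℝ)]
  have hBe : ((H ^ n : ℕ) : ℝ) ≤ Real.exp (n * H) := by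
    push_cast
    rw [Real.exp_nat_mul]
    gcongr
  have hz1 : ‖z‖ ≤ Real.exp (1 + n * H) := by
    rw [Real.exp_add]
    exact h1.trans (mul_le_mul two_le_exp_one hBe (by positivity) (by positivity))
  have hnH : (n : ℝ) ≤ n ^ 2 * H := by nlinarith [mul_le_mul hn1 hH' (by norm_num) (by positivity)]
  have hnH2 : (n : ℝ) * H ≤ n ^ 2 * H := by
    have : (n : ℝ) ≤ n ^ 2 := by nlinarith
    gcongr
  refine ⟨hz1.trans (Real.exp_le_exp.2 (by nlinarith)), ?_⟩
  have h2 := norm_aeval_derivative_le F _ hB z (Real.exp (1 + n * H))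
    (Real.one_le_exp (by positivity)) hz1
  refine h2.trans ?_
  calc (n : ℝ) * ((H ^ n : ℕ) * n * Real.exp (1 + n * H) ^ n)
      ≤ Real.exp n * (Real.exp (n * H) * Real.exp n * Real.exp (1 + n * H) ^ n) := by gcongr
    _ = Real.exp (n + (n * H + n + n * (1 + n * H))) := by
      rw [← Real.exp_nat_mul, ← Real.exp_add, ← Real.exp_add, ← Real.exp_add]
    _ ≤ _ := Real.exp_le_exp.2 (by nlinarith)

lemma abs_le_of_simple_roots_of_eval_eq_sq (p : ℤ[X]) (H : ℕ) (hn : 3 ≤ p.natDegree)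
    (hH : ∀ i, |p.coeff i| ≤ H) (r : Fin 3 → ℂ) (hinj : Function.Injective r)
    (hr : ∀ i, rootMultiplicity (r i) (p.map (Int.castRingHom ℂ)) = 1) (x y : ℤ)
    (hxy : y ^ 2 = p.eval x) :
    |(x : ℝ)| ≤ Real.exp (Real.exp (Real.exp (p.natDegree ^ 36 * H))) := by
  have hp : p ≠ 0 := by rintro rfl; simp at hn
  have hlc0 := leadingCoeff_ne_zero.2 hp
  have hlcC : (p.leadingCoeff : ℂ) ≠ 0 := by exact_mod_cast hlc0
  have hH1 : 1 ≤ H := by exact_mod_cast (Int.one_le_abs hlc0).trans (hH _)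
  have hH1' : (1 : ℝ) ≤ H := by exact_mod_cast hH1
  set F := p.integralNormalization with hF
  have hFn : F.natDegree = p.natDegree := natDegree_integralNormalization
  have hFm : F.Monic := monic_integralNormalization hp
  have hn3 : (3 : ℝ) ≤ p.natDegree := by exact_mod_cast hn
  have hroot := norm_le_exp_of_root F hFm H hH1 (by omega)
    (by rw [hFn]; exact abs_coeff_integralNormalization_le p H (by omega) hH)
  have hs := fun i => simple_root_scale hF (by omega) (r i) (hr i)
  have heq : F.eval (p.leadingCoeff * x) = p.leadingCoeff ^ (p.natDegree - 1) * y ^ 2 := by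
    rw [hxy]
    exact integralNormalization_eval₂_leadingCoeff_mul (by omega) (RingHom.id ℤ) x
  have hxle : |(x : ℝ)| ≤ |((p.leadingCoeff * x : ℤ) : ℝ)| := by
    push_cast
    rw [abs_mul]
    have : (1 : ℝ) ≤ |(p.leadingCoeff : ℝ)| := by exact_mod_cast Int.one_le_abs hlc0
    nlinarith [abs_nonneg (x : ℝ)]
  rw [hFn] at hroot
  set a : ℝ := 5 * p.natDegree ^ 2 * H with ha
  have ha1 : 1 ≤ a := by nlinarith [mul_le_mul hn3 hn3 (by norm_num) (by positivity)]
  set n := p.natDegree with hn'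
  have hcoef : 4000 * (a * ((2 * n : ℝ) ^ 3) ^ 5) ≤ n ^ 36 * H := by
    have h1 : (3 : ℝ) ^ 19 ≤ n ^ 19 := by gcongr
    calc (4000 : ℝ) * (a * ((2 * n : ℝ) ^ 3) ^ 5) = 655360000 * ((n : ℝ) ^ 17 * H) := by
          rw [ha]
          ring
      _ ≤ (n : ℝ) ^ 19 * ((n : ℝ) ^ 17 * H) := by
        gcongr
        exact le_trans (by norm_num) h1
      _ = _ := by ring
  by_cases hx : ∃ i, ((p.leadingCoeff * x : ℤ) : ℂ) = p.leadingCoeff * r i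
  · obtain ⟨i, hi⟩ := hx
    have h1 := (hroot _ (hs i).1).1
    rw [← hi, Complex.norm_intCast] at h1
    refine hxle.trans (h1.trans (Real.exp_le_exp.2 ?_))
    have h2 : a ≤ 4000 * (a * ((2 * n : ℝ) ^ 3) ^ 5) := by
      have : (1 : ℝ) ≤ ((2 * n : ℝ) ^ 3) ^ 5 := one_le_pow₀ (one_le_pow₀ (by linarith))
      nlinarith
    have h3 := Real.add_one_le_exp ((n : ℝ) ^ 36 * H)
    have h4 := Real.add_one_le_exp (Real.exp ((n : ℝ) ^ 36 * H))
    linarith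
  · push Not at hx
    refine hxle.trans ((abs_le_of_simple_roots F hFm (fun i => p.leadingCoeff * r i)
      (fun i j h => hinj (mul_left_cancel₀ hlcC h)) (p.leadingCoeff * x)
      (p.leadingCoeff ^ (n - 1)) y a ha1 hroot (pow_ne_zero _ hlc0) ?_ (fun i => (hs i).1)
      (fun i => (hs i).2) hx heq).trans ?_)
    · push_cast
      rw [abs_pow]
      have h1 : |(p.leadingCoeff : ℝ)| ≤ H := by exact_mod_cast hH _
      calc |(p.leadingCoeff : ℝ)| ^ (n - 1) ≤ (H : ℝ) ^ (n - 1) := by gcongr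
        _ ≤ (H : ℝ) ^ n := pow_le_pow_right₀ hH1' (by omega)
        _ ≤ Real.exp H ^ n := by
          gcongr
          linarith [Real.add_one_le_exp (H : ℝ)]
        _ = Real.exp (n * H) := by rw [Real.exp_nat_mul]
        _ ≤ _ := by
          rw [Real.exp_le_exp, ha]
          gcongr
          nlinarith
    · rw [hFn]
      gcongr

lemma abs_lt_of_sq_eq_sum {n : ℕ} (hn : 3 ≤ n) {H : ℕ} (hH1 : 1 ≤ H) {a : ℕ → ℤ}
    (hH : ∀ i ∈ range (n + 1), |a i| ≤ H) {x y : ℤ}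
    (hxy : y ^ 2 = ∑ i ∈ range (n + 1), a i * x ^ (n - i)) {u : ℝ} (hu : (n + 1) * H ≤ u)
    (hx : |(x : ℝ)| ≤ Real.exp (Real.exp (Real.exp u))) :
    |(y : ℝ)| < Real.exp (Real.exp (Real.exp (u + 1))) := by
  have hH1' : (1 : ℝ) ≤ H := by exact_mod_cast hH1
  have hn3 : (3 : ℝ) ≤ n := by exact_mod_cast hn
  set E := Real.exp (Real.exp (Real.exp u)) with hE
  have hE1 : 1 ≤ E := Real.one_le_exp (Real.exp_nonneg _)
  have hu1 := Real.add_one_le_exp u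
  have hu2 := Real.add_one_le_exp (Real.exp u)
  have hu3 := Real.add_one_le_exp (Real.exp (Real.exp u))
  have h1 : |(y : ℝ)| ≤ E ^ (n + 1) := by
    have h2 : |(y : ℝ)| ≤ |(y : ℝ)| ^ 2 := by
      have : |y| ≤ |y| ^ 2 := by
        rcases eq_or_ne y 0 with rfl | h
        · simp
        · nlinarith [Int.one_le_abs h]
      exact_mod_cast this
    calc |(y : ℝ)| ≤ |(y : ℝ)| ^ 2 := h2
      _ = |∑ i ∈ range (n + 1), (a i : ℝ) * x ^ (n - i)| := by
        rw [← abs_pow]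
        exact_mod_cast congrArg abs (congrArg (Int.cast : ℤ → ℝ) hxy)
      _ ≤ ∑ i ∈ range (n + 1), |(a i : ℝ) * x ^ (n - i)| := abs_sum_le_sum_abs _ _
      _ ≤ ∑ i ∈ range (n + 1), (H : ℝ) * E ^ n := by
        refine sum_le_sum fun i hi => ?_
        rw [abs_mul, abs_pow]
        have h3 : |(a i : ℝ)| ≤ H := by exact_mod_cast hH i hi
        have h4 : |(x : ℝ)| ^ (n - i) ≤ E ^ n :=
          (pow_le_pow_left₀ (abs_nonneg _) hx _).trans (pow_le_pow_right₀ hE1 (by omega))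
        gcongr
      _ = (n + 1) * H * E ^ n := by simp; ring
      _ ≤ E * E ^ n := by
        gcongr
        linarith
      _ = _ := by ring
  refine h1.trans_lt ?_
  rw [hE, ← Real.exp_nat_mul, Real.exp_lt_exp, Real.exp_add u 1]
  push_cast
  calc ((n : ℝ) + 1) * Real.exp (Real.exp u) < Real.exp (Real.exp u) * Real.exp (Real.exp u) := by
        gcongr
        nlinarith
    _ = Real.exp (Real.exp u * 2) := by rw [← Real.exp_add]; ring_nf
    _ ≤ _ := by
      gcongr
      exact two_le_exp_one

lemma pow_mul_add_one_le {n H : ℕ} (hn : 3 ≤ n) (hH : 1 ≤ H) :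
    (n : ℝ) ^ 36 * H + 1 ≤ ((n : ℝ) ^ (10 * n) * (H : ℝ)) ^ (n ^ 2) := by
  have hH1 : (1 : ℝ) ≤ H := by exact_mod_cast hH
  have hn3 : (3 : ℝ) ≤ n := by exact_mod_cast hn
  have h36 : (1 : ℝ) ≤ n ^ 36 := one_le_pow₀ (by linarith)
  have hexp : 37 ≤ 10 * n * n ^ 2 := by nlinarith [Nat.pow_le_pow_left hn 2]
  rw [mul_pow, ← pow_mul]
  have h1 : (H : ℝ) ≤ H ^ (n ^ 2) := le_self_pow₀ hH1 (by positivity)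
  have h2 : (n : ℝ) ^ 37 ≤ n ^ (10 * n * n ^ 2) := pow_le_pow_right₀ (by linarith) hexp
  calc (n : ℝ) ^ 36 * H + 1 ≤ (n : ℝ) ^ 37 * H := by
        have : (1 : ℝ) ≤ n ^ 36 * H := by nlinarith
        have : (n : ℝ) ^ 37 * H = n * (n ^ 36 * H) := by ring
        nlinarith
    _ ≤ _ := by gcongr

end BakerHyperelliptic

open BakerHyperelliptic

theorem baker_hyperelliptic_bound (n : ℕ) (hn : 3 ≤ n) (a : ℕ → ℤ) (ha : a 0 ≠ 0)
    (p : Polynomial ℤ)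
    (hp : p = ∑ i ∈ Finset.range (n + 1), Polynomial.C (a i) * Polynomial.X ^ (n - i))
    (hroots : ∃ r₁ r₂ r₃ : ℂ, r₁ ≠ r₂ ∧ r₁ ≠ r₃ ∧ r₂ ≠ r₃ ∧
      Polynomial.rootMultiplicity r₁ (p.map (Int.castRingHom ℂ)) = 1 ∧
      Polynomial.rootMultiplicity r₂ (p.map (Int.castRingHom ℂ)) = 1 ∧
      Polynomial.rootMultiplicity r₃ (p.map (Int.castRingHom ℂ)) = 1)
    (H : ℕ) (hH : H = (Finset.range (n + 1)).sup fun i => (a i).natAbs)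
    (x y : ℤ) (hxy : y ^ 2 = ∑ i ∈ Finset.range (n + 1), a i * x ^ (n - i)) :
    ((max |x| |y| : ℤ) : ℝ) <
      Real.exp (Real.exp (Real.exp (((n : ℝ) ^ (10 * n) * (H : ℝ)) ^ (n ^ 2)))) := by
  obtain ⟨r₁, r₂, r₃, h12, h13, h23, hr₁, hr₂, hr₃⟩ := hroots
  have haH : ∀ i ∈ Finset.range (n + 1), |a i| ≤ H := by
    intro i hi
    rw [Int.abs_eq_natAbs, hH]
    exact_mod_cast Finset.le_sup (f := fun i => (a i).natAbs) hi
  have hH1 : 1 ≤ H := by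
    exact_mod_cast (Int.one_le_abs ha).trans (haH 0 (by simp))
  have hcoeff : ∀ k, p.coeff k = if k ≤ n then a (n - k) else 0 := by
    intro k
    rw [hp, ← Finset.sum_range_reflect]
    simp only [Polynomial.finsetSum_coeff, Polynomial.coeff_C_mul_X_pow]
    split_ifs with hk
    · rw [Finset.sum_eq_single k]
      · rw [if_pos (by omega)]
        congr 1
      · intro j hj hjk
        rw [Finset.mem_range] at hj
        rw [if_neg (by omega)]
      · intro h
        exact absurd (Finset.mem_range.2 (by omega)) h
    · refine Finset.sum_eq_zero fun j hj => ?_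
      rw [Finset.mem_range] at hj
      rw [if_neg (by omega)]
  have hdeg : p.natDegree = n := by
    refine Polynomial.natDegree_eq_of_le_of_coeff_ne_zero ?_ ?_
    · refine Polynomial.natDegree_le_iff_coeff_eq_zero.2 fun k hk => ?_
      rw [hcoeff, if_neg (by omega)]
    · simpa [hcoeff] using ha
  have hpH : ∀ k, |p.coeff k| ≤ H := by
    intro k
    rw [hcoeff]
    split_ifs
    · exact haH _ (Finset.mem_range.2 (by omega))
    · simp
  have heval : y ^ 2 = p.eval x := by
    rw [hxy, hp]
    simp [Polynomial.eval_finsetSum]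
  have hx := abs_le_of_simple_roots_of_eval_eq_sq p H (by omega) hpH ![r₁, r₂, r₃]
    (by
      intro i j h
      fin_cases i <;> fin_cases j <;> simp_all)
    (by
      intro i
      fin_cases i
      exacts [hr₁, hr₂, hr₃]) x y heval
  rw [hdeg] at hx
  have hu : ((n : ℝ) + 1) * H ≤ n ^ 36 * H := by
    have h3 : (3 : ℝ) ≤ n := by exact_mod_cast hn
    have h2 : (n : ℝ) ^ 2 ≤ n ^ 36 := pow_le_pow_right₀ (by linarith) (by norm_num)
    gcongr
    nlinarith
  have hy := abs_lt_of_sq_eq_sum hn hH1 haH hxy hu hx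
  have hx' : |(x : ℝ)| < Real.exp (Real.exp (Real.exp ((n : ℝ) ^ 36 * H + 1))) := by
    refine hx.trans_lt ?_
    gcongr
    linarith
  have hle := Real.exp_le_exp.2 (Real.exp_le_exp.2 (Real.exp_le_exp.2 (pow_mul_add_one_le hn hH1)))
  push_cast
  exact max_lt (hx'.trans_le hle) (hy.trans_le hle)
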